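/- arXiv:math/0003195 — 3 statements merged into one kernel-verified Lean document; each statement's English description precedes it below -/
import Mathlib

section
/- Let F_q be a finite field with q elements. Then the proportion of matrices A in GL(n,q) whose minimal polynomial is squarefree (semisimple matrices, i.e. diagonalizable over the algebraic closure of F_q) converges as n → ∞ to ∏_{r ≥ 1, r ≡ 0, ±2 (mod 5)} (1 − q^{−(r−1)})/(1 − q^{−r}). -/
section
open Finset

noncomputable def ssPoc (x : ℝ) (n : ℕ) : ℝ := ∏ i ∈ range n, (1 - x ^ (i + 1))

noncomputable def ssE (x : ℝ) (n : ℤ) : ℝ := if 0 ≤ n then (ssPoc x n.toNat)⁻¹ else 0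

lemma ssPoc_pos {x : ℝ} (h0 : 0 < x) (h1 : x < 1) (n : ℕ) : 0 < ssPoc x n :=
  Finset.prod_pos fun i _ => by
    have : x ^ (i + 1) < 1 := pow_lt_one₀ h0.le h1 (by omega)
    linarith

lemma ssE_natCast (x : ℝ) (n : ℕ) : ssE x n = (ssPoc x n)⁻¹ := by simp [ssE]

lemma ssE_neg (x : ℝ) {n : ℤ} (h : n < 0) : ssE x n = 0 := by
  simp [ssE, not_le.mpr h]

lemma ssE_zero (x : ℝ) : ssE x 0 = 1 := by simp [ssE, ssPoc]

lemma ssE_rec {x : ℝ} (h0 : 0 < x) (h1 : x < 1) (n : ℤ) :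
    ssE x n * (1 - x ^ n) = ssE x (n - 1) := by
  rcases lt_trichotomy n 0 with h | h | h
  · rw [ssE_neg x h, ssE_neg x (by omega)]; simp
  · subst h; rw [ssE_neg x (n := 0 - 1) (by omega)]; simp
  · obtain ⟨k, rfl⟩ : ∃ k : ℕ, n = (k : ℤ) + 1 := ⟨(n - 1).toNat, by omega⟩
    have e1 : ssE x ((k : ℤ) + 1) = (ssPoc x (k + 1))⁻¹ := by
      exact_mod_cast ssE_natCast x (k + 1)
    have e2 : x ^ ((k : ℤ) + 1) = x ^ (k + 1) := by exact_mod_cast zpow_natCast x (k + 1)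
    have hk := (ssPoc_pos h0 h1 k).ne'
    have hk1 : (1 - x ^ (k + 1)) ≠ 0 := by
      have : x ^ (k + 1) < 1 := pow_lt_one₀ h0.le h1 (by omega)
      linarith
    rw [e1, e2, add_sub_cancel_right, ssE_natCast]
    have : ssPoc x (k + 1) = ssPoc x k * (1 - x ^ (k + 1)) := by
      simp [ssPoc, Finset.prod_range_succ]
    rw [this]; field_simp

/-- Durfee rectangle identity. -/
lemma ss_durfee {x : ℝ} (h0 : 0 < x) (h1 : x < 1) (m : ℕ) : ∀ a : ℕ,
    ∑ k ∈ range (m + 1), x ^ (k * (k + a)) * ssE x (m - k) * ssE x k * ssE x (k + a)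
      = ssE x m * ssE x (m + a) := by
  induction m with
  | zero => intro a; simp [ssE_zero]
  | succ m ih =>
    intro a
    have hx : x ≠ 0 := h0.ne'
    have hm1 : (1 - x ^ ((m : ℤ) + 1)) ≠ 0 := by
      have : x ^ (m + 1) < 1 := pow_lt_one₀ h0.le h1 (by omega)
      have e2 : x ^ ((m : ℤ) + 1) = x ^ (m + 1) := by exact_mod_cast zpow_natCast x (m + 1)
      rw [e2]; linarith
    apply mul_right_cancel₀ hm1
    have key : ∀ k : ℕ, 
      x ^ (k * (k + a)) * ssE x (((m + 1 : ℕ) : ℤ) - k) * ssE x k * ssE x (k + a) * (1 - x ^ ((m : ℤ) + 1))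
      = x ^ (k * (k + a)) * ssE x ((m : ℤ) - k) * ssE x k * ssE x (k + a) + 
        x ^ (k * (k + a)) * (x ^ ((m : ℤ) + 1 - k) * ssE x ((m : ℤ) + 1 - k) * ssE x ((k : ℤ) - 1) * ssE x (k + a)) := by
      intro k
      have r1 := ssE_rec h0 h1 ((m : ℤ) + 1 - k)
      have r2 := ssE_rec h0 h1 (k : ℤ)
      have hs : x ^ ((m : ℤ) + 1) = x ^ ((m : ℤ) + 1 - k) * x ^ (k : ℤ) := by
        rw [← zpow_add₀ hx]; congr 1; ring
      have : (m : ℤ) + 1 - k - 1 = m - k := by ring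
      rw [this] at r1
      rw [← r1, ← r2, hs]; push_cast; ring
    rw [Finset.sum_mul, Finset.sum_congr rfl (fun k _ => key k), Finset.sum_add_distrib]
    rw [Finset.sum_range_succ, ih a]
    rw [ssE_neg x (n := (m : ℤ) - ((m + 1 : ℕ) : ℤ)) (by push_cast; omega)]
    rw [Finset.sum_range_succ']
    have : ∀ k : ℕ, x ^ ((k + 1) * ((k + 1) + a)) * (x ^ ((m : ℤ) + 1 - ((k + 1 : ℕ) : ℤ)) * ssE x ((m : ℤ) + 1 - ((k + 1 : ℕ) : ℤ)) * ssE x (((k + 1 : ℕ) : ℤ) - 1) * ssE x (((k + 1 : ℕ) : ℤ) + a))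
      = x ^ (m + a + 1) * (x ^ (k * (k + (a + 1))) * ssE x (m - k) * ssE x k * ssE x (k + (a + 1 : ℕ))) := by
      intro k
      have a1 : (m : ℤ) + 1 - ((k + 1 : ℕ) : ℤ) = m - k := by push_cast; ring
      have a2 : (((k + 1 : ℕ) : ℤ) - 1) = k := by push_cast; ring
      have a3 : (((k + 1 : ℕ) : ℤ) + a) = k + (a + 1 : ℕ) := by push_cast; ring
      rw [a1, a2, a3]
      have : x ^ ((k + 1) * ((k + 1) + a)) * x ^ ((m : ℤ) - k) = x ^ (m + a + 1) * x ^ (k * (k + (a + 1))) := by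
        rw [← zpow_natCast, ← zpow_natCast, ← zpow_natCast, ← zpow_add₀ hx, ← zpow_add₀ hx]
        congr 1; push_cast; ring
      linear_combination (ssE x (m - k) * ssE x k * ssE x (k + (a + 1 : ℕ))) * this
    rw [Finset.sum_congr rfl (fun k _ => this k), ← Finset.mul_sum, ih (a + 1)]
    rw [ssE_neg x (n := ((0 : ℕ) : ℤ) - 1) (by norm_num)]
    have r1 := ssE_rec h0 h1 ((m : ℤ) + 1)
    have r2 := ssE_rec h0 h1 ((m : ℤ) + 1 + a)
    have a1 : (m : ℤ) + 1 - 1 = m := by ring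
    have a2 : (m : ℤ) + 1 + a - 1 = m + a := by ring
    have a3 : (m : ℤ) + (a + 1 : ℕ) = m + 1 + a := by push_cast; ring
    have a4 : x ^ ((m : ℤ) + 1 + a) = x ^ (m + a + 1) := by
      rw [← zpow_natCast]; congr 1; push_cast; ring
    rw [a1] at r1; rw [a2] at r2; rw [a3, ← r1, ← r2, a4]
    push_cast; ring

lemma ss_qbinom {x : ℝ} (h0 : 0 < x) (h1 : x < 1) (n : ℕ) : ∀ w : ℝ,
    ∑ k ∈ range (n + 1), (-1) ^ k * x ^ (k.choose 2) * w ^ k * ssE x k * ssE x (n - k)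
      = (∏ i ∈ range n, (1 - w * x ^ i)) * ssE x n := by
  induction n with
  | zero => intro w; simp [ssE_zero]
  | succ n ih =>
    intro w
    have hx : x ≠ 0 := h0.ne'
    have hm1 : (1 - x ^ ((n : ℤ) + 1)) ≠ 0 := by
      have : x ^ (n + 1) < 1 := pow_lt_one₀ h0.le h1 (by omega)
      have e2 : x ^ ((n : ℤ) + 1) = x ^ (n + 1) := by exact_mod_cast zpow_natCast x (n + 1)
      rw [e2]; linarith
    apply mul_right_cancel₀ hm1
    have key : ∀ k : ℕ,
      (-1) ^ k * x ^ (k.choose 2) * w ^ k * ssE x k * ssE x (((n + 1 : ℕ) : ℤ) - k) * (1 - x ^ ((n : ℤ) + 1))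
      = (-1) ^ k * x ^ (k.choose 2) * (w * x) ^ k * ssE x k * ssE x (n - k) +
        (-1) ^ k * x ^ (k.choose 2) * w ^ k * ssE x ((k : ℤ) - 1) * ssE x ((n : ℤ) + 1 - k) := by
      intro k
      have r1 := ssE_rec h0 h1 ((n : ℤ) + 1 - k)
      have r2 := ssE_rec h0 h1 (k : ℤ)
      have hs : x ^ ((n : ℤ) + 1) = x ^ ((n : ℤ) + 1 - k) * x ^ (k : ℤ) := by
        rw [← zpow_add₀ hx]; congr 1; ring
      have : (n : ℤ) + 1 - k - 1 = n - k := by ring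
      rw [this] at r1
      rw [← r1, ← r2, hs, mul_pow, zpow_natCast]; push_cast; ring
    rw [Finset.sum_mul, Finset.sum_congr rfl (fun k _ => key k), Finset.sum_add_distrib]
    rw [Finset.sum_range_succ, ih (w * x)]
    rw [ssE_neg x (n := (n : ℤ) - ((n + 1 : ℕ) : ℤ)) (by push_cast; omega)]
    rw [Finset.sum_range_succ']
    have : ∀ k : ℕ, (-1) ^ (k + 1) * x ^ ((k + 1).choose 2) * w ^ (k + 1) * ssE x (((k + 1 : ℕ) : ℤ) - 1) * ssE x ((n : ℤ) + 1 - ((k + 1 : ℕ) : ℤ))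
      = (-w) * ((-1) ^ k * x ^ (k.choose 2) * (w * x) ^ k * ssE x k * ssE x (n - k)) := by
      intro k
      have a1 : (n : ℤ) + 1 - ((k + 1 : ℕ) : ℤ) = n - k := by push_cast; ring
      have a2 : (((k + 1 : ℕ) : ℤ) - 1) = k := by push_cast; ring
      rw [a1, a2]
      have : (k + 1).choose 2 = k + k.choose 2 := by
        rw [Nat.choose_succ_succ' k 1]; simp
      rw [this, pow_add x, mul_pow]; ring
    rw [Finset.sum_congr rfl (fun k _ => this k), ← Finset.mul_sum, ih (w * x)]
    rw [ssE_neg x (n := ((0 : ℕ) : ℤ) - 1) (by norm_num)]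
    have r1 := ssE_rec h0 h1 ((n : ℤ) + 1)
    have a1 : (n : ℤ) + 1 - 1 = n := by ring
    rw [a1] at r1
    rw [Finset.prod_range_succ']
    have : ∏ i ∈ range n, (1 - w * x ^ (i + 1)) = ∏ i ∈ range n, (1 - w * x * x ^ i) :=
      Finset.prod_congr rfl fun i _ => by rw [pow_succ']; ring
    rw [this, ← r1]
    push_cast; ring
end

section
open Finset Filter Topology

noncomputable def ssB (x : ℝ) (α : ℤ → ℝ) (N : ℕ) : ℝ :=
  ∑ j ∈ Icc (-(N : ℤ)) N, α j * (ssE x (N - j) * ssE x (N + j))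

lemma ss_aux_prod {x z : ℝ} (hx : x ≠ 0) (hz : z ≠ 0) (N : ℕ) :
    (-1) ^ N * (z ^ N)⁻¹ * x ^ ((N + 1).choose 2) *
      ∏ i ∈ range (2 * N), (1 - z * (x ^ N)⁻¹ * x ^ i) =
    ∏ i ∈ range N, ((1 - z * x ^ i) * (1 - x ^ (i + 1) / z)) := by
  rw [two_mul, Finset.prod_range_add, ← Finset.prod_range_reflect (fun i => (1 - z * (x ^ N)⁻¹ * x ^ i)),
    Finset.prod_mul_distrib]
  have e1 : ∏ i ∈ range N, (1 - z * (x ^ N)⁻¹ * x ^ (N + i)) = ∏ i ∈ range N, (1 - z * x ^ i) := by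
    refine Finset.prod_congr rfl fun i _ => ?_
    rw [pow_add]; field_simp
  have e2 : ∏ i ∈ range N, (1 - z * (x ^ N)⁻¹ * x ^ (N - 1 - i)) =
      ∏ i ∈ range N, ((-(z * (x ^ (i + 1))⁻¹)) * (1 - x ^ (i + 1) / z)) := by
    refine Finset.prod_congr rfl fun i hi => ?_
    have hi := Finset.mem_range.mp hi
    have : x ^ N = x ^ (N - 1 - i) * x ^ (i + 1) := by rw [← pow_add]; congr 1; omega
    rw [this]; field_simp; ring
  have e3 : ∀ N : ℕ, (-1) ^ N * (z ^ N)⁻¹ * x ^ ((N + 1).choose 2) *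
      ∏ i ∈ range N, (-(z * (x ^ (i + 1))⁻¹)) = 1 := by
    intro N
    induction N with
    | zero => simp
    | succ N ih =>
      rw [Finset.prod_range_succ]
      have : (N + 1 + 1).choose 2 = (N + 1) + (N + 1).choose 2 := by
        rw [Nat.choose_succ_succ' (N + 1) 1]; simp
      rw [this, pow_add x]
      calc _ = ((-1) ^ N * (z ^ N)⁻¹ * x ^ ((N + 1).choose 2) *
              ∏ i ∈ range N, (-(z * (x ^ (i + 1))⁻¹))) := by
            field_simp
            ring
        _ = 1 := ih
  rw [e1, e2, Finset.prod_mul_distrib]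
  linear_combination (∏ i ∈ range N, (1 - z * x ^ i)) * (∏ i ∈ range N, (1 - x ^ (i + 1) / z)) * e3 N

lemma ss_triple_fin {x : ℝ} (h0 : 0 < x) (h1 : x < 1) {z : ℝ} (hz : z ≠ 0) (N : ℕ) :
    ssB x (fun j => (-1) ^ j * z ^ j * x ^ (j * (j - 1) / 2)) N =
    (∏ i ∈ range N, ((1 - z * x ^ i) * (1 - x ^ (i + 1) / z))) * ssE x (2 * N) := by
  have hx := h0.ne'
  have := ss_qbinom h0 h1 (2 * N) (z * (x ^ N)⁻¹)
  have h2 : ssE x (2 * (N : ℤ)) = ssE x ((2 * N : ℕ) : ℤ) := by push_cast; rfl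
  rw [← ss_aux_prod hx hz, h2, mul_assoc, ← this, ssB, Finset.mul_sum]
  refine Finset.sum_bij' (fun j _ => (j + N).toNat) (fun i _ => (i : ℤ) - N) ?_ ?_ ?_ ?_ ?_
  · intro j hj; simp only [Finset.mem_Icc, Finset.mem_range] at *; omega
  · intro j hj; simp only [Finset.mem_Icc, Finset.mem_range] at *; omega
  · intro j hj; simp only [Finset.mem_Icc, Finset.mem_range] at *; omega
  · intro j hj; simp only [Finset.mem_range] at *; omega
  · intro j hj
    simp only [Finset.mem_Icc] at hj
    obtain ⟨i, hi⟩ : ∃ i : ℕ, j = (i : ℤ) - N := ⟨(j + N).toNat, by omega⟩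
    subst hi
    have a0 : ((i : ℤ) - N + N).toNat = i := by omega
    have a1 : (N : ℤ) - (i - N) = ((2 * N : ℕ) : ℤ) - i := by push_cast; ring
    have a2 : (N : ℤ) + (i - N) = i := by ring
    have hc : ∀ k : ℕ, ((k.choose 2 : ℕ) : ℤ) * 2 = k * (k - 1) := by
      intro k
      induction k with
      | zero => simp
      | succ k ih =>
        rw [Nat.choose_succ_succ' k 1]; push_cast; simp; linarith
    have a3 : ((i : ℤ) - N) * ((i : ℤ) - N - 1) / 2 = (((N + 1).choose 2 : ℕ) : ℤ) + ((i.choose 2 : ℕ) : ℤ) - N * i := by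
      have c1 := hc i
      have c2 := hc (N + 1)
      push_cast at c2
      apply Int.ediv_eq_of_eq_mul_left (by norm_num)
      linear_combination -c1 - c2
    rw [a0, a1, a2, a3, zpow_sub₀ hx, zpow_add₀ hx, zpow_natCast, zpow_natCast, mul_pow, inv_pow,
      ← pow_mul, ← Nat.cast_mul, zpow_natCast, zpow_sub₀ hz, zpow_sub₀ (by norm_num : (-1 : ℝ) ≠ 0), 
      zpow_natCast, zpow_natCast, zpow_natCast, zpow_natCast]
    have : ((-1 : ℝ) ^ N)⁻¹ = (-1) ^ N := by rw [← inv_pow]; norm_num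
    simp only [div_eq_mul_inv, this]
    ring

lemma ss_bailey_inner {x : ℝ} (h0 : 0 < x) (h1 : x < 1) (N : ℕ) (a : ℕ) (ha : a ≤ N) :
    ∑ s ∈ range (N + 1), x ^ (s ^ 2) * ssE x (N - s) * (ssE x (s - a) * ssE x (s + a)) =
      x ^ (a ^ 2) * (ssE x (N - a) * ssE x (N + a)) := by
  obtain ⟨m, rfl⟩ := Nat.exists_eq_add_of_le ha
  rw [add_assoc, Finset.sum_range_add, Finset.sum_eq_zero, zero_add]
  · have := ss_durfee h0 h1 m (2 * a)
    have b1 : (((a + m : ℕ) : ℤ) - a) = m := by push_cast; ring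
    have b2 : (((a + m : ℕ) : ℤ) + a) = m + (2 * a : ℕ) := by push_cast; ring
    rw [b1, b2, ← this, Finset.mul_sum]
    refine Finset.sum_congr rfl fun k _ => ?_
    have b3 : (((a + m : ℕ) : ℤ) - (a + k : ℕ)) = m - k := by push_cast; ring
    have b4 : (((a + k : ℕ) : ℤ) - a) = k := by push_cast; ring
    have b5 : (((a + k : ℕ) : ℤ) + a) = k + (2 * a : ℕ) := by push_cast; ring
    rw [b3, b4, b5]
    have : x ^ ((a + k) ^ 2) = x ^ (a ^ 2) * x ^ (k * (k + 2 * a)) := by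
      rw [← pow_add]; congr 1; ring
    rw [this]; ring
  · intro s hs
    have := Finset.mem_range.mp hs
    rw [ssE_neg x (n := (s : ℤ) - a) (by omega)]; ring

lemma ss_bailey_inner' {x : ℝ} (h0 : 0 < x) (h1 : x < 1) (N : ℕ) (j : ℤ) (hj : j ∈ Icc (-(N : ℤ)) N) :
    ∑ s ∈ range (N + 1), x ^ (s ^ 2) * ssE x (N - s) * (ssE x (s - j) * ssE x (s + j)) =
      x ^ (j ^ 2) * (ssE x (N - j) * ssE x (N + j)) := by
  simp only [Finset.mem_Icc] at hj
  obtain ⟨a, rfl | rfl⟩ := j.eq_nat_or_neg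
  · rw [ss_bailey_inner h0 h1 N a (by omega)]
    norm_cast
  · have := ss_bailey_inner h0 h1 N a (by omega)
    simp only [sub_neg_eq_add, ← sub_eq_add_neg, neg_sq]
    rw [mul_comm (ssE x _) (ssE x (N - a))]
    rw [show x ^ ((a : ℤ) ^ 2) = x ^ (a ^ 2) by norm_cast, ← this]
    refine Finset.sum_congr rfl fun s _ => ?_
    ring

lemma ssB_eq_of_le {x : ℝ} (α : ℤ → ℝ) {s N : ℕ} (h : s ≤ N) :
    ssB x α s = ∑ j ∈ Icc (-(N : ℤ)) N, α j * (ssE x (s - j) * ssE x (s + j)) := by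
  rw [ssB]
  refine Finset.sum_subset ?_ ?_
  · intro j; simp only [Finset.mem_Icc]; omega
  · intro j _ hj
    simp only [Finset.mem_Icc, not_and_or] at hj
    rcases hj with hj | hj
    · rw [ssE_neg x (n := (s : ℤ) + j) (by omega)]; ring
    · rw [ssE_neg x (n := (s : ℤ) - j) (by omega)]; ring

lemma ss_bailey {x : ℝ} (h0 : 0 < x) (h1 : x < 1) (α : ℤ → ℝ) (N : ℕ) :
    ∑ s ∈ range (N + 1), x ^ (s ^ 2) * ssE x (N - s) * ssB x α s =
      ssB x (fun j => x ^ (j ^ 2) * α j) N := by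
  have : ∀ s ∈ range (N + 1), x ^ (s ^ 2) * ssE x (N - s) * ssB x α s =
      ∑ j ∈ Icc (-(N : ℤ)) N, α j * (x ^ (s ^ 2) * ssE x (N - s) * (ssE x (s - j) * ssE x (s + j))) := by
    intro s hs
    rw [ssB_eq_of_le α (Nat.lt_succ_iff.mp (Finset.mem_range.mp hs)), Finset.mul_sum]
    exact Finset.sum_congr rfl fun j _ => by ring
  rw [Finset.sum_congr rfl this, Finset.sum_comm, ssB]
  refine Finset.sum_congr rfl fun j hj => ?_
  rw [← Finset.mul_sum, ss_bailey_inner' h0 h1 N j hj]; ring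

noncomputable def ssAlpha (x : ℝ) (j : ℤ) : ℝ := (-1) ^ j * (x ^ 2) ^ j * (x ^ 5) ^ (j * (j - 1) / 2)

lemma ss_rr_fin {x : ℝ} (h0 : 0 < x) (h1 : x < 1) (N : ℕ) :
    ∑ s ∈ range (N + 1), x ^ (s ^ 2) * ssE x s * ssE x (N - s) = ssB x (ssAlpha x) N := by
  have hx := h0.ne'
  set α0 : ℤ → ℝ := (fun j => (-1) ^ j * 1 ^ j * x ^ (j * (j - 1) / 2)) with hα0
  have hb0 : ∀ N : ℕ, ssB x α0 N = if N = 0 then 1 else 0 := by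
    intro N
    rw [hα0, ss_triple_fin h0 h1 one_ne_zero]
    split_ifs with h
    · subst h; simp [ssE_zero]
    · rw [Finset.prod_eq_zero (i := 0)] <;> simp; omega
  have hb1 : ∀ N : ℕ, ssB x (fun j => x ^ (j ^ 2) * α0 j) N = ssE x N := by
    intro N
    rw [← ss_bailey h0 h1, Finset.sum_eq_single 0]
    · simp [hb0]
    · intro s _ hs; simp [hb0, hs]
    · simp
  have := ss_bailey h0 h1 (fun j => x ^ (j ^ 2) * α0 j) N
  simp only [hb1] at this
  have e : ssAlpha x = fun j => x ^ (j ^ 2) * (x ^ (j ^ 2) * α0 j) := by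
    funext j
    have hd : j * (j - 1) / 2 * 2 = j * (j - 1) := by
      have : Even (j * (j - 1)) := Int.even_mul_pred_self j
      exact Int.ediv_mul_cancel this.two_dvd
    simp only [ssAlpha, hα0, one_zpow, mul_one]
    have : ∀ n : ℕ, (x ^ n) = x ^ (n : ℤ) := fun n => (zpow_natCast x n).symm
    rw [this 2, this 5, ← zpow_mul, ← zpow_mul]
    have : x ^ (((2 : ℕ) : ℤ) * j) * x ^ (((5 : ℕ) : ℤ) * (j * (j - 1) / 2)) =
        x ^ (j ^ 2) * x ^ (j ^ 2) * x ^ (j * (j - 1) / 2) := by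
      rw [← zpow_add₀ hx, ← zpow_add₀ hx, ← zpow_add₀ hx]; congr 1
      push_cast; linear_combination 2 * hd
    linear_combination (-1) ^ j * this
  rw [e, ← this]
  exact Finset.sum_congr rfl fun s _ => by ring
end

section
open Finset Filter Topology

lemma ssPoc_tendsto {x : ℝ} (h0 : 0 < x) (h1 : x < 1) :
    ∃ P : ℝ, 0 < P ∧ Tendsto (ssPoc x) atTop (𝓝 P) ∧ ∀ n, P ≤ ssPoc x n := by
  have hanti : Antitone (ssPoc x) := by
    apply antitone_nat_of_succ_le
    intro n
    have : ssPoc x (n + 1) = ssPoc x n * (1 - x ^ (n + 1)) := by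
      simp [ssPoc, Finset.prod_range_succ]
    rw [this]
    have h2 : 0 < x ^ (n + 1) := by positivity
    nlinarith [ssPoc_pos h0 h1 n]
  have hs : Summable (fun i : ℕ => ‖-(x ^ (i + 1))‖) := by
    simp only [norm_neg, pow_succ, norm_mul, norm_pow]
    exact (summable_geometric_of_lt_one (norm_nonneg _) (by rwa [Real.norm_of_nonneg h0.le])).mul_right _
  have hne : ∏' i : ℕ, (1 + -(x ^ (i + 1))) ≠ 0 := by
    apply tprod_one_add_ne_zero_of_summable _ hs
    intro i
    have : x ^ (i + 1) < 1 := pow_lt_one₀ h0.le h1 (by omega)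
    linarith
  have hm := (multipliable_one_add_of_summable hs).hasProd.tendsto_prod_nat
  simp only [← sub_eq_add_neg] at hm hne
  have hle : ∀ n, ∏' i : ℕ, (1 - x ^ (i + 1)) ≤ ssPoc x n := fun n => hanti.le_of_tendsto hm n
  refine ⟨_, lt_of_le_of_ne ?_ hne.symm, hm, hle⟩
  exact ge_of_tendsto' hm fun n => (ssPoc_pos h0 h1 n).le

lemma ssE_nonneg {x : ℝ} (h0 : 0 < x) (h1 : x < 1) (n : ℤ) : 0 ≤ ssE x n := by
  rw [ssE]; split_ifs
  · exact inv_nonneg.mpr (ssPoc_pos h0 h1 _).le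
  · exact le_rfl

lemma ssE_le {x P : ℝ} (hP : 0 < P) (h : ∀ n, P ≤ ssPoc x n) (n : ℤ) : ssE x n ≤ P⁻¹ := by
  rw [ssE]; split_ifs
  · exact inv_anti₀ hP (h _)
  · positivity

lemma ssE_tendsto {x P : ℝ} (hP : 0 < P) (h : Tendsto (ssPoc x) atTop (𝓝 P)) (a : ℤ) :
    Tendsto (fun N : ℕ => ssE x (N + a)) atTop (𝓝 P⁻¹) := by
  have h1 : Tendsto (fun N : ℕ => ((N : ℤ) + a).toNat) atTop atTop := by
    apply tendsto_atTop.mpr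
    intro b
    filter_upwards [eventually_ge_atTop (b + a.natAbs)] with n hn
    omega
  have h2 := (h.inv₀ hP.ne').comp h1
  refine h2.congr' ?_
  filter_upwards [eventually_ge_atTop a.natAbs] with n hn
  simp only [Function.comp, ssE]
  rw [if_pos (by omega)]

lemma ssB_tendsto {x P : ℝ} (h0 : 0 < x) (h1 : x < 1) (hP : 0 < P)
    (h : Tendsto (ssPoc x) atTop (𝓝 P)) (hle : ∀ n, P ≤ ssPoc x n) {α : ℤ → ℝ}
    (hα : Summable (fun j => |α j|)) :
    Tendsto (ssB x α) atTop (𝓝 ((∑' j, α j) * (P⁻¹ * P⁻¹))) := by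
  have e : ssB x α = fun N : ℕ => ∑' j : ℤ, α j * (ssE x (N - j) * ssE x (N + j)) := by
    funext N
    rw [tsum_eq_sum (s := Icc (-(N : ℤ)) N)]
    · rfl
    · intro j hj
      simp only [Finset.mem_Icc, not_and_or] at hj
      rcases hj with hj | hj
      · rw [ssE_neg x (n := (N : ℤ) + j) (by omega)]; ring
      · rw [ssE_neg x (n := (N : ℤ) - j) (by omega)]; ring
  rw [e, ← tsum_mul_right]
  refine tendsto_tsum_of_dominated_convergence (hα.mul_right (P⁻¹ * P⁻¹)) ?_ ?_
  · intro j
    exact tendsto_const_nhds.mul ((ssE_tendsto hP h (-j)).mul (ssE_tendsto hP h j))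
  · refine Eventually.of_forall fun N j => ?_
    rw [norm_mul, Real.norm_eq_abs, norm_mul, Real.norm_of_nonneg (ssE_nonneg h0 h1 _),
      Real.norm_of_nonneg (ssE_nonneg h0 h1 _)]
    have := ssE_le hP hle (N - j)
    have := ssE_le hP hle (N + j)
    have := ssE_nonneg h0 h1 (N - j)
    have := ssE_nonneg h0 h1 (N + j)
    gcongr

lemma ssAlpha_summable {x : ℝ} (h0 : 0 < x) (h1 : x < 1) : Summable (fun j => |ssAlpha x j|) := by
  have hs : Summable (fun j : ℤ => x ^ j.natAbs) := by
    apply Summable.of_nat_of_neg <;> simpa using summable_geometric_of_lt_one h0.le h1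
  refine Summable.of_nonneg_of_le (fun _ => abs_nonneg _) (fun j => ?_) hs
  have hd : j * (j - 1) / 2 * 2 = j * (j - 1) := by
    have : Even (j * (j - 1)) := Int.even_mul_pred_self j
    exact Int.ediv_mul_cancel this.two_dvd
  rw [ssAlpha, abs_mul, abs_mul, abs_zpow, abs_neg, abs_one, one_zpow, one_mul,
    abs_of_pos (by positivity), abs_of_pos (by positivity)]
  have : ∀ n : ℕ, (x ^ n) = x ^ (n : ℤ) := fun n => (zpow_natCast x n).symm
  rw [this 2, this 5, ← zpow_mul, ← zpow_mul, this, ← zpow_add₀ h0.ne']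
  apply zpow_le_zpow_right_of_le_one₀ h0 h1.le
  rcases le_total 0 j with hj | hj
  · have : ((j.natAbs : ℕ) : ℤ) = j := by omega
    rw [this]; push_cast
    rcases hj.eq_or_lt with rfl | hj
    · simp
    · nlinarith
  · have : ((j.natAbs : ℕ) : ℤ) = -j := by omega
    rw [this]; push_cast
    rcases hj.eq_or_lt with rfl | hj
    · simp
    · nlinarith

/-- The first Rogers–Ramanujan identity. -/
lemma ss_rogers_ramanujan {x : ℝ} (h0 : 0 < x) (h1 : x < 1) :
    Summable (fun s : ℕ => x ^ (s ^ 2) * ssE x s) ∧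
    Tendsto (fun M : ℕ => ∏ m ∈ range M, ((1 - x ^ (5 * m + 1)) * (1 - x ^ (5 * m + 4)))⁻¹) atTop
      (𝓝 (∑' s : ℕ, x ^ (s ^ 2) * ssE x s)) := by
  obtain ⟨P, hP, hPt, hPle⟩ := ssPoc_tendsto h0 h1
  have h05 : 0 < x ^ 5 := by positivity
  have h15 : x ^ 5 < 1 := pow_lt_one₀ h0.le h1 (by norm_num)
  obtain ⟨P5, hP5, hP5t, hP5le⟩ := ssPoc_tendsto h05 h15
  have hα := ssAlpha_summable h0 h1
  have t1 := ssB_tendsto h0 h1 hP hPt hPle hα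
  have t5 := ssB_tendsto h05 h15 hP5 hP5t hP5le hα
  have hsum' : Summable (fun s : ℕ => x ^ (s ^ 2)) := by
    refine Summable.of_nonneg_of_le (fun _ => by positivity) (fun s => ?_)
      (summable_geometric_of_lt_one h0.le h1)
    exact pow_le_pow_of_le_one h0.le h1.le (by nlinarith)
  have hsum : Summable (fun s : ℕ => x ^ (s ^ 2) * ssE x s) := by
    refine Summable.of_nonneg_of_le (fun s => mul_nonneg (by positivity) (ssE_nonneg h0 h1 _)) (fun s => ?_)
      (hsum'.mul_right P⁻¹)
    have := ssE_le hP hPle s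
    gcongr
  refine ⟨hsum, ?_⟩
  have t2 : Tendsto (ssB x (ssAlpha x)) atTop (𝓝 ((∑' s : ℕ, x ^ (s ^ 2) * ssE x s) * P⁻¹)) := by
    have e : ssB x (ssAlpha x) = fun N : ℕ => ∑' s : ℕ, x ^ (s ^ 2) * ssE x s * ssE x (N - s) := by
      funext N
      rw [← ss_rr_fin h0 h1, tsum_eq_sum]
      intro s hs
      simp only [Finset.mem_range] at hs
      rw [ssE_neg x (n := (N : ℤ) - s) (by omega)]; ring
    rw [e, ← tsum_mul_right]
    refine tendsto_tsum_of_dominated_convergence (hsum.mul_right P⁻¹) ?_ ?_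
    · intro j
      exact tendsto_const_nhds.mul (ssE_tendsto hP hPt (-j))
    · refine Eventually.of_forall fun N j => ?_
      have a1 := ssE_nonneg h0 h1 j
      have a2 := ssE_nonneg h0 h1 (N - j)
      rw [Real.norm_of_nonneg (by positivity)]
      have := ssE_le hP hPle (N - j)
      gcongr
  have hA := tendsto_nhds_unique t1 t2
  have hA' : (∑' s : ℕ, x ^ (s ^ 2) * ssE x s) = (∑' j, ssAlpha x j) * P⁻¹ := by
    field_simp at hA ⊢; linarith
  rw [hA']
  have t6 : Tendsto (fun M : ℕ => (∏ i ∈ range M, ((1 - x ^ (5 * i + 2)) * (1 - x ^ (5 * i + 3))))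
      * ssE (x ^ 5) (2 * M)) atTop (𝓝 ((∑' j, ssAlpha x j) * (P5⁻¹ * P5⁻¹))) := by
    refine t5.congr fun M => ?_
    have := ss_triple_fin h05 h15 (z := x ^ 2) (by positivity) M
    rw [show ssAlpha x = (fun j => (-1) ^ j * (x ^ 2) ^ j * (x ^ 5) ^ (j * (j - 1) / 2)) from rfl, this]
    congr 1
    refine Finset.prod_congr rfl fun i _ => ?_
    congr 2
    · rw [← pow_mul, ← pow_add]; congr 1; ring
    · rw [← pow_mul, div_eq_iff (by positivity), ← pow_add]; rfl
  have hmul2 : Tendsto (fun M : ℕ => 2 * M) atTop atTop := tendsto_id.const_mul_atTop' (by norm_num)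
  have hmul5 : Tendsto (fun M : ℕ => 5 * M) atTop atTop := tendsto_id.const_mul_atTop' (by norm_num)
  have t7 := (t6.mul (hP5t.comp hmul2)).mul (hP5t.mul ((hPt.comp hmul5).inv₀ hP.ne'))
  have hlim : (∑' j, ssAlpha x j) * (P5⁻¹ * P5⁻¹) * P5 * (P5 * P⁻¹) = (∑' j, ssAlpha x j) * P⁻¹ := by
    field_simp
  rw [hlim] at t7
  refine t7.congr fun M => ?_
  have e2 : ssE (x ^ 5) (2 * (M : ℤ)) * ssPoc (x ^ 5) (2 * M) = 1 := by
    have : ssE (x ^ 5) (2 * (M : ℤ)) = (ssPoc (x ^ 5) (2 * M))⁻¹ := by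
      rw [← ssE_natCast]; push_cast; rfl
    rw [this]; exact inv_mul_cancel₀ (ssPoc_pos h05 h15 _).ne'
  have hne : ∀ k : ℕ, 1 - x ^ (k + 1) ≠ 0 := fun k => by
    have : x ^ (k + 1) < 1 := pow_lt_one₀ h0.le h1 (by omega)
    linarith
  have e3 : ∀ M : ℕ, ssPoc x (5 * M) * ∏ m ∈ range M, ((1 - x ^ (5 * m + 1)) * (1 - x ^ (5 * m + 4)))⁻¹
     = (∏ i ∈ range M, ((1 - x ^ (5 * i + 2)) * (1 - x ^ (5 * i + 3)))) * ssPoc (x ^ 5) M := by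
    intro M
    induction M with
    | zero => simp [ssPoc]
    | succ M ih =>
      have : ssPoc x (5 * (M + 1)) = ssPoc x (5 * M) * ((1 - x ^ (5 * M + 1)) * (1 - x ^ (5 * M + 2))
          * (1 - x ^ (5 * M + 3)) * (1 - x ^ (5 * M + 4)) * (1 - x ^ (5 * M + 5))) := by
        simp only [ssPoc, mul_add, mul_one, Finset.prod_range_succ]
        ring
      have h5 : ssPoc (x ^ 5) (M + 1) = ssPoc (x ^ 5) M * (1 - x ^ (5 * M + 5)) := by
        simp only [ssPoc, Finset.prod_range_succ, ← pow_mul]; rfl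
      rw [this, h5, Finset.prod_range_succ, Finset.prod_range_succ]
      have n1 := hne (5 * M)
      have n4 := hne (5 * M + 3)
      rw [show 5 * M + 3 + 1 = 5 * M + 4 by ring] at n4
      calc _ = (ssPoc x (5 * M) * ∏ m ∈ range M, ((1 - x ^ (5 * m + 1)) * (1 - x ^ (5 * m + 4)))⁻¹) *
            ((1 - x ^ (5 * M + 2)) * (1 - x ^ (5 * M + 3)) * (1 - x ^ (5 * M + 5))) := by
              field_simp
        _ = _ := by rw [ih]; ring
  have e3M := e3 M
  have hpp := (ssPoc_pos h0 h1 (5 * M)).ne'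
  simp only [Function.comp]
  calc _ = (ssE (x ^ 5) (2 * (M : ℤ)) * ssPoc (x ^ 5) (2 * M)) *
        ((∏ i ∈ range M, ((1 - x ^ (5 * i + 2)) * (1 - x ^ (5 * i + 3)))) * ssPoc (x ^ 5) M) *
        (ssPoc x (5 * M))⁻¹ := by ring
    _ = _ := by rw [e2, ← e3M]; field_simp
end

section
open Finset Filter Topology Polynomial

def ssMon (F : Type) [Field F] (n : ℕ) : Set F[X] := {f | f.Monic ∧ f.natDegree = n}

def ssSm {F : Type} [Field F] (S : Finset F[X]) (n : ℕ) : Set F[X] :=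
  {f | f.Monic ∧ f.natDegree = n ∧ ∀ p : F[X], Irreducible p → p.Monic → p ∣ f → p ∈ S}

section
variable {F : Type} [Field F] [Fintype F]

lemma ssMon_equiv (n : ℕ) : Nonempty (ssMon F n ≃ (Fin n → F)) :=
  ⟨(monicEquivDegreeLT n).trans (degreeLTEquiv F n).toEquiv⟩

lemma ssMon_finite (n : ℕ) : (ssMon F n).Finite := by
  obtain ⟨e⟩ := ssMon_equiv (F := F) n
  have : Finite (ssMon F n) := Finite.of_equiv _ e.symm
  exact Set.toFinite _

lemma ssMon_card (n : ℕ) : (ssMon F n).ncard = Fintype.card F ^ n := by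
  obtain ⟨e⟩ := ssMon_equiv (F := F) n
  rw [← Nat.card_coe_set_eq, Nat.card_congr e, Nat.card_eq_fintype_card]
  simp

lemma ssSm_subset (S : Finset F[X]) (n : ℕ) : ssSm S n ⊆ ssMon F n := fun _ h => ⟨h.1, h.2.1⟩

lemma ssSm_finite (S : Finset F[X]) (n : ℕ) : (ssSm S n).Finite :=
  (ssMon_finite n).subset (ssSm_subset S n)

lemma ssSm_ncard_le (S : Finset F[X]) (n : ℕ) : (ssSm S n).ncard ≤ Fintype.card F ^ n := by
  rw [← ssMon_card]; exact Set.ncard_le_ncard (ssSm_subset S n) (ssMon_finite n)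

lemma ssSm_empty (n : ℕ) : (ssSm (∅ : Finset F[X]) n).ncard = if n = 0 then 1 else 0 := by
  split_ifs with h
  · subst h
    have : ssSm (∅ : Finset F[X]) 0 = {1} := by
      ext f
      simp only [ssSm, Set.mem_ofPred_eq, Set.mem_singleton_iff]
      constructor
      · rintro ⟨h1, h2, _⟩
        exact Polynomial.Monic.natDegree_eq_zero h1 |>.mp h2
      · rintro rfl
        refine ⟨monic_one, natDegree_one, fun p hp _ hd => ?_⟩
        exact absurd (isUnit_of_dvd_one hd) hp.not_isUnit
    rw [this, Set.ncard_singleton]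
  · have : ssSm (∅ : Finset F[X]) n = ∅ := by
      ext f
      simp only [ssSm, Set.mem_ofPred_eq, Set.mem_empty_iff_false, iff_false]
      rintro ⟨h1, h2, h3⟩
      have hu : ¬ IsUnit f := fun hu => h (by rw [← h2, natDegree_eq_zero_of_isUnit hu])
      obtain ⟨p, hm, hp, hd⟩ := Polynomial.exists_monic_irreducible_factor f hu
      simpa using h3 p hp hm hd
    rw [this, Set.ncard_empty]

lemma ssSm_insert [DecidableEq F[X]] (S : Finset F[X]) (φ : F[X]) (hφ : φ ∉ S) (hi : Irreducible φ) (hm : φ.Monic)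
    (n : ℕ) : (ssSm (insert φ S) n).ncard = (ssSm S n).ncard +
      if φ.natDegree ≤ n then (ssSm (insert φ S) (n - φ.natDegree)).ncard else 0 := by
  have hu : ssSm (insert φ S) n = ssSm S n ∪ {f | f ∈ ssSm (insert φ S) n ∧ φ ∣ f} := by
    ext f
    simp only [ssSm, Set.mem_ofPred_eq, Set.mem_union, Finset.mem_insert]
    constructor
    · rintro ⟨h1, h2, h3⟩
      by_cases hd : φ ∣ f
      · exact Or.inr ⟨⟨h1, h2, h3⟩, hd⟩
      · refine Or.inl ⟨h1, h2, fun p hp hpm hpd => ?_⟩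
        rcases h3 p hp hpm hpd with rfl | h
        · exact absurd hpd hd
        · exact h
    · rintro (⟨h1, h2, h3⟩ | ⟨h, _⟩)
      · exact ⟨h1, h2, fun p hp hpm hpd => Or.inr (h3 p hp hpm hpd)⟩
      · exact h
  have hdisj : Disjoint (ssSm S n) {f | f ∈ ssSm (insert φ S) n ∧ φ ∣ f} := by
    rw [Set.disjoint_left]
    rintro f ⟨_, _, h3⟩ ⟨_, hd⟩
    exact hφ (h3 φ hi hm hd)
  have hf2 : {f | f ∈ ssSm (insert φ S) n ∧ φ ∣ f}.Finite := (ssSm_finite (insert φ S) n).subset fun _ h => h.1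
  conv_lhs => rw [hu]
  rw [Set.ncard_union_eq hdisj (ssSm_finite S n) hf2]
  congr 1
  split_ifs with hle
  · have : {f | f ∈ ssSm (insert φ S) n ∧ φ ∣ f} = (φ * ·) '' ssSm (insert φ S) (n - φ.natDegree) := by
      ext f
      simp only [Set.mem_ofPred_eq, Set.mem_image]
      constructor
      · rintro ⟨⟨h1, h2, h3⟩, g, rfl⟩
        have hg : g.Monic := hm.of_mul_monic_left h1
        refine ⟨g, ⟨hg, ?_, fun p hp hpm hpd => h3 p hp hpm (hpd.mul_left _)⟩, rfl⟩
        rw [hm.natDegree_mul hg] at h2; omega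
      · rintro ⟨g, ⟨h1, h2, h3⟩, rfl⟩
        refine ⟨⟨hm.mul h1, ?_, fun p hp hpm hpd => ?_⟩, dvd_mul_right _ _⟩
        · rw [hm.natDegree_mul h1]; omega
        · rcases hp.prime.dvd_or_dvd hpd with h | h
          · have : p = φ := eq_of_monic_of_associated hpm hm (hp.associated_of_dvd hi h)
            simp [this]
          · exact h3 p hp hpm h
    rw [this, Set.ncard_image_of_injective]
    exact mul_right_injective₀ hi.ne_zero
  · rw [Set.ncard_eq_zero hf2]
    ext f
    simp only [Set.mem_ofPred_eq, Set.mem_empty_iff_false, iff_false]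
    rintro ⟨⟨h1, h2, h3⟩, hd⟩
    exact hle (h2 ▸ natDegree_le_of_dvd hd h1.ne_zero)

noncomputable def ssM (S : Finset F[X]) : PowerSeries ℝ := PowerSeries.mk fun n => ((ssSm S n).ncard : ℝ)

lemma ssM_mul (S : Finset F[X]) (hS : ∀ p ∈ S, Irreducible p ∧ p.Monic) :
    ssM S * ∏ p ∈ S, (1 - (PowerSeries.X : PowerSeries ℝ) ^ p.natDegree) = 1 := by
  classical
  induction S using Finset.induction_on with
  | empty =>
    ext n
    simp only [ssM, Finset.prod_empty, mul_one, PowerSeries.coeff_mk, ssSm_empty, PowerSeries.coeff_one]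
    split_ifs <;> simp
  | insert φ S hφ ih =>
    have hp := hS φ (Finset.mem_insert_self _ _)
    rw [Finset.prod_insert hφ, ← mul_assoc]
    have : ssM (insert φ S) * (1 - (PowerSeries.X : PowerSeries ℝ) ^ φ.natDegree) = ssM S := by
      ext n
      rw [mul_sub, mul_one, map_sub, PowerSeries.coeff_mul_X_pow']
      simp only [ssM, PowerSeries.coeff_mk]
      rw [ssSm_insert S φ hφ hp.1 hp.2 n]
      split_ifs <;> simp
    rw [this]
    exact ih fun p hp => hS p (Finset.mem_insert_of_mem hp)

lemma ssIrr_finite (N : ℕ) : {p : F[X] | Irreducible p ∧ p.Monic ∧ p.natDegree ≤ N}.Finite := by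
  refine ((Set.finite_Iic N).biUnion fun n _ => ssMon_finite (F := F) n).subset ?_
  rintro p ⟨_, h1, h2⟩
  simp only [Set.mem_iUnion]
  exact ⟨p.natDegree, h2, h1, rfl⟩

variable (F) in
noncomputable def ssIrr (N : ℕ) : Finset F[X] := (ssIrr_finite (F := F) N).toFinset

lemma mem_ssIrr {N : ℕ} {p : F[X]} : p ∈ ssIrr F N ↔ Irreducible p ∧ p.Monic ∧ p.natDegree ≤ N := by
  simp [ssIrr]

lemma ssSm_irr {N n : ℕ} (h : n ≤ N) : (ssSm (ssIrr F N) n).ncard = Fintype.card F ^ n := by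
  rw [← ssMon_card]
  congr 1
  refine Set.Subset.antisymm (ssSm_subset _ _) ?_
  rintro f ⟨h1, h2⟩
  refine ⟨h1, h2, fun p hp hpm hpd => mem_ssIrr.mpr ⟨hp, hpm, ?_⟩⟩
  exact (natDegree_le_of_dvd hpd h1.ne_zero).trans (h2 ▸ h)

end
end

section
open Finset Filter Topology Polynomial

/-- `f` converges absolutely at `t`, with value `v` and absolute value at most `K`. -/
structure SsEv (t : ℝ) (f : PowerSeries ℝ) (v K : ℝ) : Prop where
  sm : Summable fun n => ‖PowerSeries.coeff n f * t ^ n‖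
  val : ∑' n, PowerSeries.coeff n f * t ^ n = v
  le : ∑' n, ‖PowerSeries.coeff n f * t ^ n‖ ≤ K

lemma SsEv.nonneg {t : ℝ} {f : PowerSeries ℝ} {v K : ℝ} (h : SsEv t f v K) : 0 ≤ K :=
  (tsum_nonneg fun _ => norm_nonneg _).trans h.le

lemma SsEv.one (t : ℝ) : SsEv t 1 1 1 := by
  have h : ∀ n ∉ ({0} : Finset ℕ), PowerSeries.coeff n (1 : PowerSeries ℝ) * t ^ n = 0 := by
    intro n hn
    rw [PowerSeries.coeff_one, if_neg (by simpa using hn), zero_mul]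
  have h' : ∀ n ∉ ({0} : Finset ℕ), ‖PowerSeries.coeff n (1 : PowerSeries ℝ) * t ^ n‖ = 0 := by
    intro n hn
    rw [h n hn, norm_zero]
  refine ⟨summable_of_ne_finset_zero h', ?_, ?_⟩
  · rw [tsum_eq_sum h]; simp
  · rw [tsum_eq_sum h']; simp

lemma SsEv.mul {t : ℝ} {f g : PowerSeries ℝ} {v w K L : ℝ} (hf : SsEv t f v K) (hg : SsEv t g w L) :
    SsEv t (f * g) (v * w) (K * L) := by
  have e : ∀ n, PowerSeries.coeff n (f * g) * t ^ n = ∑ kl ∈ antidiagonal n,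
      (PowerSeries.coeff kl.1 f * t ^ kl.1) * (PowerSeries.coeff kl.2 g * t ^ kl.2) := by
    intro n
    rw [PowerSeries.coeff_mul, Finset.sum_mul]
    refine Finset.sum_congr rfl fun kl h => ?_
    rw [← Finset.HasAntidiagonal.mem_antidiagonal.mp h, pow_add]; ring
  have hs := summable_norm_sum_mul_antidiagonal_of_summable_norm hf.sm hg.sm
  refine ⟨?_, ?_, ?_⟩
  · simpa only [e] using hs
  · simp only [e]
    rw [← tsum_mul_tsum_eq_tsum_sum_antidiagonal_of_summable_norm hf.sm hg.sm, hf.val, hg.val]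
  · simp only [e]
    have hf' : Summable fun n => ‖‖PowerSeries.coeff n f * t ^ n‖‖ := by simpa using hf.sm
    have hg' : Summable fun n => ‖‖PowerSeries.coeff n g * t ^ n‖‖ := by simpa using hg.sm
    have h1 := tsum_mul_tsum_eq_tsum_sum_antidiagonal_of_summable_norm hf' hg'
    have h2 := (summable_norm_sum_mul_antidiagonal_of_summable_norm hf' hg').of_norm
    calc _ ≤ _ := hs.tsum_le_tsum (fun n => (norm_sum_le _ _).trans (le_of_eq ?_)) h2
      _ = _ := h1.symm
      _ ≤ _ := mul_le_mul hf.le hg.le (tsum_nonneg fun _ => norm_nonneg _) hf.nonneg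
    exact Finset.sum_congr rfl fun kl _ => norm_mul _ _

lemma SsEv.prod {ι : Type*} {t : ℝ} (S : Finset ι) {f : ι → PowerSeries ℝ} {v K : ι → ℝ}
    (h : ∀ i ∈ S, SsEv t (f i) (v i) (K i)) :
    SsEv t (∏ i ∈ S, f i) (∏ i ∈ S, v i) (∏ i ∈ S, K i) := by
  classical
  induction S using Finset.induction_on with
  | empty => simpa using SsEv.one t
  | insert a S ha ih =>
    rw [Finset.prod_insert ha, Finset.prod_insert ha, Finset.prod_insert ha]
    exact (h a (Finset.mem_insert_self _ _)).mul (ih fun i hi => h i (Finset.mem_insert_of_mem hi))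

lemma SsEv.one_sub (t c : ℝ) (d : ℕ) (hd : 0 < d) :
    SsEv t (1 - PowerSeries.C c * PowerSeries.X ^ d) (1 - c * t ^ d) (1 + |c * t ^ d|) := by
  have e : ∀ n, PowerSeries.coeff n (1 - PowerSeries.C c * PowerSeries.X ^ d : PowerSeries ℝ) =
     (if n = 0 then 1 else 0) - if n = d then c else 0 := by
    intro n
    rw [map_sub, PowerSeries.coeff_one, PowerSeries.coeff_C_mul, PowerSeries.coeff_X_pow]
    simp
  have h : ∀ n ∉ ({0, d} : Finset ℕ), PowerSeries.coeff n (1 - PowerSeries.C c * PowerSeries.X ^ d : PowerSeries ℝ) * t ^ n = 0 := by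
    intro n hn
    simp only [Finset.mem_insert, Finset.mem_singleton, not_or] at hn
    rw [e, if_neg hn.1, if_neg hn.2]; simp
  have h' : ∀ n ∉ ({0, d} : Finset ℕ), ‖PowerSeries.coeff n (1 - PowerSeries.C c * PowerSeries.X ^ d : PowerSeries ℝ) * t ^ n‖ = 0 := by
    intro n hn
    rw [h n hn, norm_zero]
  refine ⟨summable_of_ne_finset_zero h', ?_, ?_⟩
  · rw [tsum_eq_sum h, Finset.sum_pair hd.ne, e, e]
    simp [hd.ne', hd.ne]; ring
  · rw [tsum_eq_sum h', Finset.sum_pair hd.ne, e, e]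
    simp [hd.ne', hd.ne]

section
variable {F : Type} [Field F] [Fintype F]

lemma ssM_summable (S : Finset F[X]) {t : ℝ} (h0 : 0 ≤ t) (h1 : Fintype.card F * t < 1) :
    Summable fun n : ℕ => ((ssSm S n).ncard : ℝ) * t ^ n := by
  refine Summable.of_nonneg_of_le (fun n => by positivity) (fun n => ?_)
    (summable_geometric_of_lt_one (r := Fintype.card F * t) (by positivity) h1)
  rw [mul_pow]
  have : ((ssSm S n).ncard : ℝ) ≤ (Fintype.card F : ℝ) ^ n := by exact_mod_cast ssSm_ncard_le S n
  gcongr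

lemma ss_zeta_fin (S : Finset F[X]) (hS : ∀ p ∈ S, Irreducible p ∧ p.Monic)
    {t : ℝ} (h0 : 0 ≤ t) (h1 : Fintype.card F * t < 1) :
    (∑' n : ℕ, ((ssSm S n).ncard : ℝ) * t ^ n) * ∏ p ∈ S, (1 - t ^ p.natDegree) = 1 := by
  have hM : SsEv t (ssM S) (∑' n : ℕ, ((ssSm S n).ncard : ℝ) * t ^ n) _ :=
    ⟨by simpa [ssM] using (ssM_summable S h0 h1).norm, by simp [ssM], le_rfl⟩
  have hP := SsEv.prod S (t := t) (f := fun p => (1 - PowerSeries.C 1 * PowerSeries.X ^ p.natDegree : PowerSeries ℝ))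
    (fun p hp => SsEv.one_sub t 1 p.natDegree (hS p hp).1.natDegree_pos)
  have := (hM.mul hP).val
  simp only [map_one, one_mul] at this
  rw [ssM_mul S hS] at this
  rw [← this, (SsEv.one t).val]

lemma ss_zeta_prod_ge (S : Finset F[X]) (hS : ∀ p ∈ S, Irreducible p ∧ p.Monic)
    {t : ℝ} (h0 : 0 ≤ t) (h1 : Fintype.card F * t < 1) :
    1 - Fintype.card F * t ≤ ∏ p ∈ S, (1 - t ^ p.natDegree) := by
  have h := ss_zeta_fin S hS h0 h1
  set M := (∑' n : ℕ, ((ssSm S n).ncard : ℝ) * t ^ n)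
  have hM : M ≤ (1 - Fintype.card F * t)⁻¹ := by
    rw [← tsum_geometric_of_lt_one (by positivity) h1]
    refine (ssM_summable S h0 h1).tsum_le_tsum (fun n => ?_) 
      (summable_geometric_of_lt_one (by positivity) h1)
    rw [mul_pow]
    have : ((ssSm S n).ncard : ℝ) ≤ (Fintype.card F : ℝ) ^ n := by exact_mod_cast ssSm_ncard_le S n
    gcongr
  have hM0 : 0 ≤ M := tsum_nonneg fun n => by positivity
  have hM1 : 0 < M := lt_of_le_of_ne hM0 fun h' => by rw [← h'] at h; simp at h
  have : ∏ p ∈ S, (1 - t ^ p.natDegree) = M⁻¹ := by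
    exact eq_inv_of_mul_eq_one_right h
  rw [this, ← inv_inv (1 - Fintype.card F * t)]
  exact inv_anti₀ hM1 hM

lemma ss_sum_pow_le (S : Finset F[X]) (hS : ∀ p ∈ S, Irreducible p ∧ p.Monic)
    {t : ℝ} (h0 : 0 ≤ t) (h1 : Fintype.card F * t < 1) :
    ∑ p ∈ S, t ^ p.natDegree ≤ -Real.log (1 - Fintype.card F * t) := by
  have hq : (1 : ℝ) ≤ Fintype.card F := by exact_mod_cast Fintype.card_pos
  have ht : t < 1 := by nlinarith
  have h := ss_zeta_prod_ge S hS h0 h1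
  have h2 : ∏ p ∈ S, (1 - t ^ p.natDegree) ≤ Real.exp (-∑ p ∈ S, t ^ p.natDegree) := by
    rw [← Finset.sum_neg_distrib, Real.exp_sum]
    refine Finset.prod_le_prod (fun p _ => ?_) (fun p _ => ?_)
    · have : t ^ p.natDegree ≤ 1 := pow_le_one₀ h0 ht.le
      linarith
    · have := Real.add_one_le_exp (-t ^ p.natDegree)
      linarith
  have h3 := Real.log_le_log (by linarith) (h.trans h2)
  rw [Real.log_exp] at h3
  linarith

lemma ss_zeta_tendsto {t : ℝ} (h0 : 0 ≤ t) (h1 : Fintype.card F * t < 1) :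
    Tendsto (fun N => ∏ p ∈ ssIrr F N, (1 - t ^ p.natDegree)) atTop (𝓝 (1 - Fintype.card F * t)) := by
  have hS : ∀ N, ∀ p ∈ ssIrr F N, Irreducible p ∧ p.Monic := fun N p hp =>
    ⟨(mem_ssIrr.mp hp).1, (mem_ssIrr.mp hp).2.1⟩
  have ht : Tendsto (fun N => (∑' n : ℕ, ((ssSm (ssIrr F N) n).ncard : ℝ) * t ^ n)) atTop
      (𝓝 (∑' n : ℕ, (Fintype.card F * t) ^ n)) := by
    refine tendsto_tsum_of_dominated_convergence
      (summable_geometric_of_lt_one (r := Fintype.card F * t) (by positivity) h1) ?_ ?_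
    · intro n
      refine tendsto_const_nhds.congr' ?_
      filter_upwards [eventually_ge_atTop n] with N hN
      rw [ssSm_irr hN, mul_pow]; push_cast; rfl
    · refine Eventually.of_forall fun N n => ?_
      rw [Real.norm_of_nonneg (by positivity), mul_pow]
      have : ((ssSm (ssIrr F N) n).ncard : ℝ) ≤ (Fintype.card F : ℝ) ^ n := by
        exact_mod_cast ssSm_ncard_le _ n
      gcongr
  rw [tsum_geometric_of_lt_one (by positivity) h1] at ht
  have hne : (1 - Fintype.card F * t)⁻¹ ≠ 0 := inv_ne_zero (by linarith)
  have := ht.inv₀ hne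
  rw [inv_inv] at this
  refine this.congr fun N => ?_
  exact (eq_inv_of_mul_eq_one_right (ss_zeta_fin _ (hS N) h0 h1)).symm

end
end

section
open Finset Filter Topology Polynomial

noncomputable def ssG (F : Type*) [Field F] (n : ℕ) : ℕ := Nat.card (GL (Fin n) F)

noncomputable def ssC {F : Type} [Field F] (P : F[X]) (n : ℕ) : ℕ :=
  Nat.card {A : Matrix (Fin n) (Fin n) F // aeval A P = 0}

lemma ssG_eq (K : Type*) [Field K] (n : ℕ) : Nat.card ((Fin n → K) ≃ₗ[K] (Fin n → K)) = ssG K n :=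
  Nat.card_congr ((LinearMap.GeneralLinearGroup.generalLinearEquiv K (Fin n → K)).symm.trans
    (Matrix.GeneralLinearGroup.toLin (n := Fin n) (R := K)).symm).toEquiv

lemma ss_klinear {F : Type} [Field F] {φ : F[X]} [Fact (Irreducible φ)] {V : Type*} [AddCommGroup V]
    [Module F V] [Module (AdjoinRoot φ) V] [IsScalarTower F (AdjoinRoot φ) V] {V' : Type*} [AddCommGroup V']
    [Module F V'] [Module (AdjoinRoot φ) V'] [IsScalarTower F (AdjoinRoot φ) V'] (u : V →ₗ[F] V')
    (hu : ∀ v, u (AdjoinRoot.root φ • v) = AdjoinRoot.root φ • u v) (k : AdjoinRoot φ) (v : V) :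
    u (k • v) = k • u v := by
  have hk : k ∈ Algebra.adjoin F ({AdjoinRoot.root φ} : Set (AdjoinRoot φ)) := by
    rw [AdjoinRoot.adjoinRoot_eq_top]; trivial
  induction hk using Algebra.adjoin_induction generalizing v with
  | mem x hx => rw [Set.mem_singleton_iff.mp hx, hu]
  | algebraMap r => rw [algebraMap_smul, algebraMap_smul, map_smul]
  | add x y _ _ hx hy => rw [add_smul, add_smul, map_add, hx, hy]
  | mul x y _ _ hx hy => rw [mul_smul, mul_smul, hx, hy]

/-- an operator killed by `φ` comes from an `AdjoinRoot φ`-structure. -/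
lemma ss_struct {F : Type} [Field F] {φ : F[X]} [hφ : Fact (Irreducible φ)] {n : ℕ}
    (a : Module.End F (Fin n → F)) (ha : aeval a φ = 0) :
    ∃ k : ℕ, n = φ.natDegree * k ∧ ∃ e : (Fin k → AdjoinRoot φ) ≃ₗ[F] (Fin n → F),
      ∀ v, e (AdjoinRoot.root φ • v) = a (e v) := by
  let f : AdjoinRoot φ →ₐ[F] Module.End F (Fin n → F) := 
    Ideal.Quotient.liftₐ (Ideal.span {φ}) (aeval a) (fun p hp => by
      obtain ⟨r, rfl⟩ := Ideal.mem_span_singleton.mp hp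
      rw [map_mul, ha, zero_mul])
  have hf : f (AdjoinRoot.root φ) = a := by
    change aeval a X = a
    exact aeval_X a
  let : Module (AdjoinRoot φ) (Fin n → F) := Module.compHom _ f.toRingHom
  have hsm : ∀ (k : AdjoinRoot φ) (w : Fin n → F), k • w = f k w := fun _ _ => rfl
  have : IsScalarTower F (AdjoinRoot φ) (Fin n → F) := ⟨fun r k w => by
    rw [hsm, hsm, map_smul]; rfl⟩
  have : Module.Finite F (AdjoinRoot φ) := (AdjoinRoot.powerBasis hφ.out.ne_zero).finite
  have : Module.Finite (AdjoinRoot φ) (Fin n → F) := Module.Finite.of_restrictScalars_finite F _ _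
  have hd : Module.finrank F (AdjoinRoot φ) = φ.natDegree := by
    rw [(AdjoinRoot.powerBasis hφ.out.ne_zero).finrank, AdjoinRoot.powerBasis_dim]
  have hfr := Module.finrank_mul_finrank F (AdjoinRoot φ) (Fin n → F)
  rw [hd, Module.finrank_fin_fun] at hfr
  refine ⟨_, hfr.symm, ?_⟩
  let e := (Module.finBasis (AdjoinRoot φ) (Fin n → F)).equivFun.symm
  refine ⟨e.restrictScalars F, fun v => ?_⟩
  change e _ = a (e v)
  rw [map_smul, hsm, hf]

lemma ssC_matrix {F : Type} [Field F] (P : F[X]) (n : ℕ) :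
    ssC P n = Nat.card {a : Module.End F (Fin n → F) // aeval a P = 0} := by
  refine Nat.card_congr (Equiv.subtypeEquiv (Matrix.toLinAlgEquiv' (R := F) (n := Fin n)).toEquiv fun A => ?_)
  have : aeval (Matrix.toLinAlgEquiv' A) P = Matrix.toLinAlgEquiv' (aeval A P) :=
    (aeval_algHom_apply (Matrix.toLinAlgEquiv' (R := F) (n := Fin n)).toAlgHom A P)
  change _ ↔ aeval (Matrix.toLinAlgEquiv' A) P = 0
  rw [this]
  exact (map_eq_zero_iff _ (Matrix.toLinAlgEquiv' (R := F) (n := Fin n)).injective).symm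

lemma ssC_not_dvd {F : Type} [Field F] {φ : F[X]} (hφ : Irreducible φ) {n : ℕ}
    (h : ¬ φ.natDegree ∣ n) : ssC φ n = 0 := by
  have : Fact (Irreducible φ) := ⟨hφ⟩
  rw [ssC_matrix]
  have : IsEmpty {a : Module.End F (Fin n → F) // aeval a φ = 0} := ⟨fun ⟨a, ha⟩ => by
    obtain ⟨k, hk, _⟩ := ss_struct a ha
    exact h ⟨k, hk⟩⟩
  exact Nat.card_of_isEmpty

lemma ssC_irr {F : Type} [Field F] [Fintype F] {φ : F[X]} [hφ : Fact (Irreducible φ)] (k : ℕ) :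
    ssC φ (φ.natDegree * k) * ssG (AdjoinRoot φ) k = ssG F (φ.natDegree * k) := by
  have hd0 := hφ.out.natDegree_pos
  have : Module.Finite F (AdjoinRoot φ) := (AdjoinRoot.powerBasis hφ.out.ne_zero).finite
  have hd : Module.finrank F (AdjoinRoot φ) = φ.natDegree := by
    rw [(AdjoinRoot.powerBasis hφ.out.ne_zero).finrank, AdjoinRoot.powerBasis_dim]
  set n := φ.natDegree * k with hn
  have hS : ∀ a : {a : Module.End F (Fin n → F) // aeval a φ = 0}, ∃ e : (Fin k → AdjoinRoot φ) ≃ₗ[F] (Fin n → F),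
      ∀ v, e (AdjoinRoot.root φ • v) = a.1 (e v) := by
    rintro ⟨a, ha⟩
    obtain ⟨k', hk', he⟩ := ss_struct a ha
    have : k' = k := Nat.eq_of_mul_eq_mul_left hd0 (hk'.symm.trans hn)
    subst this; exact he
  choose E hE using hS
  have hVW : Nonempty ((Fin k → AdjoinRoot φ) ≃ₗ[F] (Fin n → F)) := by
    apply FiniteDimensional.nonempty_linearEquiv_of_finrank_eq
    rw [Module.finrank_pi_fintype, Module.finrank_fin_fun]
    simp [hd, hn, mul_comm]
  obtain ⟨e0⟩ := hVW
  rw [ssC_matrix, ← ssG_eq, ← ssG_eq, ← Nat.card_prod]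
  have h1 : Nat.card ((Fin n → F) ≃ₗ[F] (Fin n → F)) = Nat.card ((Fin k → AdjoinRoot φ) ≃ₗ[F] (Fin n → F)) :=
    Nat.card_congr ⟨fun g => e0.trans g, fun g => e0.symm.trans g, fun g => by ext; simp, fun g => by ext; simp⟩
  rw [h1]
  refine Nat.card_eq_of_bijective (fun x => (x.2.restrictScalars F).trans (E x.1)) ⟨?_, ?_⟩
  · rintro ⟨a, g⟩ ⟨b, h⟩ hab
    have hab' : ∀ v, E a (g v) = E b (h v) := fun v => LinearEquiv.congr_fun hab v
    have : a = b := by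
      apply Subtype.ext
      ext1 w
      apply LinearMap.ext
      intro c
      obtain ⟨v, hv⟩ := (g.restrictScalars F).surjective ((E a).symm (LinearMap.single F (fun _ => F) w c))
      have hv' : E a (g v) = LinearMap.single F (fun _ => F) w c := by
        rw [show g v = _ from hv]; simp
      have h1 := hE a (g v)
      have h2 := hE b (h v)
      rw [← map_smul, hab', hv'] at h1
      rw [← map_smul, ← hab', ← hab', hv'] at h2
      simp only [LinearMap.comp_apply]
      rw [← h1, ← h2, ← hab']
    subst this
    congr 1
    ext1 v
    exact (E a).injective (hab' v)
  · intro e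
    let r : Module.End F (Fin k → AdjoinRoot φ) := Algebra.lsmul F F (Fin k → AdjoinRoot φ) (AdjoinRoot.root φ)
    have hr : aeval r φ = 0 := by
      have := aeval_algHom_apply (Algebra.lsmul F F (Fin k → AdjoinRoot φ) : AdjoinRoot φ →ₐ[F] _) (AdjoinRoot.root φ) φ
      rw [show r = _ from rfl, this, AdjoinRoot.aeval_eq]; simp
    let a : Module.End F (Fin n → F) := e.conjAlgEquiv F r
    have ha : aeval a φ = 0 := by
      have := aeval_algHom_apply (e.conjAlgEquiv F).toAlgHom r φ
      rw [hr, map_zero] at this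
      exact this
    have hae : ∀ v, e (AdjoinRoot.root φ • v) = a (e v) := by
      intro v; simp [a, r]
    let u : (Fin k → AdjoinRoot φ) ≃ₗ[F] (Fin k → AdjoinRoot φ) := e.trans (E ⟨a, ha⟩).symm
    have hu : ∀ v, u (AdjoinRoot.root φ • v) = AdjoinRoot.root φ • u v := by
      intro v
      apply (E ⟨a, ha⟩).injective
      rw [hE]
      simp [u, hae]
    refine ⟨⟨⟨a, ha⟩, { u with map_smul' := fun c v => ss_klinear u.toLinearMap hu c v }⟩, ?_⟩
    ext1 v
    change E ⟨a, ha⟩ (u v) = e v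
    simp [u]
end

section
open Finset Filter Topology Polynomial

lemma ss_aeval_prodMap {F : Type} [Field F] {V1 V2 : Type*} [AddCommGroup V1] [Module F V1] [AddCommGroup V2]
    [Module F V2] (B : Module.End F V1) (C : Module.End F V2) (P : F[X]) :
    aeval (R := F) (B.prodMap C : Module.End F (V1 × V2)) P = (aeval B P).prodMap (aeval C P) := by
  have h := aeval_algHom_apply (LinearMap.prodMapAlgHom F V1 V2) (B, C) P
  have h1 := aeval_algHom_apply (AlgHom.fst F (Module.End F V1) (Module.End F V2)) (B, C) P
  have h2 := aeval_algHom_apply (AlgHom.snd F (Module.End F V1) (Module.End F V2)) (B, C) P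
  simp only [AlgHom.fst_apply, AlgHom.snd_apply] at h1 h2
  rw [h1, h2]
  exact h

lemma ss_bez {F : Type} [Field F] {P Q : F[X]} (hPQ : IsCoprime P Q) {V : Type*} [AddCommGroup V] [Module F V]
    (b : Module.End F V) (v : V) (h1 : aeval b P v = 0) (h2 : aeval b Q v = 0) : v = 0 := by
  obtain ⟨r, s, h⟩ := hPQ
  have := congrArg (fun p => aeval b p v) h
  simpa [h1, h2] using this.symm

/-- block diagonal operators -/
lemma ss_stage1 {F : Type} [Field F] {P Q : F[X]} (hPQ : IsCoprime P Q) {V1 V2 : Type*} [AddCommGroup V1]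
    [Module F V1] [AddCommGroup V2] [Module F V2] :
    Nat.card {b : Module.End F (V1 × V2) // (∀ v, aeval b P (v, 0) = 0) ∧ (∀ v, aeval b Q (0, v) = 0)} =
     Nat.card {B : Module.End F V1 // aeval B P = 0} * Nat.card {C : Module.End F V2 // aeval C Q = 0} := by
  rw [← Nat.card_prod]
  symm
  refine Nat.card_eq_of_bijective (fun x => ⟨x.1.1.prodMap x.2.1, ?_, ?_⟩) ⟨?_, ?_⟩
  · intro v; rw [ss_aeval_prodMap, x.1.2]; simp
  · intro v; rw [ss_aeval_prodMap, x.2.2]; simp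
  · rintro ⟨⟨B, hB⟩, ⟨C, hC⟩⟩ ⟨⟨B', hB'⟩, ⟨C', hC'⟩⟩ h
    have h := congrArg Subtype.val h
    have h' : ∀ v, (B.prodMap C) v = (B'.prodMap C') v := fun v => LinearMap.congr_fun h v
    simp only [Prod.mk.injEq, Subtype.mk.injEq]
    exact ⟨LinearMap.ext fun v => by simpa using h' (v, 0), LinearMap.ext fun v => by simpa using h' (0, v)⟩
  · rintro ⟨b, hb1, hb2⟩
    have comm : ∀ (R : F[X]) v, aeval b R (b v) = b (aeval b R v) := by
      intro R v
      have : aeval b (R * X) = aeval b (X * R) := by rw [mul_comm]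
      simpa using LinearMap.congr_fun this v
    have k1 : ∀ v : V1 × V2, aeval b P v = 0 → v.2 = 0 := by
      rintro ⟨x, y⟩ h
      have : aeval b P (0, y) = 0 := by
        have e : ((0 : V1), y) = (x, y) - (x, 0) := by simp
        rw [e, map_sub, h, hb1, sub_zero]
      have := ss_bez hPQ b _ this (hb2 y)
      simpa using this
    have k2 : ∀ v : V1 × V2, aeval b Q v = 0 → v.1 = 0 := by
      rintro ⟨x, y⟩ h
      have : aeval b Q (x, 0) = 0 := by
        have e : (x, (0 : V2)) = (x, y) - (0, y) := by simp
        rw [e, map_sub, h, hb2, sub_zero]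
      have := ss_bez hPQ b _ (hb1 x) this
      simpa using this
    have l1 : ∀ v, (b (v, 0)).2 = 0 := fun v => k1 _ (by rw [comm, hb1, map_zero])
    have l2 : ∀ v, (b (0, v)).1 = 0 := fun v => k2 _ (by rw [comm, hb2, map_zero])
    let B : Module.End F V1 := LinearMap.fst F V1 V2 ∘ₗ b ∘ₗ LinearMap.inl F V1 V2
    let C : Module.End F V2 := LinearMap.snd F V1 V2 ∘ₗ b ∘ₗ LinearMap.inr F V1 V2
    have hb : B.prodMap C = b := by
      refine LinearMap.ext fun ⟨x, y⟩ => ?_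
      have e : (x, y) = (x, (0 : V2)) + ((0 : V1), y) := by simp
      rw [e, map_add, map_add]
      congr 1
      · ext1 <;> simp [B, C, l1]
      · ext1 <;> simp [B, C, l2]
    refine ⟨⟨⟨B, LinearMap.ext fun v => ?_⟩, ⟨C, LinearMap.ext fun v => ?_⟩⟩, Subtype.ext hb⟩
    · have := hb1 v
      rw [← hb, ss_aeval_prodMap] at this
      simpa using congrArg Prod.fst this
    · have := hb2 v
      rw [← hb, ss_aeval_prodMap] at this
      simpa using congrArg Prod.snd this

lemma ss_aeval_conj {F : Type} [Field F] {V W : Type*} [AddCommGroup V]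
    [Module F V] [AddCommGroup W] [Module F W] (e : V ≃ₗ[F] W) (b : Module.End F V) (P : F[X]) (w : W) :
    aeval (e.conjAlgEquiv F b) P w = e (aeval b P (e.symm w)) := by
  have := aeval_algHom_apply (e.conjAlgEquiv F).toAlgHom b P
  exact LinearMap.congr_fun this w

lemma ss_stage1' {F : Type} [Field F] {P Q : F[X]} (hPQ : IsCoprime P Q) {V1 V2 W : Type*} [AddCommGroup V1]
    [Module F V1] [AddCommGroup V2] [Module F V2] [AddCommGroup W] [Module F W] :
    Nat.card {x : ((V1 × V2) ≃ₗ[F] W) × Module.End F W // (∀ v, aeval x.2 P (x.1 (v, 0)) = 0) ∧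
        (∀ v, aeval x.2 Q (x.1 (0, v)) = 0)} = Nat.card ((V1 × V2) ≃ₗ[F] W) *
     (Nat.card {B : Module.End F V1 // aeval B P = 0} * Nat.card {C : Module.End F V2 // aeval C Q = 0}) := by
  rw [← ss_stage1 hPQ, ← Nat.card_prod]
  symm
  refine Nat.card_eq_of_bijective (fun x => ⟨(x.1, x.1.conjAlgEquiv F x.2.1), ?_, ?_⟩) ⟨?_, ?_⟩
  · intro v; simp only [ss_aeval_conj, LinearEquiv.symm_apply_apply, x.2.2.1, map_zero]
  · intro v; simp only [ss_aeval_conj, LinearEquiv.symm_apply_apply, x.2.2.2, map_zero]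
  · rintro ⟨e, ⟨b, hb⟩⟩ ⟨e', ⟨b', hb'⟩⟩ h
    have h := congrArg Subtype.val h
    simp only [Prod.mk.injEq] at h
    obtain ⟨rfl, h⟩ := h
    simpa using h
  · rintro ⟨⟨e, a⟩, h1, h2⟩
    obtain ⟨b, rfl⟩ := (e.conjAlgEquiv F).surjective a
    refine ⟨⟨e, b, fun v => ?_, fun v => ?_⟩, rfl⟩
    · simpa only [ss_aeval_conj, LinearEquiv.symm_apply_apply, LinearEquiv.map_eq_zero_iff] using h1 v
    · simpa only [ss_aeval_conj, LinearEquiv.symm_apply_apply, LinearEquiv.map_eq_zero_iff] using h2 v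

lemma ss_stage2 {F : Type} [Field F] {P Q : F[X]} (hPQ : IsCoprime P Q) (i j n : ℕ) (hij : i + j = n) :
    Nat.card {x : (((Fin i → F) × (Fin j → F)) ≃ₗ[F] (Fin n → F)) × Module.End F (Fin n → F) //
        (∀ v, aeval x.2 P (x.1 (v, 0)) = 0) ∧ (∀ v, aeval x.2 Q (x.1 (0, v)) = 0)} = 
     Nat.card {a : Module.End F (Fin n → F) // aeval a (P * Q) = 0 ∧
        Module.finrank F (LinearMap.ker (aeval a P)) = i} * (ssG F i * ssG F j) := by
  have hS : ∀ a : {a : Module.End F (Fin n → F) // aeval a (P * Q) = 0 ∧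
        Module.finrank F (LinearMap.ker (aeval a P)) = i}, ∃ e : ((Fin i → F) × (Fin j → F)) ≃ₗ[F] (Fin n → F),
        (∀ v, aeval a.1 P (e (v, 0)) = 0) ∧ (∀ v, aeval a.1 Q (e (0, v)) = 0) := by
    rintro ⟨a, ha, hi⟩
    have hc : IsCompl (LinearMap.ker (aeval a P)) (LinearMap.ker (aeval a Q)) := by
      refine ⟨disjoint_ker_aeval_of_isCoprime a hPQ, codisjoint_iff.mpr ?_⟩
      rw [sup_ker_aeval_eq_ker_aeval_mul_of_coprime a hPQ, ha, LinearMap.ker_zero]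
    have hj : Module.finrank F (LinearMap.ker (aeval a Q)) = j := by
      have := Submodule.finrank_add_eq_of_isCompl hc
      rw [Module.finrank_fin_fun, hi] at this
      omega
    have e1 : (Fin i → F) ≃ₗ[F] LinearMap.ker (aeval a P) := LinearEquiv.ofFinrankEq _ _ (by rw [Module.finrank_fin_fun, hi])
    have e2 : (Fin j → F) ≃ₗ[F] LinearMap.ker (aeval a Q) := LinearEquiv.ofFinrankEq _ _ (by rw [Module.finrank_fin_fun, hj])
    refine ⟨(e1.prodCongr e2).trans (Submodule.prodEquivOfIsCompl _ _ hc), fun v => ?_, fun v => ?_⟩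
    · have : ((e1.prodCongr e2).trans (Submodule.prodEquivOfIsCompl _ _ hc)) (v, 0) = (e1 v : Fin n → F) := by simp
      rw [this]; exact (e1 v).2
    · have : ((e1.prodCongr e2).trans (Submodule.prodEquivOfIsCompl _ _ hc)) (0, v) = (e2 v : Fin n → F) := by simp
      rw [this]; exact (e2 v).2
  choose E hE1 hE2 using hS
  have key1 : ∀ (a : {a : Module.End F (Fin n → F) // aeval a (P * Q) = 0 ∧
        Module.finrank F (LinearMap.ker (aeval a P)) = i}) (w : (Fin i → F) × (Fin j → F)), aeval a.1 P (E a w) = 0 → w.2 = 0 := by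
    rintro a ⟨x, y⟩ h
    have : aeval a.1 P (E a (0, y)) = 0 := by
      have e : ((0 : Fin i → F), y) = (x, y) - (x, 0) := by simp
      rw [e, map_sub, map_sub, h, hE1, sub_zero]
    have := ss_bez hPQ a.1 _ this (hE2 a y)
    rw [LinearEquiv.map_eq_zero_iff] at this
    simpa using this
  have key2 : ∀ (a : {a : Module.End F (Fin n → F) // aeval a (P * Q) = 0 ∧
        Module.finrank F (LinearMap.ker (aeval a P)) = i}) (w : (Fin i → F) × (Fin j → F)), aeval a.1 Q (E a w) = 0 → w.1 = 0 := by
    rintro a ⟨x, y⟩ h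
    have : aeval a.1 Q (E a (x, 0)) = 0 := by
      have e : (x, (0 : Fin j → F)) = (x, y) - (0, y) := by simp
      rw [e, map_sub, map_sub, h, hE2, sub_zero]
    have := ss_bez hPQ a.1 _ (hE1 a x) this
    rw [LinearEquiv.map_eq_zero_iff] at this
    simpa using this
  rw [← ssG_eq, ← ssG_eq, ← Nat.card_prod, ← Nat.card_prod]
  symm
  refine Nat.card_eq_of_bijective (fun x => ⟨((x.2.1.prodCongr x.2.2).trans (E x.1), x.1.1), ?_, ?_⟩) ⟨?_, ?_⟩
  · intro v; simp [hE1]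
  · intro v; simp [hE2]
  · rintro ⟨a, h1, h2⟩ ⟨b, k1, k2⟩ h
    have h := congrArg Subtype.val h
    simp only [Prod.mk.injEq] at h
    obtain ⟨h, hab⟩ := h
    have hab := Subtype.ext hab
    subst hab
    have h' : ∀ v : (Fin i → F) × (Fin j → F), (h1 v.1, h2 v.2) = (k1 v.1, k2 v.2) := fun v => (E a).injective (LinearEquiv.congr_fun h v)
    simp only [Prod.mk.injEq, true_and]
    exact ⟨LinearEquiv.ext fun v => (Prod.mk.inj (h' (v, 0))).1, LinearEquiv.ext fun v => (Prod.mk.inj (h' (0, v))).2⟩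
  · rintro ⟨⟨e, a⟩, h1, h2⟩
    simp only at h1 h2
    have ha : aeval a (P * Q) = 0 := by
      refine LinearMap.ext fun w => ?_
      obtain ⟨⟨x, y⟩, rfl⟩ := e.surjective w
      have ee : (x, y) = (x, (0 : Fin j → F)) + ((0 : Fin i → F), y) := by simp
      rw [ee, map_add, map_add]
      have e1 : aeval a (P * Q) (e (x, 0)) = 0 := by rw [mul_comm, map_mul, Module.End.mul_apply, h1, map_zero]
      have e2 : aeval a (P * Q) (e (0, y)) = 0 := by rw [map_mul, Module.End.mul_apply, h2, map_zero]
      rw [e1, e2]; simp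
    have hi : Module.finrank F (LinearMap.ker (aeval a P)) = i := by
      have : LinearMap.ker (aeval a P) = LinearMap.range (e.toLinearMap ∘ₗ LinearMap.inl F (Fin i → F) (Fin j → F)) := by
        apply le_antisymm
        · intro w hw
          obtain ⟨⟨x, y⟩, rfl⟩ := e.surjective w
          have : aeval a P (e (0, y)) = 0 := by
            have ee : ((0 : Fin i → F), y) = (x, y) - (x, 0) := by simp
            rw [ee, map_sub, map_sub, h1, sub_zero]; exact hw
          have := ss_bez hPQ a _ this (h2 y)
          rw [LinearEquiv.map_eq_zero_iff] at this
          have hy : y = 0 := by simpa using this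
          subst hy
          exact ⟨x, rfl⟩
        · rintro _ ⟨v, rfl⟩
          exact h1 v
      rw [this, LinearMap.finrank_range_of_inj, Module.finrank_fin_fun]
      exact e.injective.comp LinearMap.inl_injective
    set A : {a : Module.End F (Fin n → F) // aeval a (P * Q) = 0 ∧
        Module.finrank F (LinearMap.ker (aeval a P)) = i} := ⟨a, ha, hi⟩ with hA
    let u := e.trans (E A).symm
    have hEu : ∀ v, E A (u v) = e v := fun v => by simp [u]
    have u1 : ∀ v, (u (v, 0)).2 = 0 := fun v => key1 A _ (by rw [hEu]; exact h1 v)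
    have u2 : ∀ v, (u (0, v)).1 = 0 := fun v => key2 A _ (by rw [hEu]; exact h2 v)
    let U1 : (Fin i → F) →ₗ[F] (Fin i → F) := LinearMap.fst F _ _ ∘ₗ u.toLinearMap ∘ₗ LinearMap.inl F (Fin i → F) (Fin j → F)
    let U2 : (Fin j → F) →ₗ[F] (Fin j → F) := LinearMap.snd F _ _ ∘ₗ u.toLinearMap ∘ₗ LinearMap.inr F (Fin i → F) (Fin j → F)
    have hu1 : ∀ v, u (v, 0) = (U1 v, 0) := fun v => Prod.ext rfl (u1 v)
    have hu2 : ∀ v, u (0, v) = (0, U2 v) := fun v => Prod.ext (u2 v) rfl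
    have i1 : Function.Injective U1 := by
      intro v w h
      have : u (v, 0) = u (w, 0) := by rw [hu1, hu1, h]
      exact (Prod.mk.inj (u.injective this)).1
    have i2 : Function.Injective U2 := by
      intro v w h
      have : u (0, v) = u (0, w) := by rw [hu2, hu2, h]
      exact (Prod.mk.inj (u.injective this)).2
    refine ⟨⟨A, LinearEquiv.ofInjectiveEndo U1 i1, LinearEquiv.ofInjectiveEndo U2 i2⟩, ?_⟩
    apply Subtype.ext
    refine Prod.ext (LinearEquiv.ext fun ⟨x, y⟩ => ?_) rfl
    change E A (U1 x, U2 y) = e (x, y)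
    rw [← hEu]
    congr 1
    have ee : (x, y) = (x, (0 : Fin j → F)) + ((0 : Fin i → F), y) := by simp
    rw [ee, map_add, hu1, hu2]; simp

lemma ssG_pos (F : Type) [Field F] [Fintype F] (n : ℕ) : 0 < ssG F n := by
  classical
  exact Nat.card_pos

lemma ssC_mul {F : Type} [Field F] [Fintype F] {P Q : F[X]} (hPQ : IsCoprime P Q) (n : ℕ) :
    (ssC (P * Q) n : ℝ) / ssG F n = ∑ ij ∈ antidiagonal n, ((ssC P ij.1 : ℝ) / ssG F ij.1) * ((ssC Q ij.2 : ℝ) / ssG F ij.2) := by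
  classical
  have : Finite (Module.End F (Fin n → F)) := Module.finite_of_finite F
  let D : ℕ → ℕ := fun i => Nat.card {a : Module.End F (Fin n → F) // aeval a (P * Q) = 0 ∧
        Module.finrank F (LinearMap.ker (aeval a P)) = i}
  have h1 : ∀ ij ∈ antidiagonal n, (D ij.1 : ℝ) / ssG F n = ((ssC P ij.1 : ℝ) / ssG F ij.1) * ((ssC Q ij.2 : ℝ) / ssG F ij.2) := by
    rintro ⟨i, j⟩ hij
    have hij := Finset.HasAntidiagonal.mem_antidiagonal.mp hij
    simp only at hij ⊢
    have a1 := ss_stage1' hPQ (V1 := Fin i → F) (V2 := Fin j → F) (W := Fin n → F)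
    rw [ss_stage2 hPQ i j n hij, ← ssC_matrix, ← ssC_matrix] at a1
    have e0 : ((Fin i → F) × (Fin j → F)) ≃ₗ[F] (Fin n → F) := LinearEquiv.ofFinrankEq _ _ (by simp [hij])
    have h1 : Nat.card ((Fin n → F) ≃ₗ[F] (Fin n → F)) = Nat.card (((Fin i → F) × (Fin j → F)) ≃ₗ[F] (Fin n → F)) :=
      Nat.card_congr ⟨fun g => e0.trans g, fun g => e0.symm.trans g, fun g => by ext; simp, fun g => by ext1; simp⟩
    rw [← h1, ssG_eq] at a1
    have p1 : (ssG F i : ℝ) ≠ 0 := by exact_mod_cast (ssG_pos F i).ne'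
    have p2 : (ssG F j : ℝ) ≠ 0 := by exact_mod_cast (ssG_pos F j).ne'
    have p3 : (ssG F n : ℝ) ≠ 0 := by exact_mod_cast (ssG_pos F n).ne'
    rw [div_mul_div_comm, div_eq_div_iff p3 (mul_ne_zero p1 p2)]
    rw [mul_comm (_ * _) (ssG F n : ℝ)]
    exact_mod_cast a1
  rw [← Finset.sum_congr rfl h1, ← Finset.sum_div]
  congr 1
  rw [Finset.Nat.sum_antidiagonal_eq_sum_range_succ (fun i _ => (D i : ℝ))]
  rw [ssC_matrix]
  have : Fintype (Module.End F (Fin n → F)) := Fintype.ofFinite _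
  rw [Nat.card_eq_fintype_card, Fintype.card_subtype]
  rw [Finset.card_eq_sum_card_fiberwise (f := fun a => Module.finrank F (LinearMap.ker (aeval a P))) (t := range (n+1))]
  · push_cast
    refine Finset.sum_congr rfl fun i _ => ?_
    congr 1
    simp only [D]
    rw [Nat.card_eq_fintype_card, Fintype.card_subtype, Finset.filter_filter]
  · intro a _
    have := Submodule.finrank_le (LinearMap.ker (aeval a P))
    rw [Module.finrank_fin_fun] at this
    simp only [coe_range, Set.mem_Iio]
    omega
end

section
open Finset Filter Topology Polynomial

/-- generating series of matrices annihilated by `P`. -/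
noncomputable def ssCP {F : Type} [Field F] (P : F[X]) : PowerSeries ℝ :=
  PowerSeries.mk fun n => (ssC P n : ℝ) / ssG F n

noncomputable def ssEs (x : ℝ) (d : ℕ) : PowerSeries ℝ :=
  PowerSeries.mk fun n => if d ∣ n then x ^ ((n / d) ^ 2) * ssE x ((n / d : ℕ) : ℤ) else 0

lemma ss_irr_coprime {F : Type} [Field F] {p r : F[X]} (hp : Irreducible p) (hpm : p.Monic) (hr : Irreducible r)
    (hrm : r.Monic) (h : p ≠ r) : IsCoprime p r := by
  rcases EuclideanDomain.dvd_or_coprime p r hp with h1 | h1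
  · exact absurd (eq_of_monic_of_associated hpm hrm (hp.associated_of_dvd hr h1)) h
  · exact h1

lemma ssCP_one {F : Type} [Field F] [Fintype F] : ssCP (1 : F[X]) = 1 := by
  ext n
  simp only [ssCP, PowerSeries.coeff_mk, PowerSeries.coeff_one]
  rcases Nat.eq_zero_or_pos n with h | h
  · subst h
    have : ssC (1 : F[X]) 0 = 1 := by
      simp only [ssC, Nat.card_eq_one_iff_unique]
      exact ⟨inferInstance, ⟨0, Subsingleton.elim _ _⟩⟩
    have h2 : ssG F 0 = 1 := by
      rw [ssG, Nat.card_eq_one_iff_unique]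
      exact ⟨inferInstance, inferInstance⟩
    rw [this, h2]; simp
  · have : ssC (1 : F[X]) n = 0 := by
      have : NeZero n := ⟨h.ne'⟩
      have : IsEmpty {A : Matrix (Fin n) (Fin n) F // aeval A (1 : F[X]) = 0} := ⟨fun ⟨A, hA⟩ => by
        rw [map_one] at hA; exact one_ne_zero hA⟩
      exact Nat.card_of_isEmpty
    rw [this, if_neg h.ne']; simp

lemma ssCP_prod {F : Type} [Field F] [Fintype F] (S : Finset F[X]) (hS : ∀ p ∈ S, Irreducible p ∧ p.Monic) :
    ssCP (∏ p ∈ S, p) = ∏ p ∈ S, ssCP p := by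
  classical
  induction S using Finset.induction_on with
  | empty => simp [ssCP_one]
  | insert p S hp ih =>
    rw [Finset.prod_insert hp, Finset.prod_insert hp, ← ih fun r hr => hS r (mem_insert_of_mem hr)]
    have hc : IsCoprime p (∏ r ∈ S, r) := IsCoprime.prod_right fun r hr => by
      have h1 := hS p (mem_insert_self _ _)
      have h2 := hS r (mem_insert_of_mem hr)
      exact ss_irr_coprime h1.1 h1.2 h2.1 h2.2 (fun h => hp (h ▸ hr))
    ext n
    rw [PowerSeries.coeff_mul]
    simp only [ssCP, PowerSeries.coeff_mk]
    exact ssC_mul hc n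

lemma ssG_inv {K : Type} [Field K] [Fintype K] (k : ℕ) {x : ℝ} (hx : x = (Fintype.card K : ℝ)⁻¹) :
    (1 : ℝ) / ssG K k = x ^ (k ^ 2) * ssE x k := by
  have hQ : (1:ℝ) < Fintype.card K := by exact_mod_cast Fintype.one_lt_card
  have hQ0 : (0:ℝ) < Fintype.card K := by linarith
  have hQn : 0 < Fintype.card K := Fintype.card_pos
  have h : (ssG K k : ℝ) = (Fintype.card K : ℝ) ^ (k ^ 2) * ssPoc x k := by
    rw [ssG, Matrix.card_GL_field]
    push_cast
    have : ∀ i : Fin k, (((Fintype.card K ^ k - Fintype.card K ^ (i:ℕ) : ℕ)) : ℝ) = (Fintype.card K : ℝ) ^ k * (1 - x ^ (k - (i:ℕ))) := by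
      intro i
      rw [Nat.cast_sub (Nat.pow_le_pow_right hQn i.2.le), hx, inv_pow]
      push_cast
      have : (Fintype.card K : ℝ) ^ k = (Fintype.card K : ℝ) ^ (i : ℕ) * (Fintype.card K : ℝ) ^ (k - (i:ℕ)) := by
        rw [← pow_add]; congr 1; omega
      rw [this]; field_simp
    rw [Finset.prod_congr rfl fun i _ => this i, Finset.prod_mul_distrib]
    simp only [Finset.prod_const, Finset.card_univ, Fintype.card_fin]
    rw [← pow_mul, ← pow_two]
    congr 1
    rw [Fin.prod_univ_eq_prod_range (fun i => 1 - x ^ (k - i)) k, ← Finset.prod_range_reflect, ssPoc]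
    refine Finset.prod_congr rfl fun i hi => ?_
    have := mem_range.mp hi
    congr 2; omega
  rw [h, ssE_natCast, hx]
  simp only [one_div, mul_inv, inv_pow]

lemma ssCP_irr {F : Type} [Field F] [Fintype F] {φ : F[X]} (hφ : Irreducible φ) :
    ssCP φ = ssEs (((Fintype.card F : ℝ)⁻¹) ^ φ.natDegree) φ.natDegree := by
  ext n
  have hd := hφ.natDegree_pos
  simp only [ssCP, ssEs, PowerSeries.coeff_mk]
  split_ifs with h
  · obtain ⟨k, rfl⟩ := h
    have : Fact (Irreducible φ) := ⟨hφ⟩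
    have h1 := ssC_irr (φ := φ) k
    rw [Nat.mul_div_cancel_left _ hd]
    have : Module.Finite F (AdjoinRoot φ) := (AdjoinRoot.powerBasis hφ.ne_zero).finite
    have : Finite (AdjoinRoot φ) := Module.finite_of_finite F
    have : Fintype (AdjoinRoot φ) := Fintype.ofFinite _
    have hc : Fintype.card (AdjoinRoot φ) = Fintype.card F ^ φ.natDegree := by
      rw [Module.card_eq_pow_finrank (K := F), (AdjoinRoot.powerBasis hφ.ne_zero).finrank, AdjoinRoot.powerBasis_dim]
    rw [← ssG_inv (K := AdjoinRoot φ) k (by rw [hc]; push_cast; rw [inv_pow])]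
    have p1 : (ssG (AdjoinRoot φ) k : ℝ) ≠ 0 := by exact_mod_cast (ssG_pos _ k).ne'
    have p2 : (ssG F (φ.natDegree * k) : ℝ) ≠ 0 := by exact_mod_cast (ssG_pos F _).ne'
    rw [div_eq_div_iff p2 p1, one_mul]
    exact_mod_cast h1
  · rw [ssC_not_dvd hφ h]; simp

noncomputable def ssIrr0 (F : Type) [Field F] [Fintype F] (N : ℕ) : Finset F[X] := by
  classical
  exact (ssIrr F N).erase X

lemma mem_ssIrr0 {F : Type} [Field F] [Fintype F] {N : ℕ} {p : F[X]} :
    p ∈ ssIrr0 F N ↔ p ≠ X ∧ Irreducible p ∧ p.Monic ∧ p.natDegree ≤ N := by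
  classical
  unfold ssIrr0
  rw [mem_erase, mem_ssIrr]

lemma ssIrr_prod {F : Type} [Field F] [Fintype F] {M : Type*} [CommMonoid M] {N : ℕ} (hN : 1 ≤ N) (f : F[X] → M) :
    ∏ p ∈ ssIrr F N, f p = f X * ∏ p ∈ ssIrr0 F N, f p := by
  classical
  unfold ssIrr0
  rw [Finset.mul_prod_erase]
  exact mem_ssIrr.mpr ⟨irreducible_X, monic_X, by simpa using hN⟩

lemma ss_semisimple_iff {F : Type} [Field F] [Fintype F] {n : ℕ} (A : Matrix (Fin n) (Fin n) F) :
    (IsUnit A ∧ Squarefree (minpoly F A)) ↔ aeval A (∏ p ∈ ssIrr0 F n, p) = 0 := by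
  classical
  have hAint : IsIntegral F A := Algebra.IsIntegral.isIntegral A
  have hm := minpoly.monic hAint
  rw [← minpoly.dvd_iff]
  constructor
  · rintro ⟨hu, hs⟩
    have hnd := (UniqueFactorizationMonoid.squarefree_iff_nodup_normalizedFactors hm.ne_zero).mp hs
    have hp := UniqueFactorizationMonoid.prod_normalizedFactors_eq hm.ne_zero
    rw [hm.normalize_eq_self] at hp
    set T := (UniqueFactorizationMonoid.normalizedFactors (minpoly F A)).toFinset with hT
    have hp' : ∏ p ∈ T, p = minpoly F A := by
      conv_rhs => rw [← hp]
      rw [Finset.prod, hT, Multiset.toFinset_val, hnd.dedup, Multiset.map_id']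
    rw [← hp']
    apply Finset.prod_dvd_prod_of_subset
    intro p hpT
    rw [hT, Multiset.mem_toFinset, Polynomial.mem_normalizedFactors_iff hm.ne_zero] at hpT
    obtain ⟨h1, h2, h3⟩ := hpT
    refine mem_ssIrr0.mpr ⟨?_, h1, h2, ?_⟩
    · rintro rfl
      obtain ⟨r, hr⟩ := h3
      have h0 : aeval A r = 0 := by
        have := minpoly.aeval F A
        rw [hr, map_mul, aeval_X] at this
        exact (hu.mul_right_eq_zero).mp this
      have h5 := minpoly.dvd F A h0
      have hr0 : r ≠ 0 := by rintro rfl; exact hm.ne_zero (by rw [hr, mul_zero])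
      have h6 := natDegree_le_of_dvd h5 hr0
      rw [hr, natDegree_mul X_ne_zero hr0, natDegree_X] at h6
      omega
    · have h4 := natDegree_le_of_dvd (h3.trans (Matrix.minpoly_dvd_charpoly A)) (Matrix.charpoly_monic A).ne_zero
      rwa [Matrix.charpoly_natDegree_eq_dim, Fintype.card_fin] at h4
  · intro h
    have hsq : Squarefree (∏ p ∈ ssIrr0 F n, p) := by
      refine Finset.squarefree_prod_of_pairwise_isCoprime ?_ ?_
      · intro p hp r hr hne
        have h1 := mem_ssIrr0.mp hp
        have h2 := mem_ssIrr0.mp hr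
        exact (ss_irr_coprime h1.2.1 h1.2.2.1 h2.2.1 h2.2.2.1 hne).isRelPrime
      · intro p hp
        exact (mem_ssIrr0.mp hp).2.1.squarefree
    refine ⟨?_, hsq.squarefree_of_dvd h⟩
    have hc : IsCoprime X (∏ p ∈ ssIrr0 F n, p) := IsCoprime.prod_right fun r hr => by
      have h2 := mem_ssIrr0.mp hr
      exact ss_irr_coprime irreducible_X monic_X h2.2.1 h2.2.2.1 (Ne.symm h2.1)
    obtain ⟨a, b, hab⟩ := hc
    have := congrArg (aeval A) hab
    have h0 : aeval A (∏ p ∈ ssIrr0 F n, p) = 0 := by rwa [← minpoly.dvd_iff]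
    rw [map_add, map_mul, map_mul, aeval_X, map_one, h0, mul_zero, add_zero] at this
    exact IsUnit.of_mul_eq_one_right _ this

lemma ss_quotient {F : Type} [Field F] [Fintype F] (n : ℕ) :
    (Nat.card {A : Matrix (Fin n) (Fin n) F // IsUnit A ∧ Squarefree (minpoly F A)} : ℝ) /
          (Nat.card {A : Matrix (Fin n) (Fin n) F // IsUnit A} : ℝ) =
    PowerSeries.coeff n (∏ p ∈ ssIrr0 F n, ssEs (((Fintype.card F : ℝ)⁻¹) ^ p.natDegree) p.natDegree) := by
  have h1 : Nat.card {A : Matrix (Fin n) (Fin n) F // IsUnit A} = ssG F n := by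
    symm
    refine Nat.card_eq_of_bijective (fun g : GL (Fin n) F => ⟨g.1, g.isUnit⟩) ⟨fun a b h => ?_, fun ⟨A, hA⟩ => ?_⟩
    · exact Units.ext (congrArg Subtype.val h)
    · obtain ⟨u, rfl⟩ := hA
      exact ⟨u, rfl⟩
  have h2 : Nat.card {A : Matrix (Fin n) (Fin n) F // IsUnit A ∧ Squarefree (minpoly F A)} = ssC (∏ p ∈ ssIrr0 F n, p) n := by
    simp only [ss_semisimple_iff]; rfl
  rw [h1, h2, ← Finset.prod_congr rfl fun p hp => ssCP_irr (mem_ssIrr0.mp hp).2.1, ← ssCP_prod, ssCP, PowerSeries.coeff_mk]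
  intro p hp
  exact ⟨(mem_ssIrr0.mp hp).2.1, (mem_ssIrr0.mp hp).2.2.1⟩
end

section
open Finset Filter Topology Polynomial

/-- power series `∑ f k X^(d k)`. -/
noncomputable def ssSp (d : ℕ) (f : ℕ → ℝ) : PowerSeries ℝ :=
  PowerSeries.mk fun n => if d ∣ n then f (n / d) else 0

lemma ssSp_ev {d : ℕ} (hd : 0 < d) (f : ℕ → ℝ) (t K : ℝ) (ht : 0 ≤ t) (hs : Summable fun k => |f k| * (t ^ d) ^ k)
    (hK : ∑' k, |f k| * (t ^ d) ^ k ≤ K) : SsEv t (ssSp d f) (∑' k, f k * (t ^ d) ^ k) K := by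
  have hinj : Function.Injective (fun k => d * k) := fun a b h => Nat.eq_of_mul_eq_mul_left hd h
  have h0 : ∀ n, n ∉ Set.range (fun k => d * k) → PowerSeries.coeff n (ssSp d f) * t ^ n = 0 := by
    intro n hn
    have : ¬ d ∣ n := fun ⟨k, hk⟩ => hn ⟨k, hk.symm⟩
    simp [ssSp, this]
  have h1 : ∀ k, PowerSeries.coeff (d * k) (ssSp d f) * t ^ (d * k) = f k * (t ^ d) ^ k := by
    intro k
    simp [ssSp, Nat.mul_div_cancel_left _ hd, pow_mul]
  have h2 : ∀ k, ‖PowerSeries.coeff (d * k) (ssSp d f) * t ^ (d * k)‖ = |f k| * (t ^ d) ^ k := by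
    intro k
    rw [h1, Real.norm_eq_abs, abs_mul, abs_of_nonneg (pow_nonneg (pow_nonneg ht d) k)]
  have h0' : ∀ n, n ∉ Set.range (fun k => d * k) → ‖PowerSeries.coeff n (ssSp d f) * t ^ n‖ = 0 := by
    intro n hn; rw [h0 n hn, norm_zero]
  refine ⟨?_, ?_, ?_⟩
  · rw [← hinj.summable_iff h0']
    simpa only [Function.comp_def, h2] using hs
  · rw [← hinj.tsum_eq (Function.support_subset_iff'.mpr h0)]
    simp only [h1]
  · rw [← hinj.tsum_eq (Function.support_subset_iff'.mpr h0')]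
    simpa only [h2] using hK

noncomputable def ssh (x : ℝ) : ℕ → ℝ
  | 0 => 1
  | (k+1) => x ^ ((k+1)^2) * ssE x ((k+1 : ℕ) : ℤ) - x * (x ^ (k^2) * ssE x (k : ℤ))

lemma ssH_eq (x : ℝ) {d : ℕ} (hd : 0 < d) :
    (1 - PowerSeries.C x * PowerSeries.X ^ d) * ssEs x d = ssSp d (ssh x) := by
  ext n
  rw [sub_mul, one_mul, map_sub, mul_assoc, PowerSeries.coeff_C_mul, PowerSeries.coeff_X_pow_mul']
  simp only [ssEs, ssSp, PowerSeries.coeff_mk]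
  by_cases h : d ∣ n
  · obtain ⟨k, rfl⟩ := h
    rcases k with _ | k
    · simp [ssh, ssE_zero, hd.ne']
    · have e : d * (k+1) - d = d * k := by rw [mul_add, mul_one]; omega
      have hle : d ≤ d * (k+1) := Nat.le_mul_of_pos_right _ (Nat.succ_pos k)
      rw [if_pos hle, e]
      simp only [dvd_mul_right, if_true, Nat.mul_div_cancel_left _ hd, ssh]
  · rw [if_neg h, if_neg h]
    split_ifs with h1 h2
    · exact absurd ((Nat.dvd_sub_iff_left h1 dvd_rfl).mp h2) h
    · simp
    · simp

lemma ss_ev_one {x : ℝ} (h0 : 0 < x) (h1 : x < 1) {d : ℕ} (hd : 0 < d) :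
    ∃ K, SsEv 1 (ssSp d (ssh x)) ((1 - x) * ∑' s : ℕ, x ^ (s ^ 2) * ssE x s) K := by
  have hs := (ss_rogers_ramanujan h0 h1).1
  have h := ssSp_ev hd (fun s : ℕ => x ^ (s ^ 2) * ssE x s) 1 _ zero_le_one (by simpa using hs.abs) le_rfl
  simp only [one_pow, mul_one] at h
  have h2 := (SsEv.one_sub 1 x d hd).mul h
  rw [one_pow, mul_one] at h2
  rw [← ssH_eq x hd]
  exact ⟨_, h2⟩

lemma ssh_bound {r P y : ℝ} (r0 : 0 < r) (r1 : r < 1) (hP : 0 < P) (hPs : ∀ k, P ≤ ssPoc (y ^ 3) k) (y0 : 0 < y)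
    (yr : y ≤ r) (k : ℕ) : |ssh (y^3) (k+1)| * (y⁻¹) ^ (k+1) ≤ 2 * P⁻¹ / r * y ^ 4 * r ^ k := by
  have y1 : y < 1 := by linarith
  have x0 : 0 < y ^ 3 := by positivity
  have x1 : y ^ 3 < 1 := pow_lt_one₀ y0.le y1 (by norm_num)
  have E1 : ∀ k : ℕ, ssE (y^3) k ≤ P⁻¹ := fun k => ssE_le hP hPs k
  have E0 : ∀ k : ℕ, 0 ≤ ssE (y^3) k := fun k => ssE_nonneg x0 x1 k
  have Pi : 0 < P⁻¹ := inv_pos.mpr hP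
  rcases k with _ | k
  · have hrec := ssE_rec x0 x1 1
    have e : ssh (y^3) 1 = y ^ 6 * ssE (y^3) (1:ℕ) := by
      simp only [sub_self, ssE_zero, zpow_one] at hrec
      simp only [ssh, ssE_zero, Nat.cast_zero]
      push_cast
      have : ssE (y^3) 1 = 1 + y^3 * ssE (y^3) 1 := by linarith
      norm_num
      linear_combination (y^3) * this
    rw [zero_add, e, abs_of_nonneg (mul_nonneg (by positivity) (E0 1)), pow_one, pow_zero, mul_one]
    have : y ^ 6 * ssE (y^3) (1:ℕ) * y⁻¹ = y ^ 5 * ssE (y^3) (1:ℕ) := by field_simp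
    rw [this]
    have h1 : y ^ 5 * ssE (y^3) (1:ℕ) ≤ y ^ 4 * P⁻¹ :=
      mul_le_mul (pow_le_pow_of_le_one y0.le y1.le (by norm_num)) (E1 1) (E0 1) (by positivity)
    have h2 : 2 * P⁻¹ / r * y ^ 4 = (y ^ 4 * P⁻¹) * (2 / r) := by ring
    rw [h2]
    refine h1.trans (le_mul_of_one_le_right (by positivity) ?_)
    rw [le_div_iff₀ r0]; linarith
  · have a1 : ∀ (m j : ℕ) , k + 4 + (k+2) ≤ m → y ^ m * ssE (y^3) j * (y⁻¹)^(k+2) ≤ P⁻¹ * y ^ (k+4) := by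
      intro m j hm
      have : y ^ m * ssE (y^3) j * (y⁻¹)^(k+2) = ssE (y^3) j * y ^ (m - (k+2)) := by
        have : y ^ m = y ^ (m - (k+2)) * y ^ (k+2) := by rw [← pow_add]; congr 1; omega
        rw [this, inv_pow]; field_simp
      rw [this]
      exact mul_le_mul (E1 j) (pow_le_pow_of_le_one y0.le y1.le (by omega)) (by positivity) Pi.le
    have b1 := a1 (3 * (k+2)^2) (k+2) (by nlinarith)
    have b2 := a1 (3 + 3 * (k+1)^2) (k+1) (by nlinarith)
    have hh : |ssh (y^3) (k+1+1)| ≤ y ^ (3 * (k+2)^2) * ssE (y^3) (k+2:ℕ) + y ^ (3 + 3 * (k+1)^2) * ssE (y^3) (k+1:ℕ) := by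
      have : ssh (y^3) (k+1+1) = y ^ (3 * (k+2)^2) * ssE (y^3) (k+2:ℕ) - y ^ (3 + 3 * (k+1)^2) * ssE (y^3) (k+1:ℕ) := by
        simp only [ssh]
        rw [pow_add y, pow_mul y 3, pow_mul y 3, mul_assoc]
      rw [this]
      refine (abs_sub _ _).trans ?_
      rw [abs_of_nonneg (mul_nonneg (by positivity) (E0 _)), abs_of_nonneg (mul_nonneg (by positivity) (E0 _))]
    calc |ssh (y^3) (k+1+1)| * (y⁻¹) ^ (k+1+1) ≤ (y ^ (3 * (k+2)^2) * ssE (y^3) (k+2:ℕ) + y ^ (3 + 3 * (k+1)^2) * ssE (y^3) (k+1:ℕ)) * (y⁻¹) ^ (k+2) := by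
          gcongr
      _ ≤ 2 * P⁻¹ * y ^ (k+4) := by rw [add_mul]; linarith
      _ ≤ 2 * P⁻¹ * y ^ 4 * r ^ k := by
          rw [pow_add, mul_comm (y^k), ← mul_assoc]
          gcongr
      _ = _ := by rw [pow_succ r k]; field_simp

lemma ss_ev_theta {r P : ℝ} (r0 : 0 < r) (r1 : r < 1) (hP : 0 < P) (hPs : ∀ k, P ≤ ssPoc (r ^ 3) k) {d : ℕ} (hd : 0 < d) :
    ∃ v, SsEv r⁻¹ (ssSp d (ssh ((r ^ 3) ^ d))) v (1 + 2 * P⁻¹ / r / (1 - r) * (r ^ 4) ^ d) := by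
  set y := r ^ d with hy
  have y0 : 0 < y := by positivity
  have yr : y ≤ r := by
    calc y ≤ r ^ 1 := pow_le_pow_of_le_one r0.le r1.le hd
      _ = r := pow_one r
  have e3 : (r ^ 3) ^ d = y ^ 3 := by rw [hy, ← pow_mul, ← pow_mul, mul_comm]
  have e4 : (r ^ 4) ^ d = y ^ 4 := by rw [hy, ← pow_mul, ← pow_mul, mul_comm]
  have ei : (r⁻¹) ^ d = y⁻¹ := by rw [inv_pow]
  rw [e3, e4]
  have hPs' : ∀ k, P ≤ ssPoc (y ^ 3) k := by
    intro k
    refine (hPs k).trans ?_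
    unfold ssPoc
    refine Finset.prod_le_prod (fun i _ => ?_) (fun i _ => ?_)
    · have : (r ^ 3) ^ (i+1) ≤ 1 := pow_le_one₀ (by positivity) (pow_le_one₀ r0.le r1.le)
      linarith
    · have : (y ^ 3) ^ (i+1) ≤ (r ^ 3) ^ (i+1) := by gcongr
      linarith
  have hb := ssh_bound r0 r1 hP hPs' y0 yr
  have hg : HasSum (fun k => 2 * P⁻¹ / r * y ^ 4 * r ^ k) (2 * P⁻¹ / r * y ^ 4 * (1 - r)⁻¹) :=
    (hasSum_geometric_of_lt_one r0.le r1).mul_left _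
  have hs : Summable fun k => |ssh (y^3) (k+1)| * (y⁻¹) ^ (k+1) :=
    Summable.of_nonneg_of_le (fun k => by positivity) hb hg.summable
  have hs' : Summable fun k => |ssh (y^3) k| * (y⁻¹) ^ k := (summable_nat_add_iff 1).mp hs
  refine ⟨_, ssSp_ev hd _ _ _ (by positivity) (by rw [ei]; exact hs') ?_⟩
  rw [ei, hs'.tsum_eq_zero_add]
  have h1 := hs.tsum_le_tsum hb hg.summable
  rw [hg.tsum_eq] at h1
  have h2 : |ssh (y^3) 0| * (y⁻¹) ^ 0 = 1 := by simp [ssh]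
  rw [h2]
  have : 2 * P⁻¹ / r * y ^ 4 * (1 - r)⁻¹ = 2 * P⁻¹ / r / (1 - r) * y ^ 4 := by ring
  linarith

lemma ss_tail {f : PowerSeries ℝ} {v v' K K' r : ℝ} (r0 : 0 < r) (r1 : r < 1) (h1 : SsEv 1 f v K') (h2 : SsEv r⁻¹ f v' K) (n : ℕ) :
    |∑ i ∈ range (n+1), PowerSeries.coeff i f - v| ≤ K * r ^ n := by
  have hs1 : Summable fun n => PowerSeries.coeff n f := by
    have := h1.sm.of_norm
    simpa using this
  have hv : ∑' n, PowerSeries.coeff n f = v := by simpa using h1.val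
  have hsplit := hs1.sum_add_tsum_nat_add (n+1)
  rw [hv] at hsplit
  have : ∑ i ∈ range (n+1), PowerSeries.coeff i f - v = - ∑' i, PowerSeries.coeff (i + (n+1)) f := by linarith
  rw [this, abs_neg]
  have hs2 := (summable_nat_add_iff (n+1)).mpr h2.sm
  have hb : ∀ i, ‖PowerSeries.coeff (i + (n+1)) f‖ ≤ ‖PowerSeries.coeff (i + (n+1)) f * r⁻¹ ^ (i + (n+1))‖ * r ^ n := by
    intro i
    rw [norm_mul, mul_assoc]
    refine le_mul_of_one_le_right (norm_nonneg _) ?_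
    rw [Real.norm_of_nonneg (by positivity)]
    have : r⁻¹ ^ (i + (n+1)) * r ^ n = r⁻¹ ^ (i+1) := by
      rw [show i + (n+1) = (i+1) + n by ring, pow_add, mul_assoc, ← mul_pow, inv_mul_cancel₀ r0.ne', one_pow, mul_one]
    rw [this]
    exact one_le_pow₀ ((one_le_inv₀ r0).mpr r1.le)
  calc |∑' i, PowerSeries.coeff (i + (n+1)) f| ≤ ∑' i, ‖PowerSeries.coeff (i + (n+1)) f * r⁻¹ ^ (i + (n+1))‖ * r ^ n :=
        tsum_of_norm_bounded (hs2.mul_right (r^n)).hasSum hb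
    _ = (∑' i, ‖PowerSeries.coeff (i + (n+1)) f * r⁻¹ ^ (i + (n+1))‖) * r ^ n := tsum_mul_right
    _ ≤ K * r ^ n := by
        refine mul_le_mul_of_nonneg_right (le_trans ?_ h2.le) (by positivity)
        have := h2.sm.sum_add_tsum_nat_add (n+1)
        have h0 : 0 ≤ ∑ i ∈ range (n+1), ‖PowerSeries.coeff i f * r⁻¹ ^ i‖ := Finset.sum_nonneg fun _ _ => norm_nonneg _
        linarith

/-- value of the local factor at `1` -/
noncomputable def ssR (x : ℝ) : ℝ := (1 - x) * ∑' s : ℕ, x ^ (s ^ 2) * ssE x s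

section
variable {F : Type} [Field F] [Fintype F]

lemma ss_coeff_sum {n : ℕ} (hn : 1 ≤ n) {z : ℝ} (hz : z = (Fintype.card F : ℝ)⁻¹) :
    PowerSeries.coeff n (∏ p ∈ ssIrr0 F n, ssEs (z ^ p.natDegree) p.natDegree) =
    ∑ i ∈ range (n+1), PowerSeries.coeff i ((1 - PowerSeries.C z * PowerSeries.X ^ 1) *
      ∏ p ∈ ssIrr0 F n, ssSp p.natDegree (ssh (z ^ p.natDegree))) := by
  have hq : (Fintype.card F : ℝ) ≠ 0 := by exact_mod_cast Fintype.card_ne_zero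
  have hM := ssM_mul (ssIrr F n) (fun p hp => ⟨(mem_ssIrr.mp hp).1, (mem_ssIrr.mp hp).2.1⟩)
  have hM' := congrArg (PowerSeries.rescale z) hM
  rw [map_mul, map_prod, map_one, ssIrr_prod hn] at hM'
  simp only [map_sub, map_one, map_pow, PowerSeries.rescale_X, mul_pow, natDegree_X] at hM'
  simp only [← map_pow] at hM'
  rw [pow_one] at hM'
  set A := ∏ p ∈ ssIrr0 F n, ssEs (z ^ p.natDegree) p.natDegree
  have hB : (1 - PowerSeries.C z * PowerSeries.X ^ 1) *
      ∏ p ∈ ssIrr0 F n, ssSp p.natDegree (ssh (z ^ p.natDegree)) = (1 - PowerSeries.C z * PowerSeries.X ^ 1) *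
      (∏ p ∈ ssIrr0 F n, (1 - PowerSeries.C (z ^ p.natDegree) * PowerSeries.X ^ p.natDegree)) * A := by
    rw [mul_assoc, ← Finset.prod_mul_distrib]
    congr 1
    exact Finset.prod_congr rfl fun p hp => (ssH_eq _ (mem_ssIrr0.mp hp).2.1.natDegree_pos).symm
  set B := (1 - PowerSeries.C z * PowerSeries.X ^ 1) *
      ∏ p ∈ ssIrr0 F n, ssSp p.natDegree (ssh (z ^ p.natDegree))
  have hA : A = B * PowerSeries.rescale z (ssM (ssIrr F n)) := by
    rw [hB]
    linear_combination (-A) * hM'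
  rw [hA, PowerSeries.coeff_mul]
  rw [← Finset.Nat.sum_antidiagonal_eq_sum_range_succ (fun i _ => PowerSeries.coeff i B)]
  refine Finset.sum_congr rfl fun ij hij => ?_
  have hij := Finset.HasAntidiagonal.mem_antidiagonal.mp hij
  rw [PowerSeries.coeff_rescale, ssM, PowerSeries.coeff_mk, ssSm_irr (by omega), hz]
  push_cast
  rw [← mul_pow, inv_mul_cancel₀ hq, one_pow, mul_one]

lemma ss_approx {z : ℝ} (hz : z = (Fintype.card F : ℝ)⁻¹) : ∃ K r : ℝ, 0 < r ∧ r < 1 ∧ ∀ n, 1 ≤ n →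
    |PowerSeries.coeff n (∏ p ∈ ssIrr0 F n, ssEs (z ^ p.natDegree) p.natDegree) -
      (1 - z) * ∏ p ∈ ssIrr0 F n, ssR (z ^ p.natDegree)| ≤ K * r ^ n := by
  have hq : (1:ℝ) < Fintype.card F := by exact_mod_cast Fintype.one_lt_card
  have z0 : 0 < z := by rw [hz]; positivity
  have z1 : z < 1 := by rw [hz]; exact inv_lt_one_of_one_lt₀ hq
  obtain ⟨r, r0, r3⟩ : ∃ r : ℝ, 0 < r ∧ r ^ 3 = z :=
    ⟨z ^ ((1:ℝ)/3), by positivity, by rw [← Real.rpow_natCast, ← Real.rpow_mul z0.le]; norm_num⟩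
  have r1 : r < 1 := by
    by_contra h
    have := one_le_pow₀ (n := 3) (not_lt.mp h)
    linarith
  obtain ⟨P, hP, -, hPs⟩ := ssPoc_tendsto z0 z1
  rw [← r3] at hPs
  set C := 2 * P⁻¹ / r / (1 - r) with hC
  have hC0 : 0 ≤ C := by
    have : 0 < 1 - r := by linarith
    positivity
  have hqr : (Fintype.card F : ℝ) * r ^ 4 = r := by
    have : (Fintype.card F : ℝ) * r ^ 3 = 1 := by rw [r3, hz]; exact mul_inv_cancel₀ (by linarith)
    linear_combination r * this
  refine ⟨(1 + |z * r⁻¹ ^ 1|) * Real.exp (C * (-Real.log (1 - r))), r, r0, r1, fun n hn => ?_⟩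
  rw [ss_coeff_sum hn hz]
  have hz' : ∀ d : ℕ, z ^ d < 1 ∨ d = 0 := fun d => by
    rcases Nat.eq_zero_or_pos d with h | h
    · exact Or.inr h
    · exact Or.inl (pow_lt_one₀ z0.le z1 h.ne')
  have ev1 : ∀ p : F[X], ∃ K, p ∈ ssIrr0 F n → SsEv 1 (ssSp p.natDegree (ssh (z ^ p.natDegree))) (ssR (z ^ p.natDegree)) K := by
    intro p
    by_cases hp : p ∈ ssIrr0 F n
    · have hd := (mem_ssIrr0.mp hp).2.1.natDegree_pos
      obtain ⟨K, hK⟩ := ss_ev_one (x := z ^ p.natDegree) (by positivity) (pow_lt_one₀ z0.le z1 hd.ne') hd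
      exact ⟨K, fun _ => hK⟩
    · exact ⟨0, fun h => absurd h hp⟩
  choose K1 hK1 using ev1
  have ev2 : ∀ p : F[X], ∃ v, p ∈ ssIrr0 F n → SsEv r⁻¹ (ssSp p.natDegree (ssh (z ^ p.natDegree))) v (1 + C * (r ^ 4) ^ p.natDegree) := by
    intro p
    by_cases hp : p ∈ ssIrr0 F n
    · have hd := (mem_ssIrr0.mp hp).2.1.natDegree_pos
      obtain ⟨K, hK⟩ := ss_ev_theta r0 r1 hP hPs hd
      rw [r3] at hK
      exact ⟨K, fun _ => hK⟩
    · exact ⟨0, fun h => absurd h hp⟩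
  choose v2 hv2 using ev2
  have E1 := (SsEv.one_sub 1 z 1 one_pos).mul (SsEv.prod _ hK1)
  have E2 := (SsEv.one_sub r⁻¹ z 1 one_pos).mul (SsEv.prod _ hv2)
  have hKle : ∏ p ∈ ssIrr0 F n, (1 + C * (r ^ 4) ^ p.natDegree) ≤ Real.exp (C * (-Real.log (1 - r))) := by
    calc ∏ p ∈ ssIrr0 F n, (1 + C * (r ^ 4) ^ p.natDegree) ≤ ∏ p ∈ ssIrr0 F n, Real.exp (C * (r ^ 4) ^ p.natDegree) := by
          refine Finset.prod_le_prod (fun p _ => by positivity) fun p _ => ?_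
          rw [add_comm]; exact Real.add_one_le_exp _
      _ = Real.exp (C * ∑ p ∈ ssIrr0 F n, (r ^ 4) ^ p.natDegree) := by rw [← Real.exp_sum, Finset.mul_sum]
      _ ≤ _ := by
          apply Real.exp_le_exp.mpr
          refine mul_le_mul_of_nonneg_left ?_ hC0
          have := ss_sum_pow_le (F := F) (ssIrr0 F n) (fun p hp => ⟨(mem_ssIrr0.mp hp).2.1, (mem_ssIrr0.mp hp).2.2.1⟩)
            (t := r ^ 4) (by positivity) (by rw [hqr]; exact r1)
          rwa [hqr] at this
  have := ss_tail r0 r1 E1 E2 n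
  rw [one_pow, mul_one] at this
  refine this.trans ?_
  gcongr

end
end

section
open Finset Filter Topology Polynomial

noncomputable def ssg (z : ℝ) (m : ℕ) : ℝ :=
  ((1 - z ^ (5*m+4)) * (1 - z ^ (5*m+6))) / ((1 - z ^ (5*m+3)) * (1 - z ^ (5*m+5)))

lemma ss_pow_lt {z : ℝ} (z0 : 0 < z) (z1 : z < 1) (k : ℕ) (hk : 0 < k) : 0 < 1 - z ^ k := by
  have := pow_lt_one₀ z0.le z1 hk.ne'
  linarith

/-- the local limit -/
lemma ssR_tendsto {x : ℝ} (h0 : 0 < x) (h1 : x < 1) :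
    Tendsto (fun M => ∏ m ∈ range M, ((1 - x ^ (5*m+4)) * (1 - x ^ (5*m+6)))⁻¹) atTop (𝓝 (ssR x)) := by
  have hp := ss_pow_lt h0 h1
  have h := (ss_rogers_ramanujan h0 h1).2
  have e : ∀ M : ℕ, ∏ m ∈ range M, ((1 - x ^ (5*m+4)) * (1 - x ^ (5*m+6)))⁻¹ =
     ((1 - x) * ∏ m ∈ range M, ((1 - x ^ (5*m+1)) * (1 - x ^ (5*m+4)))⁻¹) * (1 - x ^ (5*M+1))⁻¹ := by
    intro M
    induction M with
    | zero => 
      have := hp 1 one_pos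
      rw [pow_one] at this
      simp [this.ne']
    | succ M ih =>
      rw [prod_range_succ, prod_range_succ, ih]
      have a1 := (hp (5*M+1) (by omega)).ne'
      have a2 := (hp (5*M+4) (by omega)).ne'
      have a3 := (hp (5*M+6) (by omega)).ne'
      rw [show 5*(M+1)+1 = 5*M+6 by ring]
      field_simp
  simp only [e]
  have hx : Tendsto (fun M : ℕ => (1 - x ^ (5*M+1))⁻¹) atTop (𝓝 1) := by
    have : Tendsto (fun M : ℕ => x ^ (5*M+1)) atTop (𝓝 0) :=
      (tendsto_pow_atTop_nhds_zero_of_lt_one h0.le h1).comp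
        (tendsto_atTop_mono (fun M => by omega : ∀ M : ℕ, M ≤ 5*M+1) tendsto_id)
    have h2 := ((tendsto_const_nhds (x := (1:ℝ))).sub this).inv₀ (by norm_num)
    simpa using h2
  have := (h.const_mul (1 - x)).mul hx
  rw [mul_one] at this
  exact this

section
variable {F : Type} [Field F] [Fintype F]

lemma ss_factor_lim {z : ℝ} (hz : z = (Fintype.card F : ℝ)⁻¹) (k : ℕ) (hk : 2 ≤ k) :
    (∀ N, 1 ≤ N → (∏ p ∈ ssIrr0 F N, (1 - (z ^ p.natDegree) ^ k))⁻¹ ≤ (1 - z ^ k) / (1 - z ^ (k-1))) ∧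
    Tendsto (fun N => (∏ p ∈ ssIrr0 F N, (1 - (z ^ p.natDegree) ^ k))⁻¹) atTop (𝓝 ((1 - z ^ k) / (1 - z ^ (k-1)))) := by
  have hq : (1:ℝ) < Fintype.card F := by exact_mod_cast Fintype.one_lt_card
  have z0 : 0 < z := by rw [hz]; positivity
  have z1 : z < 1 := by rw [hz]; exact inv_lt_one_of_one_lt₀ hq
  have hqz : (Fintype.card F : ℝ) * z ^ k = z ^ (k-1) := by
    have : (Fintype.card F : ℝ) * z = 1 := by rw [hz]; exact mul_inv_cancel₀ (by linarith)
    have e : z ^ k = z * z ^ (k-1) := by rw [← pow_succ']; congr 1; omega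
    rw [e, ← mul_assoc, this, one_mul]
  have p1 := ss_pow_lt z0 z1 k (by omega)
  have p2 := ss_pow_lt z0 z1 (k-1) (by omega)
  have hlt : (Fintype.card F : ℝ) * z ^ k < 1 := by rw [hqz]; linarith
  have e : ∀ N, 1 ≤ N → (∏ p ∈ ssIrr0 F N, (1 - (z ^ p.natDegree) ^ k))⁻¹ = (1 - z ^ k) * (∏ p ∈ ssIrr F N, (1 - (z ^ k) ^ p.natDegree))⁻¹ := by
    intro N hN
    rw [ssIrr_prod hN, natDegree_X, pow_one]
    simp only [← pow_mul, mul_comm k]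
    rw [mul_inv, ← mul_assoc, mul_inv_cancel₀ p1.ne', one_mul]
  constructor
  · intro N hN
    rw [e N hN, div_eq_mul_inv]
    have := ss_zeta_prod_ge (F := F) (ssIrr F N) (fun p hp => ⟨(mem_ssIrr.mp hp).1, (mem_ssIrr.mp hp).2.1⟩)
      (t := z ^ k) (by positivity) hlt
    rw [hqz] at this
    gcongr
  · have h := ss_zeta_tendsto (F := F) (t := z ^ k) (by positivity) hlt
    rw [hqz] at h
    have h2 := (h.inv₀ p2.ne').const_mul (1 - z ^ k)
    rw [div_eq_mul_inv]
    refine h2.congr' ?_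
    filter_upwards [eventually_ge_atTop 1] with N hN
    exact (e N hN).symm

lemma ss_L_tendsto {z G : ℝ} (hz : z = (Fintype.card F : ℝ)⁻¹)
    (hG : Tendsto (fun M => ∏ m ∈ range M, ssg z m) atTop (𝓝 G)) :
    Tendsto (fun N => ∏ p ∈ ssIrr0 F N, ssR (z ^ p.natDegree)) atTop (𝓝 G) := by
  have hq : (1:ℝ) < Fintype.card F := by exact_mod_cast Fintype.one_lt_card
  have z0 : 0 < z := by rw [hz]; positivity
  have z1 : z < 1 := by rw [hz]; exact inv_lt_one_of_one_lt₀ hq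
  let g : ℕ → ℕ → ℝ := fun N m => ∏ p ∈ ssIrr0 F N, ((1 - (z ^ p.natDegree) ^ (5*m+4)) * (1 - (z ^ p.natDegree) ^ (5*m+6)))⁻¹
  have hgp : ∀ N m, g N m = (∏ p ∈ ssIrr0 F N, (1 - (z ^ p.natDegree) ^ (5*m+4)))⁻¹ * (∏ p ∈ ssIrr0 F N, (1 - (z ^ p.natDegree) ^ (5*m+6)))⁻¹ := by
    intro N m
    simp only [g, mul_inv, Finset.prod_mul_distrib, Finset.prod_inv_distrib]
  have hssg : ∀ m, ssg z m = (1 - z ^ (5*m+4)) / (1 - z ^ (5*m+4-1)) * ((1 - z ^ (5*m+6)) / (1 - z ^ (5*m+6-1))) := by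
    intro m
    rw [ssg, div_mul_div_comm]
    rfl
  have pos : ∀ N k, 0 < k → ∀ p ∈ ssIrr0 F N, 0 < 1 - (z ^ p.natDegree) ^ k ∧ 1 - (z ^ p.natDegree) ^ k ≤ 1 := by
    intro N k hk p hp
    have hd := (mem_ssIrr0.mp hp).2.1.natDegree_pos
    rw [← pow_mul]
    refine ⟨ss_pow_lt z0 z1 _ (by positivity), ?_⟩
    have : 0 < z ^ (p.natDegree * k) := by positivity
    linarith
  have hg1 : ∀ N m, 1 ≤ g N m := by
    intro N m
    have h1 : ∏ p ∈ ssIrr0 F N, (1:ℝ) ≤ g N m := by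
      refine Finset.prod_le_prod (fun _ _ => zero_le_one) (fun p hp => ?_)
      have a := pos N (5*m+4) (by omega) p hp
      have b := pos N (5*m+6) (by omega) p hp
      rw [one_le_inv₀ (mul_pos a.1 b.1)]
      exact mul_le_one₀ a.2 b.1.le b.2
    rwa [Finset.prod_const_one] at h1
  have hg2 : ∀ N, 1 ≤ N → ∀ m, g N m ≤ ssg z m := by
    intro N hN m
    rw [hgp, hssg]
    have p0 : ∀ k, 0 < k → 0 ≤ (∏ p ∈ ssIrr0 F N, (1 - (z ^ p.natDegree) ^ k))⁻¹ := fun k hk =>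
      inv_nonneg.mpr (Finset.prod_nonneg fun p hp => (pos N k hk p hp).1.le)
    have h1 := (ss_factor_lim (F := F) hz (5*m+4) (by omega)).1 N hN
    exact mul_le_mul h1 ((ss_factor_lim (F := F) hz (5*m+6) (by omega)).1 N hN) (p0 _ (by omega)) ((p0 _ (by omega)).trans h1)
  have hglim : ∀ m, Tendsto (fun N => g N m) atTop (𝓝 (ssg z m)) := by
    intro m
    simp only [hgp, hssg]
    exact (ss_factor_lim (F := F) hz (5*m+4) (by omega)).2.mul (ss_factor_lim (F := F) hz (5*m+6) (by omega)).2
  have hL : ∀ N, Tendsto (fun M => ∏ m ∈ range M, g N m) atTop (𝓝 (∏ p ∈ ssIrr0 F N, ssR (z ^ p.natDegree))) := by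
    intro N
    have : Tendsto (fun M => ∏ p ∈ ssIrr0 F N, ∏ m ∈ range M, ((1 - (z ^ p.natDegree) ^ (5*m+4)) * (1 - (z ^ p.natDegree) ^ (5*m+6)))⁻¹)
        atTop (𝓝 (∏ p ∈ ssIrr0 F N, ssR (z ^ p.natDegree))) := by
      refine tendsto_finsetProd _ fun p hp => ?_
      have hd := (mem_ssIrr0.mp hp).2.1.natDegree_pos
      exact ssR_tendsto (by positivity) (pow_lt_one₀ z0.le z1 hd.ne')
    refine this.congr fun M => ?_
    rw [Finset.prod_comm]
  have hmono : ∀ N M, ∏ m ∈ range M, g N m ≤ ∏ p ∈ ssIrr0 F N, ssR (z ^ p.natDegree) := by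
    intro N M
    have hm : Monotone fun M => ∏ m ∈ range M, g N m := by
      refine monotone_nat_of_le_succ fun M => ?_
      rw [prod_range_succ]
      exact le_mul_of_one_le_right (Finset.prod_nonneg fun m _ => zero_le_one.trans (hg1 N m)) (hg1 N M)
    exact hm.ge_of_tendsto (hL N) M
  have hle : ∀ N, 1 ≤ N → ∏ p ∈ ssIrr0 F N, ssR (z ^ p.natDegree) ≤ G := by
    intro N hN
    exact le_of_tendsto_of_tendsto' (hL N) hG fun M =>
      Finset.prod_le_prod (fun m _ => zero_le_one.trans (hg1 N m)) fun m _ => hg2 N hN m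
  refine tendsto_order.2 ⟨fun a ha => ?_, fun b hb => ?_⟩
  · obtain ⟨M, hM⟩ := ((tendsto_order.1 hG).1 a ha).exists
    have hlim : Tendsto (fun N => ∏ m ∈ range M, g N m) atTop (𝓝 (∏ m ∈ range M, ssg z m)) :=
      tendsto_finsetProd _ fun m _ => hglim m
    filter_upwards [(tendsto_order.1 hlim).1 a hM] with N hN
    exact hN.trans_le (hmono N M)
  · filter_upwards [eventually_ge_atTop 1] with N hN
    exact (hle N hN).trans_lt hb

end

lemma ss_final_prod {z : ℝ} (z0 : 0 < z) (z1 : z < 1) :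
    Tendsto (fun M => ∏ m ∈ range M, ssg z m) atTop (𝓝 ((∏' r : {r : ℕ // 1 ≤ r ∧ (r % 5 = 0 ∨ r % 5 = 2 ∨ r % 5 = 3)},
        (1 - z ^ ((r : ℕ) - 1)) / (1 - z ^ (r : ℕ))) / (1 - z))) := by
  classical
  have hp := ss_pow_lt z0 z1
  let f : ℕ → ℝ := fun r => (1 - z ^ (r - 1)) / (1 - z ^ r)
  let s : Set ℕ := {r : ℕ | 1 ≤ r ∧ (r % 5 = 0 ∨ r % 5 = 2 ∨ r % 5 = 3)}
  have ht : (∏' r : {r : ℕ // 1 ≤ r ∧ (r % 5 = 0 ∨ r % 5 = 2 ∨ r % 5 = 3)},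
        (1 - z ^ ((r : ℕ) - 1)) / (1 - z ^ (r : ℕ))) = ∏' n, s.mulIndicator f n := tprod_subtype s f
  have hm : Multipliable (s.mulIndicator f) := by
    have hs : Summable fun n => ‖s.mulIndicator f n - 1‖ := by
      refine Summable.of_nonneg_of_le (fun _ => norm_nonneg _) (fun n => ?_)
        ((summable_geometric_of_lt_one z0.le z1).mul_left z⁻¹)
      by_cases hn : n ∈ s
      · rw [Set.mulIndicator_of_mem hn]
        obtain ⟨k, rfl⟩ : ∃ k, n = k + 1 := ⟨n - 1, by have := hn.1; omega⟩
        have h1 := hp (k+1) (by omega)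
        have h2 : z ^ (k+1) ≤ z := by
          calc z ^ (k+1) ≤ z ^ 1 := pow_le_pow_of_le_one z0.le z1.le (by omega)
            _ = z := pow_one z
        have e : f (k+1) - 1 = - (z ^ k * ((1 - z) / (1 - z ^ (k+1)))) := by
          simp only [f, Nat.add_sub_cancel]
          field_simp
          ring
        rw [e, norm_neg, Real.norm_of_nonneg (by have : 0 < 1 - z := by linarith
                                                 positivity)]
        have e2 : z⁻¹ * z ^ (k+1) = z ^ k := by rw [pow_succ]; field_simp
        rw [e2]
        refine mul_le_of_le_one_right (by positivity) ?_
        rw [div_le_one h1]; linarith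
      · rw [Set.mulIndicator_of_notMem hn, sub_self, norm_zero]; positivity
    have := Real.multipliable_one_add_of_summable hs.of_norm
    simpa using this
  rw [ht]
  have hT := hm.hasProd.tendsto_prod_nat
  have hT2 := hT.comp (tendsto_atTop_mono (fun M => by omega : ∀ M : ℕ, M ≤ 5*M+1) tendsto_id)
  have hin : ∀ n, n ∈ s → s.mulIndicator f n = f n := fun n hn => Set.mulIndicator_of_mem hn f
  have hout : ∀ n, n ∉ s → s.mulIndicator f n = 1 := fun n hn => Set.mulIndicator_of_notMem hn f
  have hms : ∀ n, n ∈ s ↔ 1 ≤ n ∧ (n % 5 = 0 ∨ n % 5 = 2 ∨ n % 5 = 3) := fun n => Iff.rfl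
  have e : ∀ M : ℕ, ∏ m ∈ range M, ssg z m = (∏ n ∈ range (5*M+1), s.mulIndicator f n) * (1 - z ^ (5*M+1)) / (1 - z) := by
    intro M
    have hz1 : (1 - z) ≠ 0 := by linarith
    induction M with
    | zero => 
      simp [hout 0 (by rw [hms]; omega), hz1]
    | succ M ih =>
      rw [prod_range_succ, ih, show 5 * (M+1) + 1 = 5*M+1+1+1+1+1+1 by ring]
      simp only [prod_range_succ _ (5*M+1+1+1+1+1), prod_range_succ _ (5*M+1+1+1+1), prod_range_succ _ (5*M+1+1+1), prod_range_succ _ (5*M+1+1), prod_range_succ _ (5*M+1)]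
      rw [hout (5*M+1) (by rw [hms]; omega), hin (5*M+1+1) (by rw [hms]; omega), hin (5*M+1+1+1) (by rw [hms]; omega),
        hout (5*M+1+1+1+1) (by rw [hms]; omega), hin (5*M+1+1+1+1+1) (by rw [hms]; omega)]
      simp only [f, ssg, add_assoc, Nat.reduceAdd]
      have a2 := (hp (5*M+2) (by omega)).ne'
      have a3 := (hp (5*M+3) (by omega)).ne'
      have a5 := (hp (5*M+5) (by omega)).ne'
      have a6 := (hp (5*M+6) (by omega)).ne'
      simp only [show 5*M+2-1 = 5*M+1 by omega, show 5*M+3-1 = 5*M+2 by omega, show 5*M+5-1 = 5*M+4 by omega]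
      field_simp
  simp only [e]
  have hx : Tendsto (fun M : ℕ => (1 - z ^ (5*M+1))) atTop (𝓝 1) := by
    have : Tendsto (fun M : ℕ => z ^ (5*M+1)) atTop (𝓝 0) :=
      (tendsto_pow_atTop_nhds_zero_of_lt_one z0.le z1).comp
        (tendsto_atTop_mono (fun M => by omega : ∀ M : ℕ, M ≤ 5*M+1) tendsto_id)
    simpa using (tendsto_const_nhds (x := (1:ℝ))).sub this
  have := (hT2.mul hx).div_const (1 - z)
  rw [mul_one] at this
  exact this

theorem ss_main {F : Type} [Field F] [Fintype F] {z : ℝ} (hz : z = (Fintype.card F : ℝ)⁻¹) :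
    Filter.Tendsto
      (fun n =>
        (Nat.card {A : Matrix (Fin n) (Fin n) F // IsUnit A ∧ Squarefree (minpoly F A)} : ℝ) /
          (Nat.card {A : Matrix (Fin n) (Fin n) F // IsUnit A} : ℝ))
      Filter.atTop
      (nhds (∏' r : {r : ℕ // 1 ≤ r ∧ (r % 5 = 0 ∨ r % 5 = 2 ∨ r % 5 = 3)},
        (1 - z ^ ((r : ℕ) - 1)) / (1 - z ^ (r : ℕ)))) := by
  have hq : (1:ℝ) < Fintype.card F := by exact_mod_cast Fintype.one_lt_card
  have z0 : 0 < z := by rw [hz]; positivity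
  have z1 : z < 1 := by rw [hz]; exact inv_lt_one_of_one_lt₀ hq
  have h1 := (ss_L_tendsto (F := F) hz (ss_final_prod z0 z1)).const_mul (1 - z)
  rw [mul_div_cancel₀ _ (by linarith : (1 - z) ≠ 0)] at h1
  obtain ⟨K, r, r0, r1, hK⟩ := ss_approx (F := F) hz
  have h2 : Tendsto (fun n : ℕ => K * r ^ n) atTop (𝓝 0) := by
    simpa using (tendsto_pow_atTop_nhds_zero_of_lt_one r0.le r1).const_mul K
  simp only [ss_quotient, ← hz]
  have h3 : Tendsto (fun n => PowerSeries.coeff n (∏ p ∈ ssIrr0 F n, ssEs (z ^ p.natDegree) p.natDegree) -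
      (1 - z) * ∏ p ∈ ssIrr0 F n, ssR (z ^ p.natDegree)) atTop (𝓝 0) := by
    refine squeeze_zero_norm' ?_ h2
    filter_upwards [eventually_ge_atTop 1] with n hn
    exact hK n hn
  simpa using h3.add h1
end

/-- The proportion of semisimple matrices (squarefree minimal polynomial, i.e. diagonalizable
over the algebraic closure) among invertible `n × n` matrices over a finite field with `q`
elements tends, as `n → ∞`, to
`∏_{r ≥ 1, r ≡ 0, ±2 (mod 5)} (1 − q^{−(r−1)})/(1 − q^{−r})`. -/
theorem tendsto_semisimpleProportion_GL {F : Type} [Field F] [Fintype F] (q : ℕ)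
    (hq : Fintype.card F = q) :
    Filter.Tendsto
      (fun n =>
        (Nat.card {A : Matrix (Fin n) (Fin n) F // IsUnit A ∧ Squarefree (minpoly F A)} : ℝ) /
          (Nat.card {A : Matrix (Fin n) (Fin n) F // IsUnit A} : ℝ))
      Filter.atTop
      (nhds (∏' r : {r : ℕ // 1 ≤ r ∧ (r % 5 = 0 ∨ r % 5 = 2 ∨ r % 5 = 3)},
        (1 - ((q : ℝ))⁻¹ ^ ((r : ℕ) - 1)) / (1 - ((q : ℝ))⁻¹ ^ (r : ℕ)))) := by
  subst hq
  exact ss_main rfl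
end

section
/- Let F_q be a finite field with q elements, let N_d(q) be the number of monic irreducible polynomials of degree d over F_q, and let |GL(n,q)| = ∏_{i=0}^{n−1}(q^n − q^i) (with |GL(0,q)| = 1). Then for every real u with 0 ≤ u < 1, ∑_{n=0}^∞ u^n · (number of n×n matrices over F_q with squarefree characteristic polynomial)/|GL(n,q)| = ∏_{d=1}^∞ (1 + u^d/(q^d − 1))^{N_d(q)}. -/
/-- The number of monic irreducible polynomials of degree `d` over the finite field `F`. -/
noncomputable def numMonicIrred (F : Type) [Field F] [Fintype F] (d : ℕ) : ℕ :=
  Nat.card {p : Polynomial F // p.Monic ∧ Irreducible p ∧ p.natDegree = d}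

open Polynomial

theorem sgf_dvd_mat {F : Type} [Field F] {n : Type} [Fintype n] [DecidableEq n]
    (A : Matrix n n F) (p g : F[X]) (hp : Irreducible p) (hpc : p ∣ A.charpoly)
    (hg : aeval A g = 0) : p ∣ g := by
  have : Fact (Irreducible p) := ⟨hp⟩
  let φ := algebraMap F (AdjoinRoot p)
  have h1 : IsRoot (A.map φ).charpoly (AdjoinRoot.root p) := by
    rw [Matrix.charpoly_map, IsRoot, eval_map]
    obtain ⟨c, hc⟩ := hpc
    rw [hc, eval₂_mul]
    have := AdjoinRoot.eval₂_root p
    simp only [φ, AdjoinRoot.algebraMap_eq]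
    rw [this, zero_mul]
  have h2 := Matrix.mem_spectrum_of_isRoot_charpoly h1
  have h3 := spectrum.subset_polynomial_aeval (A.map φ) (g.map φ) ⟨_, h2, rfl⟩
  have h4 : aeval (A.map φ) (g.map φ) = 0 := by
    have h5 : (φ.mapMatrix) (aeval A g) = aeval (A.map φ) (g.map φ) := by
      rw [aeval_def, hom_eval₂, aeval_def, eval₂_map]
      congr 1
      ext a i j
      simp [Matrix.algebraMap_matrix_apply, Matrix.map_apply]
      split_ifs <;> simp
    rw [← h5, hg, map_zero]
  rw [h4] at h3
  have : Nonempty n := by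
    by_contra hne
    rw [not_nonempty_iff] at hne
    rw [Matrix.charpoly_isEmpty] at hpc
    exact hp.not_isUnit (isUnit_of_dvd_one hpc)
  rw [spectrum.zero_eq] at h3
  have h6 : eval (AdjoinRoot.root p) (g.map φ) = 0 := by simpa using h3
  rw [eval_map] at h6
  rw [← AdjoinRoot.mk_eq_zero, ← AdjoinRoot.aeval_eq, aeval_def]
  exact h6

theorem sgf_dvd_end {F : Type} [Field F] {V : Type} [AddCommGroup V] [Module F V]
    [FiniteDimensional F V] (T : Module.End F V) (p g : F[X]) (hp : Irreducible p)
    (hpc : p ∣ T.charpoly) (hg : aeval T g = 0) : p ∣ g := by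
  let b := Module.finBasis F V
  refine sgf_dvd_mat (LinearMap.toMatrix b b T) p g hp ?_ ?_
  · rwa [LinearMap.charpoly_toMatrix]
  · have : aeval (LinearMap.toMatrixAlgEquiv b T) g = 0 := by
      rw [aeval_algHom_apply, hg, map_zero]
    exact this

abbrev SgfI (F : Type) [Field F] := {p : F[X] // p.Monic ∧ Irreducible p}

theorem sgf_coprime {F : Type} [Field F] (p r : SgfI F) (h : p ≠ r) : IsCoprime p.1 r.1 := by
  rw [p.2.2.coprime_iff_not_dvd]
  intro hd
  exact h (Subtype.ext (eq_of_monic_of_associated p.2.1 r.2.1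
    (p.2.2.associated_of_dvd r.2.2 hd)))

theorem sgf_cyclic {F : Type} [Field F] {V : Type} [AddCommGroup V] [Module F V]
    [FiniteDimensional F V] (T : Module.End F V) (S : Finset (SgfI F))
    (hT : T.charpoly = ∏ p ∈ S, p.1) :
    ∃ v : V, ∀ g : F[X], aeval T g v = 0 → (∏ p ∈ S, p.1) ∣ g := by
  classical
  have key : ∀ p : SgfI F, p ∈ S → ¬ p.1 ∣ ∏ r ∈ S.erase p, r.1 := by
    intro p hp hd
    have : IsCoprime p.1 (∏ r ∈ S.erase p, r.1) :=
      IsCoprime.prod_right fun r hr => sgf_coprime p r (Finset.ne_of_mem_erase hr).symm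
    exact (p.2.2.coprime_iff_not_dvd.1 this) hd
  have h1 : ∀ p : SgfI F, ∃ w : V, p ∈ S → aeval T (∏ r ∈ S.erase p, r.1) w ≠ 0 := by
    intro p
    by_contra! hcon
    have hp := (hcon 0).1
    refine key p hp (sgf_dvd_end T p.1 _ p.2.2 ?_ ?_)
    · rw [hT]; exact Finset.dvd_prod_of_mem _ hp
    · ext w; exact (hcon w).2
  choose w hw using h1
  have hmul : ∀ (a b : F[X]) (x : V), aeval T (a * b) x = aeval T a (aeval T b x) := by
    intro a b x; simp
  have hkill : ∀ p ∈ S, ∀ g : F[X], p.1 ∣ g →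
      aeval T g (aeval T (∏ r ∈ S.erase p, r.1) (w p)) = 0 := by
    rintro p hp g ⟨c, rfl⟩
    rw [← hmul, mul_comm p.1 c, mul_assoc, Finset.mul_prod_erase S (fun p : SgfI F => p.1) hp,
      ← hT, hmul, LinearMap.aeval_self_charpoly]
    simp
  refine ⟨∑ p ∈ S, aeval T (∏ r ∈ S.erase p, r.1) (w p), fun g hg => ?_⟩
  refine Finset.prod_dvd_of_coprime (fun p _ r _ h => sgf_coprime p r h) fun p hp => ?_
  have h2 : aeval T ((∏ r ∈ S.erase p, r.1) * g) (aeval T (∏ r ∈ S.erase p, r.1) (w p)) = 0 := by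
    have := congrArg (aeval T (∏ r ∈ S.erase p, r.1)) hg
    rw [← hmul, map_zero, map_sum, Finset.sum_eq_single_of_mem p hp] at this
    · exact this
    · intro r hr hrp
      apply hkill r hr
      exact Dvd.dvd.mul_right (Finset.dvd_prod_of_mem _ (Finset.mem_erase.2 ⟨hrp, hr⟩)) _
  by_contra hnd
  have hnd2 : ¬ p.1 ∣ (∏ r ∈ S.erase p, r.1) * g := fun h =>
    (p.2.2.prime.dvd_or_dvd h).elim (key p hp) hnd
  obtain ⟨a, b, hab⟩ := p.2.2.coprime_iff_not_dvd.2 hnd2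
  apply hw p hp
  have h3 := congrArg (fun z => aeval T z (aeval T (∏ r ∈ S.erase p, r.1) (w p))) hab
  simp only [map_add, LinearMap.add_apply] at h3
  rw [hkill p hp _ (dvd_mul_left _ _), hmul b, h2] at h3
  simpa using h3.symm

theorem sgf_prod_monic {F : Type} [Field F] (S : Finset (SgfI F)) :
    (∏ p ∈ S, p.1).Monic := monic_prod_of_monic _ _ fun p _ => p.2.1

/-- Multiplication by the root. -/
noncomputable abbrev sgfL {F : Type} [Field F] (f : F[X]) : Module.End F (AdjoinRoot f) :=
  Algebra.lmul F (AdjoinRoot f) (AdjoinRoot.root f)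

theorem sgfL_charpoly {F : Type} [Field F] (f : F[X]) [Module.Finite F (AdjoinRoot f)]
    (hf : f.Monic) :
    (sgfL f).charpoly = f := by
  let b := AdjoinRoot.powerBasis' hf
  rw [← LinearMap.charpoly_toMatrix (sgfL f) b.basis]
  have h := charpoly_leftMulMatrix b
  rw [AdjoinRoot.powerBasis'_gen] at h
  have h2 : minpoly F (AdjoinRoot.root f) = f := by
    have := AdjoinRoot.minpoly_powerBasis_gen_of_monic hf
    simpa using this
  rw [h2] at h
  exact h

theorem sgfL_aeval {F : Type} [Field F] (f g : F[X]) :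
    aeval (sgfL f) g = Algebra.lmul F (AdjoinRoot f) (AdjoinRoot.mk f g) := by
  rw [aeval_algHom_apply, AdjoinRoot.aeval_eq]

theorem sgf_conj {F : Type} [Field F] (S : Finset (SgfI F)) (f : F[X]) (hf : f = ∏ p ∈ S, p.1)
    [Module.Finite F (AdjoinRoot f)]
    (T : Module.End F (AdjoinRoot f)) (hT : T.charpoly = f) :
    ∃ g : (Module.End F (AdjoinRoot f))ˣ, (g : Module.End F (AdjoinRoot f)) * sgfL f = T * g := by
  obtain ⟨v, hv⟩ := sgf_cyclic T S (hT.trans hf)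
  rw [← hf] at hv
  have hf0 : aeval T f = 0 := by
    have := LinearMap.aeval_self_charpoly T
    rwa [hT] at this
  let ev : Module.End F (AdjoinRoot f) →ₗ[F] AdjoinRoot f := LinearMap.applyₗ v
  let ψ : AdjoinRoot f →ₐ[F] Module.End F (AdjoinRoot f) :=
    Ideal.Quotient.liftₐ (Ideal.span {f}) (aeval T) (by
      intro a ha
      obtain ⟨c, rfl⟩ := Ideal.mem_span_singleton.1 ha
      rw [map_mul, hf0, zero_mul])
  have hψ : ∀ g, ψ (AdjoinRoot.mk f g) = aeval T g := fun g => rfl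
  let φ : Module.End F (AdjoinRoot f) := ev.comp ψ.toLinearMap
  have hφ : ∀ g, φ (AdjoinRoot.mk f g) = aeval T g v := fun g => rfl
  have hinj : Function.Injective φ := by
    rw [injective_iff_map_eq_zero]
    intro a
    induction a using AdjoinRoot.induction_on with
    | ih g =>
      intro h
      rw [hφ] at h
      exact AdjoinRoot.mk_eq_zero.2 (hv g h)
  have hu : IsUnit φ := (Module.End.isUnit_iff _).2 ⟨hinj, LinearMap.injective_iff_surjective.1 hinj⟩
  refine ⟨hu.unit, ?_⟩
  ext a
  induction a using AdjoinRoot.induction_on with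
  | ih g =>
    have h1 : (sgfL f) (AdjoinRoot.mk f g) = AdjoinRoot.mk f (X * g) := by
      rw [map_mul, AdjoinRoot.mk_X]; rfl
    change φ (sgfL f _) = T (φ _)
    rw [h1, hφ, hφ]
    simp

theorem sgf_comm {F : Type} [Field F] (f : F[X]) (g : Module.End F (AdjoinRoot f)) :
    g * sgfL f = sgfL f * g ↔ ∃ a, g = Algebra.lmul F (AdjoinRoot f) a := by
  constructor
  · intro h
    refine ⟨g 1, ?_⟩
    ext a
    induction a using AdjoinRoot.induction_on with
    | ih r =>
      have h1 : Commute g (aeval (sgfL f) r) := by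
        induction r using Polynomial.induction_on' with
        | add p q hp hq => rw [map_add]; exact hp.add_right hq
        | monomial n a =>
          rw [aeval_monomial]
          exact Commute.mul_right (Algebra.commutes a g).symm (Commute.pow_right h n)
      have h2 := congrArg (fun z : Module.End F (AdjoinRoot f) => z 1) h1.eq
      rw [sgfL_aeval] at h2
      simp only [Module.End.mul_apply] at h2
      simpa [mul_comm] using h2
  · rintro ⟨a, rfl⟩
    rw [← map_mul, ← map_mul, mul_comm]

theorem sgf_card_orbit {F : Type} [Field F] [Fintype F] (S : Finset (SgfI F)) (f : F[X])
    (hf : f = ∏ p ∈ S, p.1) [Module.Finite F (AdjoinRoot f)] :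
    Nat.card {T : Module.End F (AdjoinRoot f) // T.charpoly = f} * Nat.card (AdjoinRoot f)ˣ =
      Nat.card (Module.End F (AdjoinRoot f))ˣ := by
  have hm : f.Monic := hf ▸ sgf_prod_monic S
  let G := ConjAct (Module.End F (AdjoinRoot f))ˣ
  have horb : MulAction.orbit G (sgfL f) = {T | T.charpoly = f} := by
    ext T
    simp only [MulAction.mem_orbit_iff, Set.mem_ofPred_eq]
    constructor
    · rintro ⟨g, rfl⟩
      rw [ConjAct.units_smul_def]
      have := LinearEquiv.charpoly_conj
        (LinearMap.GeneralLinearGroup.generalLinearEquiv F _ (ConjAct.ofConjAct g)) (sgfL f)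
      rw [sgfL_charpoly f hm] at this
      exact this
    · intro hT
      obtain ⟨g, hg⟩ := sgf_conj S f hf T hT
      refine ⟨ConjAct.toConjAct g, ?_⟩
      rw [ConjAct.units_smul_def, ConjAct.ofConjAct_toConjAct, hg, mul_assoc, Units.mul_inv, mul_one]
  have hstab : ∀ g : G, g ∈ MulAction.stabilizer G (sgfL f) ↔
      ((ConjAct.ofConjAct g : (Module.End F (AdjoinRoot f))ˣ) : Module.End F (AdjoinRoot f)) * sgfL f
        = sgfL f * (ConjAct.ofConjAct g : (Module.End F (AdjoinRoot f))ˣ) := by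
    intro g
    rw [MulAction.mem_stabilizer_iff, ConjAct.units_smul_def, Units.mul_inv_eq_iff_eq_mul]
  have hinj : Function.Injective (Algebra.lmul F (AdjoinRoot f)) := Algebra.lmul_injective
  let e : (AdjoinRoot f)ˣ → MulAction.stabilizer G (sgfL f) := fun a =>
    ⟨ConjAct.toConjAct (Units.map (Algebra.lmul F (AdjoinRoot f)).toMonoidHom a), by
      rw [hstab]
      exact (sgf_comm f _).2 ⟨a, rfl⟩⟩
  have he : Function.Bijective e := by
    constructor
    · intro a b hab
      have h1 := congrArg (fun z : MulAction.stabilizer G (sgfL f) =>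
        ((ConjAct.ofConjAct z.1 : (Module.End F (AdjoinRoot f))ˣ) : Module.End F (AdjoinRoot f))) hab
      exact Units.ext (hinj h1)
    · rintro ⟨g, hg⟩
      have hg1 := (hstab g).1 hg
      obtain ⟨a, ha⟩ := (sgf_comm f _).1 hg1
      have hg2 : (((ConjAct.ofConjAct g)⁻¹ : (Module.End F (AdjoinRoot f))ˣ) :
          Module.End F (AdjoinRoot f)) * sgfL f = sgfL f * ((ConjAct.ofConjAct g)⁻¹ :
          (Module.End F (AdjoinRoot f))ˣ) := by
        exact ((show Commute _ _ from hg1).units_inv_left).eq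
      obtain ⟨b, hb⟩ := (sgf_comm f _).1 hg2
      refine ⟨⟨a, b, hinj ?_, hinj ?_⟩, ?_⟩
      · rw [map_mul, ← ha, ← hb, map_one, Units.mul_inv]
      · rw [map_mul, ← ha, ← hb, map_one, Units.inv_mul]
      · apply Subtype.ext
        apply ConjAct.ofConjAct.injective
        apply Units.ext
        exact ha.symm
  have hfin : Finite (Module.End F (AdjoinRoot f)) := Module.finite_of_finite F
  have hcard := Nat.card_congr (MulAction.orbitProdStabilizerEquivGroup G (sgfL f))
  rw [Nat.card_prod, ← Nat.card_congr (Equiv.ofBijective e he), horb] at hcard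
  exact hcard

theorem sgf_card_mat {F : Type} [Field F] [Fintype F] (S : Finset (SgfI F)) (n : ℕ)
    (hn : ∑ p ∈ S, p.1.natDegree = n) :
    Nat.card {A : Matrix (Fin n) (Fin n) F // A.charpoly = ∏ p ∈ S, p.1} *
      Nat.card (AdjoinRoot (∏ p ∈ S, p.1))ˣ = Nat.card (GL (Fin n) F) := by
  have hm := sgf_prod_monic S
  have hd : (∏ p ∈ S, p.1).natDegree = n := by
    rw [natDegree_prod_of_monic _ _ fun p _ => p.2.1, hn]
  generalize hf : (∏ p ∈ S, p.1) = f at *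
  let pb := AdjoinRoot.powerBasis' hm
  have : Module.Finite F (AdjoinRoot f) := pb.finite
  have hdim : pb.dim = n := by rw [← hd]; rfl
  let b : Module.Basis (Fin n) F (AdjoinRoot f) := pb.basis.reindex (finCongr hdim)
  let E := LinearMap.toMatrixAlgEquiv b
  have h1 : Nat.card {A : Matrix (Fin n) (Fin n) F // A.charpoly = f} =
      Nat.card {T : Module.End F (AdjoinRoot f) // T.charpoly = f} := by
    refine (Nat.card_congr (E.toEquiv.subtypeEquiv fun T => ?_)).symm
    have : (E T).charpoly = T.charpoly := LinearMap.charpoly_toMatrix T b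
    change T.charpoly = f ↔ (E T).charpoly = f
    rw [this]
  rw [h1, sgf_card_orbit S f hf.symm]
  exact Nat.card_congr (Units.mapEquiv E.toMulEquiv).toEquiv

theorem sgf_card_units_irr {F : Type} [Field F] [Fintype F] (p : SgfI F) :
    Nat.card (AdjoinRoot p.1)ˣ = Fintype.card F ^ p.1.natDegree - 1 := by
  have : Fact (Irreducible p.1) := ⟨p.2.2⟩
  let pb := AdjoinRoot.powerBasis' p.2.1
  have : Module.Finite F (AdjoinRoot p.1) := pb.finite
  rw [Nat.card_units, Module.natCard_eq_pow_finrank (K := F), Nat.card_eq_fintype_card, pb.finrank]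
  rfl

theorem sgf_crt {R ι : Type} [CommRing R] [Fintype ι] (I : ι → Ideal R)
    (hI : Pairwise fun i j => IsCoprime (I i) (I j)) (J : Ideal R) (hJ : J = ⨅ i, I i) :
    Nat.card (R ⧸ J)ˣ = ∏ i, Nat.card (R ⧸ I i)ˣ := by
  subst hJ
  have e := Ideal.quotientInfRingEquivPiQuotient I hI
  rw [Nat.card_congr (Units.mapEquiv e.toMulEquiv).toEquiv, Nat.card_congr MulEquiv.piUnits.toEquiv,
    Nat.card_pi]

theorem sgf_card_units {F : Type} [Field F] [Fintype F] (S : Finset (SgfI F)) :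
    Nat.card (AdjoinRoot (∏ p ∈ S, p.1))ˣ = ∏ p ∈ S, (Fintype.card F ^ p.1.natDegree - 1) := by
  classical
  have hcop : Pairwise fun p r : S => IsCoprime (Ideal.span {p.1.1}) (Ideal.span {r.1.1}) := by
    intro p r h
    rw [Ideal.isCoprime_span_singleton_iff]
    exact sgf_coprime p.1 r.1 fun h' => h (Subtype.ext h')
  have hI : Ideal.span {∏ p ∈ S, p.1} = ⨅ p : S, Ideal.span {p.1.1} := by
    have h3 : ∀ p r : S, p ≠ r → IsCoprime p.1.1 r.1.1 := fun p r h =>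
      sgf_coprime p.1 r.1 fun h' => h (Subtype.ext h')
    have h4 := Ideal.iInf_span_singleton (I := fun p : S => p.1.1) h3
    rw [h4]
    congr 2
    exact (Finset.prod_coe_sort S (fun p : SgfI F => p.1)).symm
  have h2 : Nat.card (AdjoinRoot (∏ p ∈ S, p.1))ˣ =
    Nat.card (F[X] ⧸ Ideal.span {∏ p ∈ S, p.1})ˣ := rfl
  rw [h2, sgf_crt (fun p : S => Ideal.span {p.1.1}) hcop _ hI, ← Finset.prod_coe_sort S]
  exact Finset.prod_congr rfl fun p _ => sgf_card_units_irr p.1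

theorem sgf_fiber_inj {F : Type} [Field F] (d : ℕ) :
    Function.Injective (fun (p : {p : SgfI F // p.1.natDegree = d}) (i : Fin d) =>
      p.1.1.coeff i) := by
  rintro ⟨p, hp⟩ ⟨r, hr⟩ h
  apply Subtype.ext
  apply Subtype.ext
  ext i
  rcases lt_trichotomy i d with hi | hi | hi
  · exact congrFun h ⟨i, hi⟩
  · subst hi
    have h1 := p.2.1.coeff_natDegree
    have h2 := r.2.1.coeff_natDegree
    rw [hp] at h1
    rw [hr] at h2
    rw [h1, h2]
  · rw [coeff_eq_zero_of_natDegree_lt (hp.trans_lt hi), coeff_eq_zero_of_natDegree_lt (hr.trans_lt hi)]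

instance sgf_fiber_finite {F : Type} [Field F] [Fintype F] (d : ℕ) :
    Finite {p : SgfI F // p.1.natDegree = d} := Finite.of_injective _ (sgf_fiber_inj d)

theorem sgf_fiber_card_le {F : Type} [Field F] [Fintype F] (d : ℕ) :
    Nat.card {p : SgfI F // p.1.natDegree = d} ≤ Fintype.card F ^ d := by
  have := Nat.card_le_card_of_injective _ (sgf_fiber_inj (F := F) d)
  simpa using this

theorem sgf_num {F : Type} [Field F] [Fintype F] (d : ℕ) :
    numMonicIrred F d = Nat.card {p : SgfI F // p.1.natDegree = d} := by
  unfold numMonicIrred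
  exact Nat.card_congr
    { toFun := fun p => ⟨⟨p.1, p.2.1, p.2.2.1⟩, p.2.2.2⟩
      invFun := fun p => ⟨p.1.1, p.1.2.1, p.1.2.2, p.2⟩
      left_inv := fun _ => rfl
      right_inv := fun _ => rfl }

theorem sgf_num_zero {F : Type} [Field F] [Fintype F] :
    Nat.card {p : SgfI F // p.1.natDegree = 0} = 0 := by
  have : IsEmpty {p : SgfI F // p.1.natDegree = 0} := by
    refine ⟨fun p => ?_⟩
    have := p.1.2.2.natDegree_pos
    have := p.2
    omega
  exact Nat.card_of_isEmpty

theorem sgf_prod_inj {F : Type} [Field F] (S S' : Finset (SgfI F))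
    (h : ∏ p ∈ S, p.1 = ∏ p ∈ S', p.1) : S = S' := by
  have key : ∀ S S' : Finset (SgfI F), ∏ p ∈ S, p.1 = ∏ p ∈ S', p.1 → S ⊆ S' := by
    intro S S' h p hp
    by_contra hn
    have h1 : IsCoprime p.1 (∏ r ∈ S', r.1) :=
      IsCoprime.prod_right fun r hr => sgf_coprime p r fun e => hn (e ▸ hr)
    rw [p.2.2.coprime_iff_not_dvd, ← h] at h1
    exact h1 (Finset.dvd_prod_of_mem _ hp)
  exact Finset.Subset.antisymm (key _ _ h) (key _ _ h.symm)

theorem sgf_prod_surj {F : Type} [Field F] (f : F[X]) (hf : f.Monic) (hs : Squarefree f) :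
    ∃ S : Finset (SgfI F), f = ∏ p ∈ S, p.1 := by
  classical
  have hnd := (UniqueFactorizationMonoid.squarefree_iff_nodup_normalizedFactors hf.ne_zero).1 hs
  have hP : ∀ p ∈ (UniqueFactorizationMonoid.normalizedFactors f).toFinset,
      p.Monic ∧ Irreducible p := by
    intro p hp
    rw [Multiset.mem_toFinset] at hp
    have hi := UniqueFactorizationMonoid.irreducible_of_normalized_factor p hp
    refine ⟨?_, hi⟩
    rw [← UniqueFactorizationMonoid.normalize_normalized_factor p hp]
    exact monic_normalize hi.ne_zero
  refine ⟨(UniqueFactorizationMonoid.normalizedFactors f).toFinset.subtype _, ?_⟩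
  rw [Finset.prod_subtype_of_mem (fun p => p) hP]
  have h1 := UniqueFactorizationMonoid.prod_normalizedFactors_eq hf.ne_zero
  rw [hf.normalize_eq_self] at h1
  conv_lhs => rw [← h1]
  rw [Finset.prod, Multiset.toFinset_val, hnd.dedup, Multiset.map_id']

theorem sgf_squarefree {F : Type} [Field F] (S : Finset (SgfI F)) :
    Squarefree (∏ p ∈ S, p.1) :=
  Finset.squarefree_prod_of_pairwise_isCoprime (fun p _ r _ h => (sgf_coprime p r h).isRelPrime)
    fun p _ => p.2.2.squarefree

/-- The decomposition of separable matrices by characteristic polynomial. -/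
theorem sgf_sigma {F : Type} [Field F] [Fintype F] (n : ℕ) :
    Nonempty ((Σ S : {S : Finset (SgfI F) // ∑ p ∈ S, p.1.natDegree = n},
      {A : Matrix (Fin n) (Fin n) F // A.charpoly = ∏ p ∈ S.1, p.1}) ≃
      {A : Matrix (Fin n) (Fin n) F // Squarefree A.charpoly}) := by
  refine ⟨Equiv.ofBijective (fun x => ⟨x.2.1, by
    rw [x.2.2]; exact sgf_squarefree x.1.1⟩) ⟨?_, ?_⟩⟩
  · rintro ⟨⟨S, hS⟩, ⟨A, hA⟩⟩ ⟨⟨S', hS'⟩, ⟨A', hA'⟩⟩ h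
    have h1 : A = A' := congrArg Subtype.val h
    subst h1
    have h2 := sgf_prod_inj S S' (hA.symm.trans hA')
    subst h2
    rfl
  · rintro ⟨A, hA⟩
    obtain ⟨S, hS⟩ := sgf_prod_surj _ A.charpoly_monic hA
    have hdeg : ∑ p ∈ S, p.1.natDegree = n := by
      rw [← natDegree_prod_of_monic _ _ fun p _ => p.2.1, ← hS, Matrix.charpoly_natDegree_eq_dim,
        Fintype.card_fin]
    exact ⟨⟨⟨S, hdeg⟩, ⟨A, hS⟩⟩, rfl⟩

theorem sgf_units_pos {F : Type} [Field F] [Fintype F] (S : Finset (SgfI F)) :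
    0 < ∏ p ∈ S, (Fintype.card F ^ p.1.natDegree - 1) := by
  refine Finset.prod_pos fun p _ => ?_
  have := Nat.one_lt_pow p.2.2.natDegree_pos.ne' (Fintype.one_lt_card (α := F))
  omega

instance sgf_fiberS_finite {F : Type} [Field F] [Fintype F] (n : ℕ) :
    Finite {S : Finset (SgfI F) // ∑ p ∈ S, p.1.natDegree = n} := by
  have h : ∀ S : {S : Finset (SgfI F) // ∑ p ∈ S, p.1.natDegree = n},
      Nonempty {A : Matrix (Fin n) (Fin n) F // A.charpoly = ∏ p ∈ S.1, p.1} := by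
    intro S
    have h1 := sgf_card_mat S.1 n S.2
    have h2 : 0 < Nat.card (GL (Fin n) F) := Nat.card_pos
    rw [← h1] at h2
    exact (Nat.card_pos_iff.1 (Nat.pos_of_mul_pos_right h2)).1
  let A := fun S => (h S).some
  obtain ⟨e⟩ := sgf_sigma (F := F) n
  refine Finite.of_injective (fun S => e ⟨S, A S⟩) fun S S' hS => ?_
  exact congrArg Sigma.fst (e.injective hS)

theorem sgf_term {F : Type} [Field F] [Fintype F] (q : ℕ) (hq : Fintype.card F = q) (u : ℝ)
    (n : ℕ) :
    HasSum (fun S : {S : Finset (SgfI F) // ∑ p ∈ S, p.1.natDegree = n} =>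
      ∏ p ∈ S.1, (u ^ p.1.natDegree / ((q : ℝ) ^ p.1.natDegree - 1)))
      (u ^ n * (Nat.card {A : Matrix (Fin n) (Fin n) F // Squarefree A.charpoly} : ℝ) /
        ∏ i ∈ Finset.range n, ((q : ℝ) ^ n - (q : ℝ) ^ i)) := by
  have := Fintype.ofFinite {S : Finset (SgfI F) // ∑ p ∈ S, p.1.natDegree = n}
  have hq1 : 1 < q := hq ▸ Fintype.one_lt_card
  have hGL : (Nat.card (GL (Fin n) F) : ℝ) = ∏ i ∈ Finset.range n, ((q : ℝ) ^ n - (q : ℝ) ^ i) := by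
    rw [Matrix.card_GL_field, hq, Finset.prod_range, Nat.cast_prod]
    refine Finset.prod_congr rfl fun i _ => ?_
    rw [Nat.cast_sub (Nat.pow_le_pow_right hq1.le i.2.le)]
    push_cast
    rfl
  have hGL0 : (Nat.card (GL (Fin n) F) : ℝ) ≠ 0 := by
    exact_mod_cast Nat.card_pos.ne'
  obtain ⟨e⟩ := sgf_sigma (F := F) n
  rw [← hGL, ← Nat.card_congr e, Nat.card_sigma]
  convert hasSum_fintype _ using 1
  rw [Nat.cast_sum, Finset.mul_sum, Finset.sum_div]
  refine Finset.sum_congr rfl fun S _ => ?_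
  have h1 := sgf_card_mat S.1 n S.2
  rw [sgf_card_units, hq] at h1
  have h2 : ((∏ p ∈ S.1, (q ^ p.1.natDegree - 1) : ℕ) : ℝ) =
      ∏ p ∈ S.1, ((q : ℝ) ^ p.1.natDegree - 1) := by
    rw [Nat.cast_prod]
    refine Finset.prod_congr rfl fun p _ => ?_
    rw [Nat.cast_sub (Nat.one_le_pow _ _ (by omega))]
    push_cast
    rfl
  have h3 : ((∏ p ∈ S.1, (q ^ p.1.natDegree - 1) : ℕ) : ℝ) ≠ 0 := by
    have := sgf_units_pos S.1
    rw [hq] at this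
    exact_mod_cast this.ne'
  rw [Finset.prod_div_distrib, Finset.prod_pow_eq_pow_sum, S.2, ← h2]
  rw [← h1] at hGL0 ⊢
  rw [Nat.cast_mul] at hGL0 ⊢
  have h4 := left_ne_zero_of_mul hGL0
  field_simp

theorem sgf_summable {F : Type} [Field F] [Fintype F] (q : ℕ) (hq : Fintype.card F = q) (u : ℝ)
    (hu0 : 0 ≤ u) (hu1 : u < 1) :
    Summable fun p : SgfI F => u ^ p.1.natDegree / ((q : ℝ) ^ p.1.natDegree - 1) := by
  have hq1 : 1 < q := hq ▸ Fintype.one_lt_card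
  have hq2 : (2 : ℝ) ≤ q := by exact_mod_cast hq1
  have hnn : ∀ d : ℕ, 0 ≤ u ^ d / ((q : ℝ) ^ d - 1) := fun d =>
    div_nonneg (pow_nonneg hu0 d) (sub_nonneg.2 (one_le_pow₀ (by linarith)))
  rw [← (Equiv.sigmaFiberEquiv (fun p : SgfI F => p.1.natDegree)).summable_iff,
    summable_sigma_of_nonneg (fun x => by exact hnn _)]
  refine ⟨fun d => Summable.of_finite, ?_⟩
  have hbd : ∀ d : ℕ, (∑' p : {p : SgfI F // p.1.natDegree = d},
      ((fun p : SgfI F => u ^ p.1.natDegree / ((q : ℝ) ^ p.1.natDegree - 1)) ∘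
        (Equiv.sigmaFiberEquiv (fun p : SgfI F => p.1.natDegree))) ⟨d, p⟩) ≤ 2 * u ^ d := by
    intro d
    have h1 : ∀ p : {p : SgfI F // p.1.natDegree = d},
      ((fun p : SgfI F => u ^ p.1.natDegree / ((q : ℝ) ^ p.1.natDegree - 1)) ∘
        (Equiv.sigmaFiberEquiv (fun p : SgfI F => p.1.natDegree))) ⟨d, p⟩ =
        u ^ d / ((q : ℝ) ^ d - 1) := by
      rintro ⟨p, rfl⟩
      rfl
    rw [tsum_congr h1, tsum_const, nsmul_eq_mul]
    have h2 : (Nat.card {p : SgfI F // p.1.natDegree = d} : ℝ) ≤ (q : ℝ) ^ d := by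
      have := sgf_fiber_card_le (F := F) d
      rw [hq] at this
      exact_mod_cast this
    rcases Nat.eq_zero_or_pos d with rfl | hd
    · simp
    have h3 : (2 : ℝ) ≤ (q : ℝ) ^ d := hq2.trans (le_self_pow₀ (by linarith) hd.ne')
    refine (mul_le_mul_of_nonneg_right h2 (hnn d)).trans ?_
    rw [← mul_div_assoc, div_le_iff₀ (by linarith)]
    nlinarith [pow_nonneg hu0 d]
  refine Summable.of_nonneg_of_le (fun d => tsum_nonneg fun p => hnn _) hbd ?_
  exact (summable_geometric_of_lt_one hu0 hu1).mul_left 2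

theorem separable_generating_function {F : Type} [Field F] [Fintype F] (q : ℕ)
    (hq : Fintype.card F = q) (u : ℝ) (hu0 : 0 ≤ u) (hu1 : u < 1) :
    ∑' n : ℕ, u ^ n *
        (Nat.card {A : Matrix (Fin n) (Fin n) F // Squarefree A.charpoly} : ℝ) /
        ∏ i ∈ Finset.range n, ((q : ℝ) ^ n - (q : ℝ) ^ i) =
      ∏' d : ℕ, (1 + u ^ (d + 1) / ((q : ℝ) ^ (d + 1) - 1)) ^ numMonicIrred F (d + 1) := by
  have hs := sgf_summable (F := F) q hq u hu0 hu1
  have hs2 := summable_finsetProd_of_summable_norm hs.norm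
  have hP := hasProd_one_add_of_hasSum_prod hs2.hasSum
  -- the sum side
  have hsum := hs2.hasSum
  rw [← (Equiv.sigmaFiberEquiv (fun S : Finset (SgfI F) =>
    ∑ p ∈ S, p.1.natDegree)).hasSum_iff] at hsum
  have hS := (hsum.sigma fun n => sgf_term q hq u n).tsum_eq
  -- the product side
  rw [← (Equiv.sigmaFiberEquiv (fun p : SgfI F => p.1.natDegree)).hasProd_iff] at hP
  have hP2 := hP.sigma (g := fun d => (1 + u ^ d / ((q : ℝ) ^ d - 1)) ^ numMonicIrred F d) (by
    intro d
    have := Fintype.ofFinite {p : SgfI F // p.1.natDegree = d}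
    convert hasProd_fintype _ using 1
    have h1 : ∀ p : {p : SgfI F // p.1.natDegree = d},
      ((fun p : SgfI F => 1 + u ^ p.1.natDegree / ((q : ℝ) ^ p.1.natDegree - 1)) ∘
        (Equiv.sigmaFiberEquiv (fun p : SgfI F => p.1.natDegree))) ⟨d, p⟩ =
        1 + u ^ d / ((q : ℝ) ^ d - 1) := by
      rintro ⟨p, rfl⟩
      rfl
    rw [Finset.prod_congr rfl fun p _ => h1 p, Finset.prod_const, Finset.card_univ,
      ← Nat.card_eq_fintype_card, sgf_num])
  have hP3 := (Function.Injective.hasProd_iff (add_left_injective 1) (by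
    intro d hd
    have : d = 0 := by
      by_contra h
      exact hd ⟨d - 1, by simp only []; omega⟩
    subst this
    rw [sgf_num, sgf_num_zero, pow_zero])).2 hP2
  rw [hS]
  exact hP3.tprod_eq.symm
end

section
/- Let F_q be a finite field with q elements and N_d(q) the number of monic irreducible polynomials of degree d over F_q. For real u with 0 ≤ u < 1, define S_M(u,q) = ∑_{n=0}^∞ u^n · (number of n×n matrices over F_q with squarefree characteristic polynomial)/|GL(n,q)|, where |GL(n,q)| = ∏_{i=0}^{n−1}(q^n − q^i). Then S_M(u,q) = (∏_{d=1}^∞ (1 − u^d(u^d − 1)/(q^d(q^d − 1)))^{N_d(q)}) / (1 − u). -/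
open Polynomial

lemma irr_dvd_of_aeval {F : Type} [Field F] {n : ℕ} (A : Matrix (Fin n) (Fin n) F)
    (φ p : F[X]) (hφ : Irreducible φ) (hd : φ ∣ A.charpoly) (hp : aeval A p = 0) : φ ∣ p := by
  have : Fact (Irreducible φ) := ⟨hφ⟩
  let K := AdjoinRoot φ
  let α : K := AdjoinRoot.root φ
  let B : Matrix (Fin n) (Fin n) K := A.map (algebraMap F K)
  have hB : B = (Algebra.ofId F K).mapMatrix A := rfl
  have hroot : (Matrix.toLin' B).charpoly.IsRoot α := by
    rw [Matrix.charpoly_toLin', IsRoot.def, Matrix.charpoly_map]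
    obtain ⟨c, hc⟩ := hd
    rw [hc, eval_map, eval₂_mul]
    have : eval₂ (algebraMap F K) α φ = 0 := AdjoinRoot.eval₂_root φ
    rw [this, zero_mul]
  rw [← Module.End.hasEigenvalue_iff_isRoot_charpoly] at hroot
  obtain ⟨v, hv⟩ := hroot.exists_hasEigenvector
  have h1 := Module.End.aeval_apply_of_hasEigenvector (p := p.map (algebraMap F K)) hv
  have h2 : aeval (Matrix.toLin' B) (p.map (algebraMap F K)) = 0 := by
    have : Matrix.toLin' B = Matrix.toLinAlgEquiv' B := rfl
    rw [this, aeval_algHom_apply, aeval_map_algebraMap, hB, aeval_algHom_apply, hp]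
    simp
  rw [h2] at h1
  have h3 := (smul_eq_zero.mp h1.symm).resolve_right hv.2
  rw [eval_map] at h3
  rw [← AdjoinRoot.mk_eq_zero, ← AdjoinRoot.aeval_eq, aeval_def]
  exact h3

lemma squarefree_dvd {F : Type} [Field F] (f p : F[X]) (hf : Squarefree f) 
    (h : ∀ φ, Irreducible φ → φ ∣ f → φ ∣ p) : f ∣ p := by
  by_cases hp : p = 0
  · simp [hp]
  classical
  exact (UniqueFactorizationMonoid.dvd_iff_normalizedFactors_le_normalizedFactors hf.ne_zero hp).2 <| by
    rw [Multiset.le_iff_subset ((UniqueFactorizationMonoid.squarefree_iff_nodup_normalizedFactors hf.ne_zero).1 hf)]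
    intro φ hφ
    rw [UniqueFactorizationMonoid.mem_normalizedFactors_iff' hf.ne_zero] at hφ
    rw [UniqueFactorizationMonoid.mem_normalizedFactors_iff' hp]
    exact ⟨hφ.1, hφ.2.1, h _ hφ.1 hφ.2.2⟩

lemma exists_cyclic {F : Type} [Field F] {n : ℕ} (A : Matrix (Fin n) (Fin n) F)
    (hs : Squarefree A.charpoly) :
    ∃ v : Fin n → F, ∀ p : F[X], aeval (Matrix.toLin' A) p v = 0 → A.charpoly ∣ p := by
  obtain ⟨x, hx⟩ := Module.exists_ker_toSpanSingleton_eq_annihilator F[X]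
    (Module.AEval' (Matrix.toLin' A))
  obtain ⟨v, rfl⟩ := (Module.AEval'.of _).surjective x
  refine ⟨v, fun p hp => squarefree_dvd _ _ hs fun φ hφ hd => irr_dvd_of_aeval A φ p hφ hd ?_⟩
  have h1 : p ∈ LinearMap.ker (LinearMap.toSpanSingleton F[X] _ (Module.AEval'.of (Matrix.toLin' A) v)) := by
    rw [LinearMap.mem_ker, LinearMap.toSpanSingleton_apply]
    have := Module.AEval.of_aeval_smul (R := F) (A := Module.End F (Fin n → F)) (Matrix.toLin' A) p v
    refine this.symm.trans ?_
    rw [Module.End.smul_def, hp, map_zero]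
  rw [hx, Module.AEval.annihilator_eq_ker_aeval, RingHom.mem_ker] at h1
  have : Matrix.toLin' A = Matrix.toLinAlgEquiv' A := rfl
  rw [this, aeval_algHom_apply] at h1
  simpa using h1

lemma exists_equiv {F : Type} [Field F] {n : ℕ} (A : Matrix (Fin n) (Fin n) F)
    (hs : Squarefree A.charpoly) :
    ∃ e : AdjoinRoot A.charpoly ≃ₗ[F] (Fin n → F),
      ∀ x, e (AdjoinRoot.root _ * x) = Matrix.toLin' A (e x) := by
  obtain ⟨v, hv⟩ := exists_cyclic A hs
  have hCH : aeval (Matrix.toLin' A) A.charpoly = 0 := by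
    rw [← Matrix.charpoly_toLin']; exact LinearMap.aeval_self_charpoly _
  let ψ : AdjoinRoot A.charpoly →ₐ[F] Module.End F (Fin n → F) :=
    Ideal.Quotient.liftₐ (Ideal.span {A.charpoly}) (aeval (Matrix.toLin' A)) (by
      intro a ha
      obtain ⟨c, rfl⟩ := Ideal.mem_span_singleton.1 ha
      rw [map_mul, hCH, zero_mul])
  have hψ : ∀ p, ψ (AdjoinRoot.mk _ p) = aeval (Matrix.toLin' A) p := fun p => rfl
  let L : AdjoinRoot A.charpoly →ₗ[F] (Fin n → F) := (LinearMap.applyₗ v) ∘ₗ ψ.toLinearMap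
  have hL : ∀ y, L y = ψ y v := fun y => rfl
  have hinj : Function.Injective L := by
    rw [injective_iff_map_eq_zero]
    intro a
    induction a using AdjoinRoot.induction_on with
    | ih p =>
      intro h
      rw [hL, hψ] at h
      exact AdjoinRoot.mk_eq_zero.2 (hv p h)
  have hne := A.charpoly_monic.ne_zero
  have : Module.Finite F (AdjoinRoot A.charpoly) := (AdjoinRoot.powerBasis hne).finite
  have hrank : Module.finrank F (AdjoinRoot A.charpoly) = Module.finrank F (Fin n → F) := by
    rw [(AdjoinRoot.powerBasis hne).finrank]
    simp [Matrix.charpoly_natDegree_eq_dim]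
  refine ⟨LinearMap.linearEquivOfInjective L hinj hrank, fun x => ?_⟩
  rw [LinearMap.linearEquivOfInjective_apply, LinearMap.linearEquivOfInjective_apply, hL, hL, map_mul]
  rw [AdjoinRoot.root, hψ, aeval_X]
  rfl

lemma charpoly_mulRoot {F : Type} [Field F] (f : F[X]) (hf : f.Monic)
    [Module.Finite F (AdjoinRoot f)] :
    (LinearMap.mulLeft F (AdjoinRoot.root f)).charpoly = f := by
  have h := charpoly_leftMulMatrix (AdjoinRoot.powerBasis hf.ne_zero)
  rw [AdjoinRoot.minpoly_powerBasis_gen_of_monic hf] at h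
  rw [← LinearMap.charpoly_toMatrix _ (AdjoinRoot.powerBasis hf.ne_zero).basis]
  exact h

lemma fiber_card {F : Type} [Field F] {n : ℕ} (A : Matrix (Fin n) (Fin n) F) (f : F[X])
    (hf : A.charpoly = f) (hs : Squarefree f) :
    Nat.card {e : AdjoinRoot f ≃ₗ[F] (Fin n → F) // 
      ∀ x, e (AdjoinRoot.root _ * x) = Matrix.toLin' A (e x)} = Nat.card (AdjoinRoot f)ˣ := by
  subst hf
  obtain ⟨e0, he0⟩ := exists_equiv A hs
  symm
  let m : (AdjoinRoot A.charpoly)ˣ → (AdjoinRoot A.charpoly ≃ₗ[F] (Fin n → F)) := fun w =>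
    LinearEquiv.trans (M₂ := AdjoinRoot A.charpoly)
      { LinearMap.mulLeft F (w : AdjoinRoot A.charpoly) with
        invFun := fun x => (w⁻¹ : (AdjoinRoot A.charpoly)ˣ) * x
        left_inv := fun x => by simp
        right_inv := fun x => by simp } e0
  have hm : ∀ w x, m w x = e0 (w * x) := fun w x => rfl
  have hmp : ∀ w x, m w (AdjoinRoot.root _ * x) = Matrix.toLin' A (m w x) := by
    intro w x
    rw [hm, hm, ← he0, mul_left_comm]
  refine Nat.card_congr (Equiv.ofBijective (fun w => (⟨m w, hmp w⟩ : {e : AdjoinRoot A.charpoly ≃ₗ[F] (Fin n → F) //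
      ∀ x, e (AdjoinRoot.root _ * x) = Matrix.toLin' A (e x)})) ⟨?_, ?_⟩)
  · intro w w' h
    have := congrArg (fun z => e0.symm (z.1 1)) h
    ext
    simpa [hm] using this
  · rintro ⟨e, he⟩
    let g : AdjoinRoot A.charpoly ≃ₗ[F] AdjoinRoot A.charpoly := e.trans e0.symm
    have hg : ∀ x, g (AdjoinRoot.root _ * x) = AdjoinRoot.root _ * g x := by
      intro x
      apply e0.injective
      rw [he0]
      simp [g, he]
    have hg' : ∀ p : F[X], ∀ x, g (AdjoinRoot.mk _ p * x) = AdjoinRoot.mk _ p * g x := by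
      intro p
      induction p using Polynomial.induction_on' with
      | add p q hp hq => intro x; rw [map_add, add_mul, map_add, hp, hq, add_mul]
      | monomial k a =>
        intro x
        rw [← C_mul_X_pow_eq_monomial, (AdjoinRoot.mk A.charpoly).map_mul, (AdjoinRoot.mk A.charpoly).map_pow, AdjoinRoot.mk_X, mul_assoc, mul_assoc]
        have h1 : ∀ y, AdjoinRoot.mk A.charpoly (C a) * y = a • y := by
          intro y; rw [Algebra.smul_def]; rfl
        rw [h1, h1, map_smul]
        congr 1
        induction k with
        | zero => simp
        | succ k ih => rw [pow_succ', mul_assoc, hg, ih, mul_assoc]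
    have hg1 : ∀ x, g x = x * g 1 := by
      intro x
      induction x using AdjoinRoot.induction_on with
      | ih p => simpa using hg' p 1
    have hu : g.symm 1 * g 1 = 1 := by rw [← hg1]; simp
    refine ⟨⟨g 1, g.symm 1, by rw [mul_comm]; exact hu, hu⟩, ?_⟩
    apply Subtype.ext
    apply LinearEquiv.ext
    intro x
    rw [hm, mul_comm, ← hg1]
    simp [g]

lemma card_equivs {F : Type} [Field F] [Fintype F] {n : ℕ} (f : F[X])
    (hf : f.Monic) (hn : f.natDegree = n) :
    Nat.card (AdjoinRoot f ≃ₗ[F] (Fin n → F)) = 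
      ∏ i : (Fin n), (Fintype.card F ^ n - Fintype.card F ^ (i : ℕ)) := by
  subst hn
  rw [← Matrix.card_GL_field]
  let e0 : AdjoinRoot f ≃ₗ[F] (Fin f.natDegree → F) := (AdjoinRoot.powerBasis hf.ne_zero).basis.equivFun
  have h1 : (AdjoinRoot f ≃ₗ[F] (Fin f.natDegree → F)) ≃ ((Fin f.natDegree → F) ≃ₗ[F] (Fin f.natDegree → F)) :=
    ⟨fun e => e0.symm.trans e, fun e => e0.trans e, fun e => by ext; simp, fun e => by ext; simp⟩
  rw [Nat.card_congr h1]
  exact Nat.card_congr ((LinearMap.GeneralLinearGroup.generalLinearEquiv F _).symm.toEquiv.trans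
    Matrix.GeneralLinearGroup.toLin.symm.toEquiv)

lemma card_charpoly_mul {F : Type} [Field F] [Fintype F] {n : ℕ} (f : F[X])
    (hf : f.Monic) (hn : f.natDegree = n) (hs : Squarefree f) :
    Nat.card {A : Matrix (Fin n) (Fin n) F // A.charpoly = f} * Nat.card (AdjoinRoot f)ˣ =
      ∏ i : (Fin n), (Fintype.card F ^ n - Fintype.card F ^ (i : ℕ)) := by
  classical
  have : Module.Finite F (AdjoinRoot f) := (AdjoinRoot.powerBasis hf.ne_zero).finite
  have : Finite (AdjoinRoot f) := Module.finite_of_finite F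
  rw [← card_equivs f hf hn]
  let conj : (AdjoinRoot f ≃ₗ[F] (Fin n → F)) → {A : Matrix (Fin n) (Fin n) F // A.charpoly = f} :=
    fun e => ⟨LinearMap.toMatrix' (e.conj (LinearMap.mulLeft F (AdjoinRoot.root f))), by
      rw [← Matrix.charpoly_toLin', Matrix.toLin'_toMatrix', LinearEquiv.charpoly_conj,
        charpoly_mulRoot f hf]⟩
  have : Finite (AdjoinRoot f ≃ₗ[F] (Fin n → F)) := Finite.of_injective (fun e => (e : AdjoinRoot f → (Fin n → F))) DFunLike.coe_injective
  rw [← Nat.card_congr (Equiv.sigmaFiberEquiv conj), Nat.card_sigma]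
  have : ∀ A, Nat.card {e // conj e = A} = Nat.card (AdjoinRoot f)ˣ := by
    rintro ⟨A, hA⟩
    rw [← fiber_card A f hA hs]
    apply Nat.card_congr
    apply Equiv.subtypeEquivRight
    intro e
    rw [Subtype.ext_iff]
    change LinearMap.toMatrix' _ = A ↔ _
    rw [← LinearEquiv.eq_symm_apply, LinearMap.toMatrix'_symm]
    constructor
    · intro h x
      rw [← h]
      simp [LinearEquiv.conj_apply]
    · intro h
      refine LinearMap.ext fun y => ?_
      obtain ⟨x, rfl⟩ := e.surjective y
      rw [← h]
      simp [LinearEquiv.conj_apply]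
  simp only [this]
  simp

/-- Monic irreducible polynomials. -/
abbrev MIrr (F : Type) [Field F] : Type := {p : F[X] // p.Monic ∧ Irreducible p}

lemma mirr_coprime {F : Type} [Field F] (p p' : MIrr F) (h : p ≠ p') : IsCoprime p.1 p'.1 := by
  rw [p.2.2.coprime_iff_not_dvd]
  intro hd
  exact h (Subtype.ext (eq_of_monic_of_associated p.2.1 p'.2.1 (p.2.2.associated_of_dvd p'.2.2 hd)))

lemma card_units_mul {F : Type} [Field F] (f g : F[X]) (h : IsCoprime f g) :
    Nat.card (AdjoinRoot (f * g))ˣ = Nat.card (AdjoinRoot f)ˣ * Nat.card (AdjoinRoot g)ˣ := by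
  have e : AdjoinRoot (f * g) ≃+* AdjoinRoot f × AdjoinRoot g :=
    (Ideal.quotEquivOfEq (Ideal.span_singleton_mul_span_singleton f g).symm).trans
      (Ideal.quotientMulEquivQuotientProd (Ideal.span {f}) (Ideal.span {g})
        ((Ideal.isCoprime_span_singleton_iff f g).2 h))
  rw [Nat.card_congr (Units.mapEquiv e.toMulEquiv).toEquiv, Nat.card_congr MulEquiv.prodUnits.toEquiv,
    Nat.card_prod]

lemma card_units_irr {F : Type} [Field F] [Fintype F] (p : MIrr F) :
    (Nat.card (AdjoinRoot p.1)ˣ : ℝ) = (Fintype.card F : ℝ) ^ p.1.natDegree - 1 := by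
  have : Fact (Irreducible p.1) := ⟨p.2.2⟩
  have : Module.Finite F (AdjoinRoot p.1) := (AdjoinRoot.powerBasis p.2.1.ne_zero).finite
  have : Finite (AdjoinRoot p.1) := Module.finite_of_finite F
  have h : Nat.card (AdjoinRoot p.1) = Fintype.card F ^ p.1.natDegree := by
    rw [Module.natCard_eq_pow_finrank (K := F), (AdjoinRoot.powerBasis p.2.1.ne_zero).finrank, Nat.card_eq_fintype_card]
    simp
  rw [Nat.card_units, h, Nat.cast_sub (Nat.one_le_pow _ _ Fintype.card_pos)]
  simp

lemma card_units_prod {F : Type} [Field F] [Fintype F] (S : Finset (MIrr F)) :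
    (Nat.card (AdjoinRoot (∏ p ∈ S, p.1))ˣ : ℝ) = ∏ p ∈ S, ((Fintype.card F : ℝ) ^ p.1.natDegree - 1) := by
  classical
  induction S using Finset.induction_on with
  | empty =>
    have key : ∀ f : F[X], f = 1 → Nat.card (AdjoinRoot f)ˣ = 1 := by
      rintro f hf
      have h1 : (1 : AdjoinRoot f) = 0 := by
        rw [← map_one (AdjoinRoot.mk f), ← hf]; exact AdjoinRoot.mk_self
      have : Subsingleton (AdjoinRoot f) := subsingleton_of_zero_eq_one h1.symm
      have : Subsingleton (AdjoinRoot f)ˣ := ⟨fun a b => Units.ext (Subsingleton.elim _ _)⟩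
      exact Nat.card_of_subsingleton 1
    rw [key _ Finset.prod_empty]
    simp
  | insert a S ha ih =>
    rw [Finset.prod_insert ha, Finset.prod_insert ha, card_units_mul, Nat.cast_mul, ih, card_units_irr]
    exact IsCoprime.prod_right fun i hi => mirr_coprime _ _ (by rintro rfl; exact ha hi)

lemma mirr_prod_monic {F : Type} [Field F] (S : Finset (MIrr F)) : (∏ p ∈ S, p.1).Monic :=
  monic_prod_of_monic _ _ fun p _ => p.2.1

lemma mirr_prod_squarefree {F : Type} [Field F] (S : Finset (MIrr F)) : Squarefree (∏ p ∈ S, p.1) :=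
  Finset.squarefree_prod_of_pairwise_isCoprime
    (fun p _ p' _ h => (mirr_coprime p p' h).isRelPrime) fun p _ => p.2.2.squarefree

lemma mirr_prod_natDegree {F : Type} [Field F] (S : Finset (MIrr F)) :
    (∏ p ∈ S, p.1).natDegree = ∑ p ∈ S, p.1.natDegree :=
  natDegree_prod_of_monic _ _ fun p _ => p.2.1

lemma mirr_dvd_prod {F : Type} [Field F] (S : Finset (MIrr F)) (p : MIrr F) :
    p.1 ∣ ∏ p ∈ S, p.1 ↔ p ∈ S := by
  constructor
  · intro h
    obtain ⟨a, ha, hd⟩ := (p.2.2.prime.dvd_finsetProd_iff _).1 h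
    by_contra hn
    have hne : p ≠ a := by rintro rfl; exact hn ha
    exact (p.2.2.coprime_iff_not_dvd.1 (mirr_coprime p a hne)) hd
  · intro h
    exact Finset.dvd_prod_of_mem _ h

lemma mirr_prod_exists {F : Type} [Field F] (f : F[X]) (hf : f.Monic) (hs : Squarefree f) :
    ∃ S : Finset (MIrr F), ∏ p ∈ S, p.1 = f := by
  classical
  have hfin : Set.Finite {p : MIrr F | p.1 ∣ f} := by
    have : Set.Finite ((fun p : MIrr F => p.1) '' {p : MIrr F | p.1 ∣ f}) := by
      refine Set.Finite.subset (UniqueFactorizationMonoid.normalizedFactors f).toFinset.finite_toSet ?_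
      rintro _ ⟨p, hp, rfl⟩
      simp only [Finset.mem_coe, Multiset.mem_toFinset]
      rw [UniqueFactorizationMonoid.mem_normalizedFactors_iff' hf.ne_zero]
      exact ⟨p.2.2, p.2.1.normalize_eq_self, hp⟩
    exact this.of_finite_image Subtype.val_injective.injOn
  refine ⟨hfin.toFinset, eq_of_monic_of_associated (mirr_prod_monic _) hf (associated_of_dvd_dvd ?_ ?_)⟩
  · apply Finset.prod_dvd_of_coprime
    · intro p _ p' _ h
      exact mirr_coprime p p' h
    · intro p hp
      simpa using hp
  · by_contra hcon
    apply hcon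
    refine (UniqueFactorizationMonoid.dvd_iff_normalizedFactors_le_normalizedFactors hs.ne_zero (mirr_prod_monic _).ne_zero).2 ?_
    rw [Multiset.le_iff_subset ((UniqueFactorizationMonoid.squarefree_iff_nodup_normalizedFactors hs.ne_zero).1 hs)]
    intro φ hφ
    rw [UniqueFactorizationMonoid.mem_normalizedFactors_iff' hs.ne_zero] at hφ
    rw [UniqueFactorizationMonoid.mem_normalizedFactors_iff' (mirr_prod_monic _).ne_zero]
    refine ⟨hφ.1, hφ.2.1, ?_⟩
    have hm : φ.Monic := by rw [← hφ.2.1]; exact monic_normalize hφ.1.ne_zero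
    exact (mirr_dvd_prod _ ⟨φ, hm, hφ.1⟩).2 (by simpa using hφ.2.2)

/-- Total degree of a finite set of monic irreducibles. -/
noncomputable def totDeg {F : Type} [Field F] (S : Finset (MIrr F)) : ℕ := ∑ p ∈ S, p.1.natDegree

lemma finite_monic_deg {F : Type} [Field F] [Fintype F] (n : ℕ) : 
    Nat.card {f : F[X] // f.Monic ∧ f.natDegree = n} = Fintype.card F ^ n ∧
    Finite {f : F[X] // f.Monic ∧ f.natDegree = n} := by
  have e := (Polynomial.monicEquivDegreeLT (R := F) n).trans (Polynomial.degreeLTEquiv F n).toEquiv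
  have e' : {f : F[X] // f.Monic ∧ f.natDegree = n} ≃ (Fin n → F) := e
  exact ⟨by rw [Nat.card_congr e']; simp, Finite.of_equiv _ e'.symm⟩

lemma mirr_prod_inj {F : Type} [Field F] (S T : Finset (MIrr F)) (h : ∏ p ∈ S, p.1 = ∏ p ∈ T, p.1) :
    S = T := by
  ext p
  rw [← mirr_dvd_prod, h, mirr_dvd_prod]

instance finite_fiber {F : Type} [Field F] [Fintype F] (n : ℕ) :
    Finite {S : Finset (MIrr F) // totDeg S = n} := by
  have := (finite_monic_deg (F := F) n).2
  refine Finite.of_injective (β := {f : F[X] // f.Monic ∧ f.natDegree = n})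
    (fun S => ⟨∏ p ∈ S.1, p.1, mirr_prod_monic _, by rw [mirr_prod_natDegree]; exact S.2⟩) ?_
  intro S T h
  exact Subtype.ext (mirr_prod_inj _ _ (congrArg Subtype.val h))

lemma card_sqfree {F : Type} [Field F] [Fintype F] (n : ℕ) 
    [Fintype {S : Finset (MIrr F) // totDeg S = n}] :
    Nat.card {A : Matrix (Fin n) (Fin n) F // Squarefree A.charpoly} =
      ∑ S : {S : Finset (MIrr F) // totDeg S = n},
        Nat.card {A : Matrix (Fin n) (Fin n) F // A.charpoly = ∏ p ∈ S.1, p.1} := by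
  rw [← Nat.card_sigma]
  symm
  refine Nat.card_congr (Equiv.ofBijective (fun x : (Σ S : {S : Finset (MIrr F) // totDeg S = n}, {A : Matrix (Fin n) (Fin n) F // A.charpoly = ∏ p ∈ S.1, p.1}) => 
    (⟨x.2.1, by rw [x.2.2]; exact mirr_prod_squarefree _⟩ : {A : Matrix (Fin n) (Fin n) F // Squarefree A.charpoly})) ⟨?_, ?_⟩)
  · rintro ⟨⟨S, hS⟩, ⟨A, hA⟩⟩ ⟨⟨T, hT⟩, ⟨B, hB⟩⟩ h
    obtain rfl : A = B := congrArg Subtype.val h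
    obtain rfl : S = T := mirr_prod_inj _ _ (hA.symm.trans hB)
    rfl
  · rintro ⟨A, hA⟩
    obtain ⟨S, hS⟩ := mirr_prod_exists _ A.charpoly_monic hA
    refine ⟨⟨⟨S, ?_⟩, ⟨A, hS.symm⟩⟩, rfl⟩
    rw [totDeg, ← mirr_prod_natDegree, hS]
    simp [Matrix.charpoly_natDegree_eq_dim]

lemma one_lt_q (F : Type) [Field F] [Fintype F] : (1 : ℝ) < Fintype.card F := by
  exact_mod_cast Fintype.one_lt_card

lemma term_eq {F : Type} [Field F] [Fintype F] (u : ℝ) (n : ℕ)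
    [Fintype {S : Finset (MIrr F) // totDeg S = n}] :
    u ^ n * (Nat.card {A : Matrix (Fin n) (Fin n) F // Squarefree A.charpoly} : ℝ) /
        ∏ i ∈ Finset.range n, ((Fintype.card F : ℝ) ^ n - (Fintype.card F : ℝ) ^ i) =
    ∑ S : {S : Finset (MIrr F) // totDeg S = n},
      ∏ p ∈ S.1, u ^ p.1.natDegree / ((Fintype.card F : ℝ) ^ p.1.natDegree - 1) := by
  rw [card_sqfree, Nat.cast_sum, Finset.mul_sum, Finset.sum_div]
  refine Finset.sum_congr rfl fun S _ => ?_
  have hq := one_lt_q F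
  have h := card_charpoly_mul (n := n) (∏ p ∈ S.1, p.1) (mirr_prod_monic _)
    (by rw [mirr_prod_natDegree]; exact S.2) (mirr_prod_squarefree _)
  have h' := congrArg (Nat.cast : ℕ → ℝ) h
  rw [Nat.cast_mul, card_units_prod, Nat.cast_prod] at h'
  have h2 : ∏ i ∈ Finset.range n, ((Fintype.card F : ℝ) ^ n - (Fintype.card F : ℝ) ^ i) =
    ∏ i : Fin n, ((Fintype.card F ^ n - Fintype.card F ^ (i : ℕ) : ℕ) : ℝ) := by
    rw [Finset.prod_range]
    refine Finset.prod_congr rfl fun i _ => ?_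
    rw [Nat.cast_sub (Nat.pow_le_pow_right Fintype.card_pos i.2.le)]
    simp
  have h0 : ∏ i ∈ Finset.range n, ((Fintype.card F : ℝ) ^ n - (Fintype.card F : ℝ) ^ i) ≠ 0 := by
    rw [Finset.prod_ne_zero_iff]
    intro i hi
    have := pow_lt_pow_right₀ hq (Finset.mem_range.1 hi)
    linarith
  rw [Finset.prod_div_distrib, Finset.prod_pow_eq_pow_sum]
  have hS : ∑ i ∈ S.1, i.1.natDegree = n := S.2
  have h3 : ∏ p ∈ S.1, ((Fintype.card F : ℝ) ^ p.1.natDegree - 1) ≠ 0 := by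
    rw [Finset.prod_ne_zero_iff]
    intro p _
    have := one_lt_pow₀ hq p.2.2.natDegree_pos.ne'
    linarith
  rw [hS, div_eq_div_iff h0 h3, h2, ← h']
  ring

/-- Monic polynomials. -/
abbrev Mon (F : Type) [Field F] : Type := {f : F[X] // f.Monic}

lemma mon_fiber_hasSum {F : Type} [Field F] [Fintype F] (u : ℝ) (n : ℕ) :
    HasSum (fun f : {f : Mon F // f.1.natDegree = n} => (u / Fintype.card F) ^ f.1.1.natDegree) (u ^ n) := by
  have hq := one_lt_q F
  obtain ⟨h1, h2⟩ := finite_monic_deg (F := F) n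
  have e : {f : Mon F // f.1.natDegree = n} ≃ {f : F[X] // f.Monic ∧ f.natDegree = n} :=
    Equiv.subtypeSubtypeEquivSubtypeInter (fun f : F[X] => f.Monic) (fun f => f.natDegree = n)
  have : Finite {f : Mon F // f.1.natDegree = n} := Finite.of_equiv _ e.symm
  have := Fintype.ofFinite {f : Mon F // f.1.natDegree = n}
  have hc : Fintype.card {f : Mon F // f.1.natDegree = n} = Fintype.card F ^ n := by
    rw [← Nat.card_eq_fintype_card, Nat.card_congr e, h1]
  convert hasSum_fintype (fun f : {f : Mon F // f.1.natDegree = n} => (u / Fintype.card F) ^ f.1.1.natDegree) using 1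
  rw [Finset.sum_congr rfl (fun f _ => by rw [f.2]), Finset.sum_const, Finset.card_univ, hc, nsmul_eq_mul,
    div_pow]
  push_cast
  field_simp

lemma mon_hasSum {F : Type} [Field F] [Fintype F] (u : ℝ) (hu0 : 0 ≤ u) (hu1 : u < 1) :
    HasSum (fun f : Mon F => (u / Fintype.card F) ^ f.1.natDegree) (1 - u)⁻¹ := by
  let e := Equiv.sigmaFiberEquiv (fun f : Mon F => f.1.natDegree)
  have hs : Summable ((fun f : Mon F => (u / Fintype.card F) ^ f.1.natDegree) ∘ e) := by
    rw [summable_sigma_of_nonneg (fun x => by simp only [Function.comp]; positivity)]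
    refine ⟨fun n => (mon_fiber_hasSum u n).summable, ?_⟩
    refine (summable_geometric_of_lt_one hu0 hu1).congr fun n => ?_
    exact (mon_fiber_hasSum u n).tsum_eq.symm
  have h := hs.hasSum.sigma (fun n => mon_fiber_hasSum u n)
  have h2 := h.unique (hasSum_geometric_of_lt_one hu0 hu1)
  rw [← e.hasSum_iff, ← h2]
  exact hs.hasSum

open Classical in
/-- Sum over monic polynomials coprime to `S`. -/
noncomputable def sieveT {F : Type} [Field F] (x : ℝ) (S : Finset (MIrr F)) (f : Mon F) : ℝ :=
  if ∀ p ∈ S, ¬ p.1 ∣ f.1 then x ^ f.1.natDegree else 0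

lemma sieve_summable {F : Type} [Field F] (x : ℝ) (hx : 0 ≤ x) (S : Finset (MIrr F))
    (hs : Summable (fun f : Mon F => x ^ f.1.natDegree)) : Summable (sieveT x S) := by
  refine hs.of_nonneg_of_le (fun f => ?_) (fun f => ?_)
  · unfold sieveT; split_ifs <;> positivity
  · unfold sieveT; split_ifs
    · exact le_rfl
    · positivity

lemma sieve_insert {F : Type} [Field F] (x : ℝ) (hx : 0 ≤ x) (S : Finset (MIrr F)) (p : MIrr F)
    (hp : p ∉ S) [DecidableEq (MIrr F)]
    (hs : Summable (fun f : Mon F => x ^ f.1.natDegree)) :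
    ∑' f, sieveT x (insert p S) f = (1 - x ^ p.1.natDegree) * ∑' f, sieveT x S f := by
  classical
  let m : Mon F → Mon F := fun g => ⟨p.1 * g.1, p.2.1.mul g.2⟩
  have hm : Function.Injective m := fun g g' h =>
    Subtype.ext (mul_left_cancel₀ p.2.1.ne_zero (congrArg Subtype.val h))
  let R : Mon F → ℝ := fun f => if p.1 ∣ f.1 then sieveT x S f else 0
  have h1 : ∀ f, R f = sieveT x S f - sieveT x (insert p S) f := by
    intro f
    simp only [R, sieveT, Finset.forall_mem_insert]
    by_cases a : p.1 ∣ f.1 <;> simp [a]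
  have h2 : ∀ g, R (m g) = x ^ p.1.natDegree * sieveT x S g := by
    intro g
    have : ∀ r ∈ S, (r.1 ∣ p.1 * g.1 ↔ r.1 ∣ g.1) := by
      intro r hr
      refine ⟨fun h => ?_, fun h => h.mul_left _⟩
      exact (mirr_coprime r p (by rintro rfl; exact hp hr)).dvd_of_dvd_mul_left h
    have h3 : (∀ r ∈ S, ¬ r.1 ∣ p.1 * g.1) ↔ (∀ r ∈ S, ¬ r.1 ∣ g.1) := by
      refine forall₂_congr fun r hr => ?_
      rw [this r hr]
    simp only [R, m, sieveT, dvd_mul_right, if_true, h3, p.2.1.natDegree_mul g.2, pow_add]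
    split_ifs <;> simp
  have h4 : ∑' g, R (m g) = ∑' f, R f := by
    apply hm.tsum_eq
    intro f hf
    have : p.1 ∣ f.1 := by
      by_contra hcon
      exact hf (by simp [R, hcon])
    obtain ⟨c, hc⟩ := this
    refine ⟨⟨c, ?_⟩, Subtype.ext hc.symm⟩
    exact p.2.1.of_mul_monic_left (hc ▸ f.2)
  simp_rw [h2, h1] at h4
  rw [tsum_mul_left, (sieve_summable x hx S hs).tsum_sub (sieve_summable x hx _ hs)] at h4
  linarith

lemma sieve_prod {F : Type} [Field F] (x : ℝ) (hx : 0 ≤ x) (S : Finset (MIrr F))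
    (hs : Summable (fun f : Mon F => x ^ f.1.natDegree)) :
    ∑' f, sieveT x S f = (∏ p ∈ S, (1 - x ^ p.1.natDegree)) * ∑' f : Mon F, x ^ f.1.natDegree := by
  classical
  induction S using Finset.induction_on with
  | empty => simp [sieveT]
  | insert a S ha ih => rw [sieve_insert x hx S a ha hs, ih, Finset.prod_insert ha, mul_assoc]

lemma euler_hasProd {F : Type} [Field F] [Fintype F] (u : ℝ) (hu0 : 0 ≤ u) (hu1 : u < 1) :
    HasProd (fun p : MIrr F => 1 - (u / Fintype.card F) ^ p.1.natDegree) (1 - u) := by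
  classical
  have hS := mon_hasSum (F := F) u hu0 hu1
  set x : ℝ := u / Fintype.card F with hxdef
  have hx : 0 ≤ x := by positivity
  have h1 : ∀ S : Finset (MIrr F), (∏ p ∈ S, (1 - x ^ p.1.natDegree)) = (∑' f, sieveT x S f) * (1 - u) := by
    intro S
    rw [sieve_prod x hx S hS.summable, hS.tsum_eq, mul_assoc, inv_mul_cancel₀ (by linarith), mul_one]
  have h2 : Filter.Tendsto (fun S : Finset (MIrr F) => ∑' f, sieveT x S f) Filter.atTop
      (nhds (∑' f : Mon F, if f = ⟨1, monic_one⟩ then (1 : ℝ) else 0)) := by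
    refine tendsto_tsum_of_dominated_convergence hS.summable (fun f => ?_) (Filter.Eventually.of_forall fun S f => ?_)
    · by_cases hf : f = ⟨1, monic_one⟩
      · subst hf
        refine tendsto_const_nhds.congr fun S => ?_
        have : ∀ p ∈ S, ¬ p.1 ∣ (1 : F[X]) := fun p _ h => p.2.2.not_isUnit (isUnit_of_dvd_one h)
        simp only [sieveT]
        rw [if_pos this]
        simp
      · have hnu : ¬ IsUnit f.1 := fun h => hf (Subtype.ext (f.2.eq_one_of_isUnit h))
        obtain ⟨p, hpm, hpi, hpd⟩ := Polynomial.exists_monic_irreducible_factor f.1 hnu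
        rw [if_neg hf]
        refine tendsto_const_nhds.congr' ?_
        filter_upwards [Filter.eventually_ge_atTop ({⟨p, hpm, hpi⟩} : Finset (MIrr F))] with S hS
        simp only [sieveT]
        rw [if_neg]
        intro h
        exact h ⟨p, hpm, hpi⟩ (hS (by simp)) hpd
    · unfold sieveT
      split_ifs
      · rw [Real.norm_of_nonneg (by positivity)]
      · simp; positivity
  rw [tsum_ite_eq] at h2
  have h3 := h2.mul_const (1 - u)
  rw [one_mul] at h3
  change Filter.Tendsto _ _ _
  exact h3.congr fun S => (h1 S).symm

lemma mirr_summable {F : Type} [Field F] [Fintype F] (u : ℝ) (hu0 : 0 ≤ u) (hu1 : u < 1) :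
    Summable (fun p : MIrr F => u ^ p.1.natDegree / ((Fintype.card F : ℝ) ^ p.1.natDegree - 1)) := by
  have hq := one_lt_q F
  have hq2 : (2 : ℝ) ≤ Fintype.card F := by exact_mod_cast Fintype.one_lt_card (α := F)
  have h : ∀ p : MIrr F, 2 ≤ (Fintype.card F : ℝ) ^ p.1.natDegree := fun p =>
    hq2.trans (le_self_pow₀ hq.le p.2.2.natDegree_pos.ne')
  have hs := ((mon_hasSum (F := F) u hu0 hu1).summable.comp_injective
    (i := fun p : MIrr F => (⟨p.1, p.2.1⟩ : Mon F)) 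
    (fun p p' h => Subtype.ext (congrArg (fun z : Mon F => z.1) h))).mul_left 2
  refine hs.of_nonneg_of_le (fun p => ?_) (fun p => ?_)
  · have := h p
    exact div_nonneg (by positivity) (by linarith)
  · have := h p
    simp only [Function.comp]
    rw [div_pow, ← mul_div_assoc, div_le_div_iff₀ (by linarith) (by linarith)]
    have hp : 0 ≤ u ^ p.1.natDegree := by positivity
    nlinarith

/-- With `S_M(u,q) = ∑_{n=0}^∞ uⁿ · #{n×n matrices with squarefree char. poly}/|GL(n,q)|`
(where `|GL(n,q)| = ∏_{i=0}^{n−1}(qⁿ − qⁱ)`), one has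
`S_M(u,q) = (∏_{d=1}^∞ (1 − u^d(u^d − 1)/(q^d(q^d − 1)))^{N_d(q)}) / (1 − u)`. -/
theorem separable_generating_function_product_form {F : Type} [Field F] [Fintype F] (q : ℕ)
    (hq : Fintype.card F = q) (u : ℝ) (hu0 : 0 ≤ u) (hu1 : u < 1) :
    ∑' n : ℕ, u ^ n *
        (Nat.card {A : Matrix (Fin n) (Fin n) F // Squarefree A.charpoly} : ℝ) /
        ∏ i ∈ Finset.range n, ((q : ℝ) ^ n - (q : ℝ) ^ i) =
      (∏' d : ℕ,
          (1 - u ^ (d + 1) * (u ^ (d + 1) - 1) / ((q : ℝ) ^ (d + 1) * ((q : ℝ) ^ (d + 1) - 1)))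
            ^ numMonicIrred F (d + 1)) / (1 - u) := by
  subst hq
  classical
  have hq := one_lt_q F
  have hsum := mirr_summable (F := F) u hu0 hu1
  set a : MIrr F → ℝ := fun p => u ^ p.1.natDegree / ((Fintype.card F : ℝ) ^ p.1.natDegree - 1) with ha
  have hgt : ∀ p : MIrr F, 1 < (Fintype.card F : ℝ) ^ p.1.natDegree := fun p =>
    one_lt_pow₀ hq p.2.2.natDegree_pos.ne'
  have ha0 : ∀ p, 0 ≤ a p := fun p => div_nonneg (by positivity) (by linarith [hgt p])
  have hfs := (summable_finsetProd_of_summable_nonneg ha0 hsum).hasSum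
  set SM : ℝ := ∑' S : Finset (MIrr F), ∏ p ∈ S, a p with hSM
  have hprod := hasProd_one_add_of_hasSum_prod hfs
  -- the left-hand side
  have hL : ∑' n : ℕ, u ^ n *
        (Nat.card {A : Matrix (Fin n) (Fin n) F // Squarefree A.charpoly} : ℝ) /
        ∏ i ∈ Finset.range n, ((Fintype.card F : ℝ) ^ n - (Fintype.card F : ℝ) ^ i) = SM := by
    apply HasSum.tsum_eq
    rw [← (Equiv.sigmaFiberEquiv (fun S : Finset (MIrr F) => totDeg S)).hasSum_iff] at hfs
    refine hfs.sigma fun n => ?_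
    have := Fintype.ofFinite {S : Finset (MIrr F) // totDeg S = n}
    rw [term_eq]
    exact hasSum_fintype _
  -- the right-hand side
  have hR := hprod.mul (euler_hasProd (F := F) u hu0 hu1)
  rw [← (Equiv.sigmaFiberEquiv (fun p : MIrr F => p.1.natDegree - 1)).hasProd_iff] at hR
  have hR2 := hR.sigma (g := fun d => 
          (1 - u ^ (d + 1) * (u ^ (d + 1) - 1) / ((Fintype.card F : ℝ) ^ (d + 1) * ((Fintype.card F : ℝ) ^ (d + 1) - 1)))
            ^ numMonicIrred F (d + 1)) (fun d => by
    have e : {p : MIrr F // p.1.natDegree - 1 = d} ≃ {p : F[X] // p.Monic ∧ Irreducible p ∧ p.natDegree = d + 1} :=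
      { toFun := fun p => ⟨p.1.1, p.1.2.1, p.1.2.2, by
          have := p.1.2.2.natDegree_pos; have := p.2; omega⟩
        invFun := fun p => ⟨⟨p.1, p.2.1, p.2.2.1⟩, by have := p.2.2.2; simp only; omega⟩
        left_inv := fun p => rfl
        right_inv := fun p => rfl }
    have hfin := (finite_monic_deg (F := F) (d + 1)).2
    have : Finite {p : F[X] // p.Monic ∧ Irreducible p ∧ p.natDegree = d + 1} :=
      Finite.of_injective (β := {f : F[X] // f.Monic ∧ f.natDegree = d + 1}) 
        (fun p => ⟨p.1, p.2.1, p.2.2.2⟩) (fun p p' h => Subtype.ext (congrArg (fun z => z.1) h))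
    have : Finite {p : MIrr F // p.1.natDegree - 1 = d} := Finite.of_equiv _ e.symm
    have := Fintype.ofFinite {p : MIrr F // p.1.natDegree - 1 = d}
    have hc : numMonicIrred F (d + 1) = (Finset.univ : Finset {p : MIrr F // p.1.natDegree - 1 = d}).card := by
      rw [numMonicIrred, Finset.card_univ, ← Nat.card_eq_fintype_card, Nat.card_congr e]
    rw [hc, ← Finset.prod_const]
    convert hasProd_fintype _ using 1
    refine Finset.prod_congr rfl fun p _ => ?_
    have hd : p.1.1.natDegree = d + 1 := by
      have := p.1.2.2.natDegree_pos; have := p.2; omega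
    have h1 := hgt p.1
    simp only [Function.comp, Equiv.sigmaFiberEquiv, Equiv.coe_fn_mk, ha, div_pow]
    rw [hd] at h1 ⊢
    have h2 : (Fintype.card F : ℝ) ^ (d + 1) - 1 ≠ 0 := by linarith
    have h3 : (Fintype.card F : ℝ) ^ (d + 1) ≠ 0 := by linarith
    field_simp
    ring)
  rw [hL, hR2.tprod_eq, mul_div_assoc, div_self (by linarith), mul_one]
end
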